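/- Let m, n ≥ 1. A triple (x, y, z) with x ∈ ℝ^{m+n}, y ∈ ℝ^m, z ∈ ℝ^n, each a decreasing sequence, belongs to LR(m,n) if and only if: (i) |x| = |y| + |z| (sums of all coordinates); (ii) x_{n+k} ≤ y_k ≤ x_k for all k ∈ [m]; (iii) x_{m+ℓ} ≤ z_ℓ ≤ x_ℓ for all ℓ ∈ [n]; and (iv) |x|_A ≥ |y|_B + |z|_C for every triple (A,B,C) where B is a strict subset of [m], C is a strict subset of [n], A ⊂ [m+n] with #A = #B + #C, and (μ(A), μ(B), μ(C)) ∈ LR(#B, #C). -/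

import Mathlib

open Matrix

/-- Eigenvalues of a (Hermitian) complex matrix, listed in decreasing order. -/
noncomputable def eigVec {k : ℕ} (X : Matrix (Fin k) (Fin k) ℂ) (hX : X.IsHermitian) :
    Fin k → ℝ :=
  fun i => hX.eigenvalues (Tuple.sort hX.eigenvalues i.rev)

/-- The `i`-th (0-based) singular value of a rectangular complex matrix:
the square root of the `i`-th largest eigenvalue of `Y * Yᴴ` (and `0` for `i ≥ a`). -/
noncomputable def sval {a b : ℕ} (Y : Matrix (Fin a) (Fin b) ℂ) (i : ℕ) : ℝ :=
  if h : i < a then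
    Real.sqrt (eigVec (Y * Yᴴ) (Matrix.isHermitian_mul_conjTranspose_self Y) ⟨i, h⟩)
  else 0

/-- The Horn cone `Horn(k)`. -/
def Horn (k : ℕ) : Set ((Fin k → ℝ) × (Fin k → ℝ) × (Fin k → ℝ)) :=
  { v | ∃ (X Y : Matrix (Fin k) (Fin k) ℂ) (hX : X.IsHermitian) (hY : Y.IsHermitian),
      v.1 = eigVec X hX ∧ v.2.1 = eigVec Y hY ∧ v.2.2 = eigVec (X + Y) (hX.add hY) }

/-- The Littlewood–Richardson cone `LR(m,n)`. -/
def LRcone (m n : ℕ) : Set ((Fin (m + n) → ℝ) × (Fin m → ℝ) × (Fin n → ℝ)) :=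
  { v | ∃ (M : Matrix (Fin (m + n)) (Fin (m + n)) ℂ) (hM : M.IsHermitian),
      v.1 = eigVec M hM ∧
      v.2.1 = eigVec (M.submatrix (Fin.castAdd n) (Fin.castAdd n))
        (hM.submatrix (Fin.castAdd n)) ∧
      v.2.2 = eigVec (M.submatrix (Fin.natAdd m) (Fin.natAdd m))
        (hM.submatrix (Fin.natAdd m)) }

/-- Top-left `p × p` block. -/
def blockTL (p q : ℕ) (X : Matrix (Fin (p + q)) (Fin (p + q)) ℂ) : Matrix (Fin p) (Fin p) ℂ :=
  X.submatrix (Fin.castAdd q) (Fin.castAdd q)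

/-- Top-right `p × q` block. -/
def blockTR (p q : ℕ) (X : Matrix (Fin (p + q)) (Fin (p + q)) ℂ) : Matrix (Fin p) (Fin q) ℂ :=
  X.submatrix (Fin.castAdd q) (Fin.natAdd p)

/-- Bottom-left `q × p` block. -/
def blockBL (p q : ℕ) (X : Matrix (Fin (p + q)) (Fin (p + q)) ℂ) : Matrix (Fin q) (Fin p) ℂ :=
  X.submatrix (Fin.natAdd p) (Fin.castAdd q)

/-- Bottom-right `q × q` block. -/
def blockBR (p q : ℕ) (X : Matrix (Fin (p + q)) (Fin (p + q)) ℂ) : Matrix (Fin q) (Fin q) ℂ :=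
  X.submatrix (Fin.natAdd p) (Fin.natAdd p)

/-- `λ* = (−λ_k, …, −λ_1)`. -/
def starVec {k : ℕ} (x : Fin k → ℝ) : Fin k → ℝ := fun i => -x i.rev

/-- `ŝ^{p,q} = (s₁, …, s_q, 0, …, 0, −s_q, …, −s₁) ∈ ℝ^{p+q}` (with `p − q` middle zeros). -/
noncomputable def hatPQ (p q : ℕ) (s : Fin q → ℝ) : Fin (p + q) → ℝ :=
  fun i =>
    if h : (i : ℕ) < q then s ⟨i, h⟩
    else if h' : (i : ℕ) < p then 0
    else -s ⟨p + q - 1 - i, by have := i.isLt; omega⟩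

/-- The cone `A(p,q)`: pairs `(e(X), s(X₁₂))` for `X` Hermitian of size `p+q`. -/
def coneA (p q : ℕ) : Set ((Fin (p + q) → ℝ) × (Fin q → ℝ)) :=
  { v | ∃ (X : Matrix (Fin (p + q)) (Fin (p + q)) ℂ) (hX : X.IsHermitian),
      v.1 = eigVec X hX ∧ ∀ i : Fin q, v.2 i = sval (blockTR p q X) (i : ℕ) }

/-- The cone `S(p,q)`: triples `(s(X), s(X₁₂), s(X₂₁))`. -/
def coneS (p q : ℕ) : Set ((Fin (p + q) → ℝ) × (Fin q → ℝ) × (Fin q → ℝ)) :=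
  { v | ∃ X : Matrix (Fin (p + q)) (Fin (p + q)) ℂ,
      (∀ i : Fin (p + q), v.1 i = sval X (i : ℕ)) ∧
      (∀ i : Fin q, v.2.1 i = sval (blockTR p q X) (i : ℕ)) ∧
      (∀ i : Fin q, v.2.2 i = sval (blockBL p q X) (i : ℕ)) }

/-- The cone `T(p,q)`: triples `(s(X), s(X₁₁), s(X₂₂))`. -/
def coneT (p q : ℕ) : Set ((Fin (p + q) → ℝ) × (Fin p → ℝ) × (Fin q → ℝ)) :=
  { v | ∃ X : Matrix (Fin (p + q)) (Fin (p + q)) ℂ,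
      (∀ i : Fin (p + q), v.1 i = sval X (i : ℕ)) ∧
      (∀ i : Fin p, v.2.1 i = sval (blockTL p q X) (i : ℕ)) ∧
      (∀ i : Fin q, v.2.2 i = sval (blockBR p q X) (i : ℕ)) }

/-- `μ(A) = (a_r − r ≥ … ≥ a₂ − 2 ≥ a₁ − 1)` as a decreasing real vector, for
`A = {a₁ < … < a_r}` a subset of `[n]` (0-based indexing internally). -/
noncomputable def muVec {n r : ℕ} (A : Finset (Fin n)) (h : A.card = r) : Fin r → ℝ :=
  fun k => (((A.orderIsoOfFin h k.rev : Fin n) : ℕ) : ℝ) - ((k.rev : ℕ) : ℝ)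

/-- `A^o = {ℓ + 1 − a : a ∈ A}` inside `[ℓ]`. -/
def opp {n : ℕ} (A : Finset (Fin n)) : Finset (Fin n) := A.image Fin.rev

/-- `|s|_{K ∩ [q]}` where `K ⊆ [n]`, `s ∈ ℝ^q` and `[q]` is viewed inside `[n]`. -/
noncomputable def sumRestr {n q : ℕ} (s : Fin q → ℝ) (K : Finset (Fin n)) : ℝ :=
  ∑ i ∈ K, (if h : (i : ℕ) < q then s ⟨i, h⟩ else 0)

/-- The augmented matrix `Ŷ^{p,q} = [[0, Y], [Yᴴ, 0]]` of size `p + q`. -/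
def hatM (p q : ℕ) (Y : Matrix (Fin p) (Fin q) ℂ) : Matrix (Fin (p + q)) (Fin (p + q)) ℂ :=
  Matrix.reindex finSumFinEquiv finSumFinEquiv (Matrix.fromBlocks 0 Y Yᴴ 0)

/-- A partial order which is the disjoint union of at most two chains ("blocks"). -/
class BlockOrder (T : Type) extends PartialOrder T where
  /-- The block of an element. -/
  blk : T → Bool
  blk_eq_iff : ∀ a b : T, blk a = blk b ↔ a ≤ b ∨ b ≤ a

open BlockOrder (blk)

section Echelon

open scoped Classical in
/-- The diagonal projection matrix onto the coordinates in `I`. -/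
noncomputable def pr {T : Type} (I : Finset T) : Matrix T T ℂ :=
  Matrix.of fun i j => if i = j ∧ i ∈ I then 1 else 0

/-- The matrix `M` is supported on `J × I`. -/
def Supp {S T : Type} (M : Matrix S T ℂ) (J : Finset S) (I : Finset T) : Prop :=
  ∀ j i, M j i ≠ 0 → j ∈ J ∧ i ∈ I

/-- The subspace of vectors supported on `I`. -/
def coord {T : Type} (I : Finset T) : Submodule ℂ (T → ℂ) where
  carrier := {v | ∀ i, v i ≠ 0 → i ∈ I}
  add_mem' := by
    intro a b ha hb i hi
    by_cases h : a i = 0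
    · exact hb i (by simpa [h] using hi)
    · exact ha i h
  zero_mem' := by intro i hi; simp at hi
  smul_mem' := by
    intro c a ha i hi
    exact ha i (by simp at hi; exact hi.2)

variable {S T R : Type}

theorem mem_coord {I : Finset T} {v : T → ℂ} : v ∈ coord I ↔ ∀ i, v i ≠ 0 → i ∈ I := Iff.rfl

theorem mem_coord' {I : Finset T} {v : T → ℂ} : v ∈ coord I ↔ ∀ i, i ∉ I → v i = 0 :=
  forall_congr' fun i => by rw [not_imp_comm]

theorem Supp.zero {J : Finset S} {I : Finset T} : Supp (0 : Matrix S T ℂ) J I :=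
  fun _ _ h => absurd rfl h

theorem Supp.eq_zero {M : Matrix S T ℂ} {J : Finset S} {I : Finset T} (h : Supp M J I) {j i}
    (hji : ¬ (j ∈ J ∧ i ∈ I)) : M j i = 0 := by
  by_contra h0; exact hji (h j i h0)

theorem supp_of_eq_zero {M : Matrix S T ℂ} {J : Finset S} {I : Finset T}
    (h : ∀ j i, ¬ (j ∈ J ∧ i ∈ I) → M j i = 0) : Supp M J I := by
  intro j i h0
  by_contra h1
  exact h0 (h j i h1)

theorem Supp.add {A B : Matrix S T ℂ} {J : Finset S} {I : Finset T} (hA : Supp A J I)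
    (hB : Supp B J I) : Supp (A + B) J I :=
  supp_of_eq_zero fun j i h => by simp [hA.eq_zero h, hB.eq_zero h]

theorem Supp.sub {A B : Matrix S T ℂ} {J : Finset S} {I : Finset T} (hA : Supp A J I)
    (hB : Supp B J I) : Supp (A - B) J I :=
  supp_of_eq_zero fun j i h => by simp [hA.eq_zero h, hB.eq_zero h]

theorem Supp.smul {A : Matrix S T ℂ} {J : Finset S} {I : Finset T} (hA : Supp A J I) (c : ℂ) :
    Supp (c • A) J I :=
  supp_of_eq_zero fun j i h => by simp [hA.eq_zero h]

theorem Supp.mono {A : Matrix S T ℂ} {J J' : Finset S} {I I' : Finset T} (hA : Supp A J I)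
    (hJ : J ⊆ J') (hI : I ⊆ I') : Supp A J' I' :=
  fun j i h => ⟨hJ (hA j i h).1, hI (hA j i h).2⟩

theorem Supp.conjTranspose {A : Matrix S T ℂ} {J : Finset S} {I : Finset T} (hA : Supp A J I) :
    Supp Aᴴ I J :=
  fun i j h => (hA j i (by simpa using h)).symm

theorem Supp.mul [Fintype T] {A : Matrix S T ℂ} {B : Matrix T R ℂ} {J : Finset S} {I I' : Finset T}
    {K : Finset R} (hA : Supp A J I) (hB : Supp B I' K) : Supp (A * B) J K := by
  intro j k h
  rw [Matrix.mul_apply] at h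
  obtain ⟨i, -, hi⟩ := Finset.exists_ne_zero_of_sum_ne_zero h
  exact ⟨(hA j i (left_ne_zero_of_mul hi)).1, (hB i k (right_ne_zero_of_mul hi)).2⟩

theorem pr_apply [DecidableEq T] (I : Finset T) (i j : T) :
    pr I i j = if i = j ∧ i ∈ I then 1 else 0 := by
  simp only [pr, Matrix.of_apply]
  congr

theorem supp_pr (I : Finset T) : Supp (pr I) I I := by
  classical
  intro i j h
  rw [pr_apply] at h
  have : i = j ∧ i ∈ I := by by_contra h'; simp [h'] at h
  exact ⟨this.2, this.1 ▸ this.2⟩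

theorem pr_mul_apply [Fintype S] [DecidableEq S] (J : Finset S) (M : Matrix S T ℂ) (j i) :
    (pr J * M) j i = if j ∈ J then M j i else 0 := by
  rw [Matrix.mul_apply, Finset.sum_eq_single j]
  · simp [pr_apply]
  · intro b _ hb; simp [pr_apply, hb.symm]
  · simp

theorem mul_pr_apply [Fintype T] [DecidableEq T] (I : Finset T) (M : Matrix S T ℂ) (j i) :
    (M * pr I) j i = if i ∈ I then M j i else 0 := by
  rw [Matrix.mul_apply, Finset.sum_eq_single i]
  · simp [pr_apply]
  · intro b _ hb; rw [pr_apply]; simp [hb]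
  · simp

theorem Supp.pr_mul [Fintype S] {M : Matrix S T ℂ} {J J' : Finset S} {I : Finset T}
    (h : Supp M J I) (hJ : J ⊆ J') : pr J' * M = M := by
  classical
  ext j i
  rw [pr_mul_apply]
  split_ifs with hj
  · rfl
  · exact (h.eq_zero fun h' => hj (hJ h'.1)).symm

theorem Supp.mul_pr [Fintype T] {M : Matrix S T ℂ} {J : Finset S} {I I' : Finset T}
    (h : Supp M J I) (hI : I ⊆ I') : M * pr I' = M := by
  classical
  ext j i
  rw [mul_pr_apply]
  split_ifs with hj
  · rfl
  · exact (h.eq_zero fun h' => hj (hI h'.2)).symm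

theorem supp_mask [Fintype S] [Fintype T] (M : Matrix S T ℂ) (J : Finset S) (I : Finset T) :
    Supp (pr J * M * pr I) J I := by
  classical
  apply supp_of_eq_zero
  intro j i h
  rw [mul_pr_apply, pr_mul_apply]
  split_ifs <;> simp_all

theorem pr_mul_pr [Fintype T] [DecidableEq T] (I J : Finset T) : pr I * pr J = pr (I ∩ J) := by
  ext i j
  rw [pr_mul_apply, pr_apply, pr_apply]
  by_cases h1 : i = j <;> by_cases h2 : i ∈ I <;> by_cases h3 : i ∈ J <;> simp_all

theorem pr_mul_self [Fintype T] (I : Finset T) : pr I * pr I = pr I := by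
  classical
  rw [pr_mul_pr, Finset.inter_self]

theorem pr_univ [Fintype T] [DecidableEq T] : pr (Finset.univ : Finset T) = 1 := by
  ext i j; rw [pr_apply, Matrix.one_apply]; simp

theorem pr_conjTranspose (I : Finset T) : (pr I)ᴴ = pr I := by
  classical
  ext i j
  rw [Matrix.conjTranspose_apply, pr_apply, pr_apply]
  by_cases h : i = j
  · subst h; split_ifs <;> simp
  · simp [h, Ne.symm h]

theorem pr_add_pr_sdiff [DecidableEq T] {I I' : Finset T} (h : I' ⊆ I) :
    pr I' + pr (I \ I') = pr I := by
  ext i j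
  rw [Matrix.add_apply, pr_apply, pr_apply, pr_apply]
  by_cases h1 : i = j <;> by_cases h2 : i ∈ I' <;> by_cases h3 : i ∈ I <;> simp_all
  exact h3 (h h2)

theorem pr_mulVec_apply [Fintype T] [DecidableEq T] (I : Finset T) (v : T → ℂ) (i : T) :
    (pr I *ᵥ v) i = if i ∈ I then v i else 0 := by
  rw [Matrix.mulVec, dotProduct, Finset.sum_eq_single i]
  · simp [pr_apply]
  · intro b _ hb; simp [pr_apply, hb.symm]
  · simp

theorem pr_mulVec_mem [Fintype T] (I : Finset T) (v : T → ℂ) : pr I *ᵥ v ∈ coord I := by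
  classical
  intro i hi
  rw [pr_mulVec_apply] at hi
  by_contra h; simp [h] at hi

theorem pr_mulVec [Fintype T] {I : Finset T} {v : T → ℂ} (hv : v ∈ coord I) : pr I *ᵥ v = v := by
  classical
  ext i
  rw [pr_mulVec_apply]
  split_ifs with h
  · rfl
  · rw [mem_coord'.1 hv i h]

theorem Supp.mulVec_mem [Fintype T] {M : Matrix S T ℂ} {J : Finset S} {I : Finset T}
    (h : Supp M J I) (v : T → ℂ) : M *ᵥ v ∈ coord J := by
  intro j hj
  obtain ⟨i, -, hi⟩ := Finset.exists_ne_zero_of_sum_ne_zero hj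
  exact (h j i (left_ne_zero_of_mul hi)).1

theorem finrank_coord [Fintype T] (I : Finset T) : Module.finrank ℂ (coord I) = I.card := by
  classical
  let e : coord I ≃ₗ[ℂ] (I → ℂ) :=
    { toFun := fun v i => v.1 i
      map_add' := fun _ _ => rfl
      map_smul' := fun _ _ => rfl
      invFun := fun u => ⟨fun i => if h : i ∈ I then u ⟨i, h⟩ else 0, fun i hi => by
        by_contra h; simp [h] at hi⟩
      left_inv := by
        rintro ⟨v, hv⟩
        ext i
        by_cases h : i ∈ I
        · simp [h]
        · simp [h, mem_coord'.1 hv i h]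
      right_inv := by
        intro u; ext i; simp }
  rw [e.finrank_eq]; simp

theorem coord_mono {I J : Finset T} (h : I ⊆ J) : coord I ≤ coord J := fun _ hv i hi => h (hv i hi)

theorem coord_inf [DecidableEq T] (I J : Finset T) : coord I ⊓ coord J = coord (I ∩ J) := by
  ext v
  simp only [Submodule.mem_inf, mem_coord, Finset.mem_inter]
  exact ⟨fun h i hi => ⟨h.1 i hi, h.2 i hi⟩, fun h => ⟨fun i hi => (h i hi).1, fun i hi => (h i hi).2⟩⟩

theorem coord_univ [Fintype T] : coord (Finset.univ : Finset T) = ⊤ := by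
  ext v; simp [mem_coord]

/-- Square matrices whose nonzero entries sit at `(i, j)` with `i ≤ j`. -/
def IsUp [PartialOrder T] (M : Matrix T T ℂ) : Prop := ∀ i j, M i j ≠ 0 → i ≤ j

theorem IsUp.mul [PartialOrder T] [Fintype T] {A B : Matrix T T ℂ} (hA : IsUp A) (hB : IsUp B) :
    IsUp (A * B) := by
  intro i k h
  rw [Matrix.mul_apply] at h
  obtain ⟨j, -, hj⟩ := Finset.exists_ne_zero_of_sum_ne_zero h
  exact (hA i j (left_ne_zero_of_mul hj)).trans (hB j k (right_ne_zero_of_mul hj))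

theorem IsUp.add [PartialOrder T] {A B : Matrix T T ℂ} (hA : IsUp A) (hB : IsUp B) :
    IsUp (A + B) := by
  intro i k h
  by_cases h0 : A i k = 0
  · exact hB i k (by simpa [h0] using h)
  · exact hA i k h0

theorem IsUp.smul [PartialOrder T] {A : Matrix T T ℂ} (hA : IsUp A) (c : ℂ) : IsUp (c • A) := by
  intro i k h
  exact hA i k (by simp at h; exact h.2)

theorem IsUp.sub [PartialOrder T] {A B : Matrix T T ℂ} (hA : IsUp A) (hB : IsUp B) :
    IsUp (A - B) := by
  intro i k h
  by_cases h0 : A i k = 0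
  · exact hB i k (by simpa [h0] using h)
  · exact hA i k h0

theorem isUp_pr [PartialOrder T] (I : Finset T) : IsUp (pr I) := by
  classical
  intro i j h
  rw [pr_apply] at h
  have : i = j ∧ i ∈ I := by by_contra h'; simp [h'] at h
  exact this.1.le

theorem IsUp.mul_diag [PartialOrder T] [Fintype T] {A B : Matrix T T ℂ} (hA : IsUp A)
    (hB : IsUp B) (a : T) : (A * B) a a = A a a * B a a := by
  rw [Matrix.mul_apply, Finset.sum_eq_single a]
  · intro b _ hb
    by_contra h
    exact hb ((hB b a (right_ne_zero_of_mul h)).antisymm (hA a b (left_ne_zero_of_mul h)))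
  · simp

/-- `C` is an echelon matrix with rows in `I` and columns in `I'`: the column of `a ∈ I'` has its
leading (i.e. largest) nonzero entry in row `a`. -/
structure IsEch [PartialOrder T] (C : Matrix T T ℂ) (I I' : Finset T) : Prop where
  supp : Supp C I I'
  up : IsUp C
  diag : ∀ a ∈ I', C a a ≠ 0

theorem IsEch.subset [PartialOrder T] {C : Matrix T T ℂ} {I I' : Finset T} (h : IsEch C I I') :
    I' ⊆ I := fun a ha => (h.supp a a (h.diag a ha)).1

theorem isEch_pr [PartialOrder T] {I I' : Finset T} (h : I' ⊆ I) : IsEch (pr I') I I' :=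
  ⟨(supp_pr I').mono h subset_rfl, isUp_pr I', fun a ha => by classical simp [pr_apply, ha]⟩

theorem IsEch.mul [PartialOrder T] [Fintype T] {C C' : Matrix T T ℂ} {I I' I'' : Finset T}
    (h : IsEch C I I') (h' : IsEch C' I' I'') : IsEch (C * C') I I'' :=
  ⟨h.supp.mul h'.supp, h.up.mul h'.up, fun a ha => by
    rw [h.up.mul_diag h'.up]; exact mul_ne_zero (h.diag a (h'.subset ha)) (h'.diag a ha)⟩

/-- If `v` has a nonzero entry outside the lower set `D`, then so does `C v`. -/
theorem IsEch.mem_coord_of_mulVec [PartialOrder T] [Fintype T] {C : Matrix T T ℂ}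
    {I I' D : Finset T} (h : IsEch C I I') (hD : IsLowerSet (D : Set T)) {v : T → ℂ}
    (hv : v ∈ coord I') (hCv : C *ᵥ v ∈ coord D) : v ∈ coord D := by
  classical
  by_contra hcon
  obtain ⟨i0, hi0, hi0D⟩ : ∃ i, v i ≠ 0 ∧ i ∉ D := by
    simpa [mem_coord] using hcon
  obtain ⟨i, hi, hmax⟩ := Finset.exists_maximal (s := Finset.univ.filter fun i => v i ≠ 0 ∧ i ∉ D)
    ⟨i0, by simp [hi0, hi0D]⟩
  simp only [Finset.mem_filter, Finset.mem_univ, true_and] at hi hmax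
  have key : (C *ᵥ v) i = C i i * v i := by
    rw [Matrix.mulVec, dotProduct, Finset.sum_eq_single i]
    · intro k _ hk
      by_contra h0
      have hik := h.up i k (left_ne_zero_of_mul h0)
      have hkD : k ∉ D := fun hkD => hi.2 (hD hik hkD)
      exact hk ((hmax ⟨right_ne_zero_of_mul h0, hkD⟩ hik).antisymm hik)
    · simp
  exact hi.2 (hCv i (by rw [key]; exact mul_ne_zero (h.diag i (hv i hi.1)) hi.1))

theorem IsEch.mulVec_eq_zero [PartialOrder T] [Fintype T] {C : Matrix T T ℂ} {I I' : Finset T}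
    (h : IsEch C I I') {v : T → ℂ} (hv : v ∈ coord I') (hCv : C *ᵥ v = 0) : v = 0 := by
  have := h.mem_coord_of_mulVec (D := ∅) (by simp [IsLowerSet]) hv (by rw [hCv]; exact zero_mem _)
  ext i
  exact mem_coord'.1 this i (by simp)

theorem IsUp.mulVec_mem [PartialOrder T] [Fintype T] {C : Matrix T T ℂ} (h : IsUp C)
    {D : Finset T} (hD : IsLowerSet (D : Set T)) {v : T → ℂ} (hv : v ∈ coord D) :
    C *ᵥ v ∈ coord D := by
  intro i hi
  obtain ⟨k, -, hk⟩ := Finset.exists_ne_zero_of_sum_ne_zero hi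
  exact hD (h i k (left_ne_zero_of_mul hk)) (hv k (right_ne_zero_of_mul hk))

theorem IsEch.finrank_inf_coord [PartialOrder T] [Fintype T] [DecidableEq T] {C : Matrix T T ℂ}
    {I I' D : Finset T} (h : IsEch C I I') (hD : IsLowerSet (D : Set T)) :
    Module.finrank ℂ ↥(LinearMap.range C.mulVecLin ⊓ coord D) = (I' ∩ D).card := by
  have : LinearMap.range C.mulVecLin ⊓ coord D = (coord (I' ∩ D)).map C.mulVecLin := by
    ext w
    simp only [Submodule.mem_inf, LinearMap.mem_range, Submodule.mem_map, Matrix.mulVecLin_apply]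
    constructor
    · rintro ⟨⟨v, rfl⟩, hw⟩
      have hv : C *ᵥ (pr I' *ᵥ v) = C *ᵥ v := by
        rw [Matrix.mulVec_mulVec, h.supp.mul_pr subset_rfl]
      refine ⟨pr I' *ᵥ v, ?_, hv⟩
      rw [← coord_inf]
      exact ⟨pr_mulVec_mem _ _, h.mem_coord_of_mulVec hD (pr_mulVec_mem _ _) (hv ▸ hw)⟩
    · rintro ⟨v, hv, rfl⟩
      rw [← coord_inf] at hv
      exact ⟨⟨v, rfl⟩, h.up.mulVec_mem hD hv.2⟩
  rw [this, ← finrank_coord (I' ∩ D), ← LinearMap.range_domRestrict]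
  apply LinearMap.finrank_range_of_inj
  rw [← LinearMap.ker_eq_bot, LinearMap.ker_eq_bot']
  rintro ⟨v, hv⟩ h0
  exact Subtype.ext (h.mulVec_eq_zero (coord_mono Finset.inter_subset_left hv) h0)

/-- Echelon matrices that are square are invertible, with echelon inverse. -/
theorem IsEch.exists_inv [PartialOrder T] [Fintype T] {C : Matrix T T ℂ} {I : Finset T}
    (h : IsEch C I I) : ∃ D, IsEch D I I ∧ C * D = pr I ∧ D * C = pr I := by
  classical
  have right : ∀ C : Matrix T T ℂ, IsEch C I I → ∃ D, IsEch D I I ∧ C * D = pr I := by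
    intro C h
    let W : Submodule ℂ (Matrix T T ℂ) :=
      { carrier := {M | Supp M I I ∧ IsUp M}
        add_mem' := fun ha hb => ⟨ha.1.add hb.1, ha.2.add hb.2⟩
        zero_mem' := ⟨Supp.zero, fun i j h => absurd rfl h⟩
        smul_mem' := fun c _ ha => ⟨ha.1.smul c, ha.2.smul c⟩ }
    let L : W →ₗ[ℂ] W :=
      { toFun := fun M => ⟨C * M.1, h.supp.mul M.2.1, h.up.mul M.2.2⟩
        map_add' := fun a b => Subtype.ext (Matrix.mul_add _ _ _)
        map_smul' := fun c a => Subtype.ext (Matrix.mul_smul _ _ _) }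
    have hinj : Function.Injective L := by
      rw [← LinearMap.ker_eq_bot, LinearMap.ker_eq_bot']
      rintro ⟨M, hM⟩ h0
      have h0 : C * M = 0 := congrArg Subtype.val h0
      ext i j
      have h1 : M.col j = 0 := by
        apply h.mulVec_eq_zero
        · intro i hi; exact (hM.1 i j hi).1
        · ext i; exact congrFun (congrFun h0 i) j
      exact congrFun h1 i
    obtain ⟨D, hD⟩ := (LinearMap.injective_iff_surjective.1 hinj) ⟨pr I, supp_pr I, isUp_pr I⟩
    have hD : C * D.1 = pr I := congrArg Subtype.val hD
    refine ⟨D.1, ⟨D.2.1, D.2.2, fun a ha => ?_⟩, hD⟩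
    have := congrFun (congrFun hD a) a
    rw [h.up.mul_diag D.2.2, pr_apply] at this
    simp only [ha, and_self, if_true] at this
    exact right_ne_zero_of_mul (this ▸ one_ne_zero)
  obtain ⟨D, hD, hCD⟩ := right C h
  obtain ⟨E, hE, hDE⟩ := right D hD
  refine ⟨D, hD, hCD, ?_⟩
  have : C = E := by
    rw [← h.supp.mul_pr subset_rfl, ← hDE, ← Matrix.mul_assoc, hCD, hE.supp.pr_mul subset_rfl]
  rw [this, hDE]

/-- An echelon matrix extends to a square one. -/
theorem IsEch.exists_completion [PartialOrder T] [Fintype T] {C : Matrix T T ℂ}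
    {I I' : Finset T} (h : IsEch C I I') : ∃ E D, IsEch E I I ∧ IsEch D I I ∧ E * D = pr I ∧
      D * E = pr I ∧ E * pr I' = C ∧ D * C = pr I' := by
  classical
  have hE : IsEch (C + pr (I \ I')) I I := by
    refine ⟨(h.supp.mono subset_rfl h.subset).add ((supp_pr _).mono ?_ ?_), h.up.add (isUp_pr _), ?_⟩
    · exact Finset.sdiff_subset
    · exact Finset.sdiff_subset
    · intro a ha
      rw [Matrix.add_apply, pr_apply]
      by_cases ha' : a ∈ I'
      · simpa [ha'] using h.diag a ha'
      · rw [h.supp.eq_zero fun h' => ha' h'.2]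
        simp [ha, ha']
  obtain ⟨D, hD, h1, h2⟩ := hE.exists_inv
  have h3 : (C + pr (I \ I')) * pr I' = C := by
    rw [Matrix.add_mul, h.supp.mul_pr subset_rfl, pr_mul_pr, Finset.sdiff_inter_self]
    ext i j; simp [pr_apply]
  refine ⟨_, D, hE, hD, h1, h2, h3, ?_⟩
  calc D * C = D * ((C + pr (I \ I')) * pr I') := by rw [h3]
    _ = pr I * pr I' := by rw [← Matrix.mul_assoc, h2]
    _ = pr I' := (supp_pr I').pr_mul h.subset

end Echelon

section Subspace

variable {S T : Type}

/-- The restriction of a vector to a block. -/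
def toBlk [BlockOrder T] (b : Bool) (v : T → ℂ) : T → ℂ := fun i => if blk i = b then v i else 0

/-- A subspace compatible with the block decomposition. -/
def Graded [BlockOrder T] (W : Submodule ℂ (T → ℂ)) : Prop := ∀ v ∈ W, ∀ b, toBlk b v ∈ W

theorem BlockOrder.blk_eq_of_le [BlockOrder T] {a b : T} (h : a ≤ b) : blk a = blk b :=
  (BlockOrder.blk_eq_iff a b).2 (Or.inl h)

theorem BlockOrder.exists_top [BlockOrder T] [Fintype T] {v : T → ℂ} (hv : v ≠ 0)
    (hb : ∀ i j, v i ≠ 0 → v j ≠ 0 → blk i = blk j) : ∃ a, v a ≠ 0 ∧ ∀ i, v i ≠ 0 → i ≤ a := by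
  classical
  obtain ⟨i0, hi0⟩ := Function.ne_iff.1 hv
  obtain ⟨a, ha, hmax⟩ := Finset.exists_maximal (s := Finset.univ.filter fun i => v i ≠ 0)
    ⟨i0, by simpa using hi0⟩
  simp only [Finset.mem_filter, Finset.mem_univ, true_and] at ha hmax
  refine ⟨a, ha, fun i hi => ?_⟩
  rcases (BlockOrder.blk_eq_iff i a).1 (hb i a hi ha) with h | h
  · exact h
  · exact hmax hi h

/-- Every graded subspace has an echelon basis. -/
theorem Graded.exists_echelon [BlockOrder T] [Fintype T] {I : Finset T}
    {W : Submodule ℂ (T → ℂ)} (hgr : Graded W) (hW : W ≤ coord I) :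
    ∃ I' C, IsEch C I I' ∧ LinearMap.range C.mulVecLin = W := by
  classical
  let P : T → Prop := fun a => ∃ v ∈ W, v a ≠ 0 ∧ ∀ i, v i ≠ 0 → i ≤ a
  let I' := I.filter P
  have hP : ∀ a, P a → a ∈ I' := fun a ha => by
    obtain ⟨v, hv, hva, -⟩ := id ha
    exact Finset.mem_filter.2 ⟨hW hv a hva, ha⟩
  choose! c hcW hca hcle using fun a (ha : P a) => ha
  let C : Matrix T T ℂ := Matrix.of fun i a => if a ∈ I' then c a i else 0
  have hC : IsEch C I I' := by
    refine ⟨fun i a h => ?_, fun i a h => ?_, fun a ha => ?_⟩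
    · by_cases ha : a ∈ I'
      · exact ⟨hW (hcW a (Finset.mem_filter.1 ha).2) i (by simpa [C, ha] using h), ha⟩
      · simp [C, ha] at h
    · by_cases ha : a ∈ I'
      · exact hcle a (Finset.mem_filter.1 ha).2 i (by simpa [C, ha] using h)
      · simp [C, ha] at h
    · simpa [C, ha] using hca a (Finset.mem_filter.1 ha).2
  have hcol : ∀ a, P a → c a ∈ LinearMap.range C.mulVecLin := by
    intro a ha
    refine ⟨Pi.single a 1, ?_⟩
    ext i
    simp [C, hP a ha]
  have main : ∀ a, ∀ v ∈ W, (∀ i, v i ≠ 0 → i ≤ a) → v ∈ LinearMap.range C.mulVecLin := by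
    intro a
    induction a using WellFoundedLT.induction with
    | _ a ih =>
    have lower : ∀ v ∈ W, (∀ i, v i ≠ 0 → i ≤ a) → v a = 0 →
        v ∈ LinearMap.range C.mulVecLin := by
      intro v hv hle ha
      by_cases h0 : v = 0
      · rw [h0]; exact zero_mem _
      · obtain ⟨b, hb, hbmax⟩ := BlockOrder.exists_top h0 fun i j hi hj =>
          (BlockOrder.blk_eq_of_le (hle i hi)).trans (BlockOrder.blk_eq_of_le (hle j hj)).symm
        exact ih b ((hle b hb).lt_of_ne fun h => hb (h ▸ ha)) v hv hbmax
    intro v hv hle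
    by_cases ha : v a = 0
    · exact lower v hv hle ha
    · have hPa : P a := ⟨v, hv, ha, hle⟩
      have h1 : v - (v a / c a a) • c a ∈ LinearMap.range C.mulVecLin := by
        refine lower _ (W.sub_mem hv (W.smul_mem _ (hcW a hPa))) (fun i hi => ?_) ?_
        · by_cases hvi : v i = 0
          · refine hcle a hPa i fun h0 => hi ?_
            simp [hvi, h0]
          · exact hle i hvi
        · simp [hca a hPa]
      simpa using Submodule.add_mem _ h1 (Submodule.smul_mem _ (v a / c a a) (hcol a hPa))
  refine ⟨I', C, hC, le_antisymm ?_ ?_⟩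
  · rw [Matrix.range_mulVecLin, Submodule.span_le]
    rintro _ ⟨a, rfl⟩
    by_cases ha : a ∈ I'
    · have : C.col a = c a := by ext i; simp [C, ha]
      rw [this]
      exact hcW a (Finset.mem_filter.1 ha).2
    · have : C.col a = 0 := by ext i; simp [C, ha]
      rw [this]
      exact zero_mem _
  · intro v hv
    have hsum : v = toBlk true v + toBlk false v := by
      ext i
      cases h : blk i <;> simp [toBlk, h]
    have part : ∀ b, toBlk b v ∈ LinearMap.range C.mulVecLin := by
      intro b
      by_cases h0 : toBlk b v = 0
      · rw [h0]; exact zero_mem _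
      · have hb : ∀ i, toBlk b v i ≠ 0 → blk i = b := by
          intro i hi; by_contra h; simp [toBlk, h] at hi
        obtain ⟨a, -, ha⟩ := BlockOrder.exists_top h0 fun i j hi hj => (hb i hi).trans (hb j hj).symm
        exact main a _ (hgr v hv b) ha
    rw [hsum]
    exact Submodule.add_mem _ (part _) (part _)

theorem IsEch.finrank_range [PartialOrder T] [Fintype T] {C : Matrix T T ℂ}
    {I I' : Finset T} (h : IsEch C I I') :
    Module.finrank ℂ (LinearMap.range C.mulVecLin) = I'.card := by
  classical
  have := h.finrank_inf_coord (D := Finset.univ) (by simp [isLowerSet_univ])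
  rwa [coord_univ, inf_top_eq, Finset.inter_univ] at this

/-- Block preserving matrices map block components to block components. -/
theorem IsUp.toBlk_mulVec [BlockOrder T] [Fintype T] {M : Matrix T T ℂ} (hM : IsUp M) (b : Bool)
    (v : T → ℂ) : M *ᵥ toBlk b v = toBlk b (M *ᵥ v) := by
  ext i
  simp only [Matrix.mulVec, dotProduct, toBlk]
  split_ifs with h
  · refine Finset.sum_congr rfl fun k _ => ?_
    by_cases h0 : M i k = 0
    · simp [h0]
    · rw [if_pos ((BlockOrder.blk_eq_of_le (hM i k h0)).symm.trans h)]
  · refine Finset.sum_eq_zero fun k _ => ?_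
    by_cases h0 : M i k = 0
    · simp [h0]
    · rw [if_neg fun h' => h ((BlockOrder.blk_eq_of_le (hM i k h0)).trans h'), mul_zero]

theorem graded_coord [BlockOrder T] (I : Finset T) : Graded (coord I) := by
  intro v hv b i hi
  refine hv i fun h => hi ?_
  simp [toBlk, h]

theorem Graded.inf [BlockOrder T] {V W : Submodule ℂ (T → ℂ)} (hV : Graded V) (hW : Graded W) :
    Graded (V ⊓ W) := fun v hv b => ⟨hV v hv.1 b, hW v hv.2 b⟩

theorem IsUp.graded_ker [BlockOrder T] [Fintype T] {M : Matrix T T ℂ} (hM : IsUp M) :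
    Graded (LinearMap.ker M.mulVecLin) := by
  intro v hv b
  rw [LinearMap.mem_ker, Matrix.mulVecLin_apply] at hv ⊢
  rw [hM.toBlk_mulVec, hv]
  ext i; simp [toBlk]

theorem IsUp.graded_range [BlockOrder T] [Fintype T] {M : Matrix T T ℂ} (hM : IsUp M) :
    Graded (LinearMap.range M.mulVecLin) := by
  rintro _ ⟨v, rfl⟩ b
  exact ⟨toBlk b v, hM.toBlk_mulVec b v⟩

theorem exists_layers_of_nonneg [PartialOrder T] [Fintype T] [DecidableEq T] {w : T → ℝ}
    (hw : Antitone w) (h0 : ∀ i, 0 ≤ w i) : ∃ c : Finset T → ℝ,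
      (∀ D, c D ≠ 0 → IsLowerSet (D : Set T)) ∧ (∀ D, 0 ≤ c D) ∧
      ∀ i, w i = ∑ D, if i ∈ D then c D else 0 := by
  induction h : (Finset.univ.filter fun i => 0 < w i).card using Nat.strong_induction_on
    generalizing w with
  | _ N ih =>
  set D := Finset.univ.filter fun i => 0 < w i with hD
  have hmem : ∀ i, i ∈ D ↔ 0 < w i := by simp [hD]
  by_cases hne : D.Nonempty
  · obtain ⟨a, ha, hmin⟩ := D.exists_min_image w hne
    have hap := (hmem a).1 ha
    have hlt : (Finset.univ.filter fun i => 0 < w i - if i ∈ D then w a else 0).card < N := by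
      rw [← h]
      apply Finset.card_lt_card
      rw [Finset.ssubset_iff_of_subset]
      · refine ⟨a, ha, by simp [ha]⟩
      · intro i hi
        simp only [Finset.mem_filter, Finset.mem_univ, true_and] at hi
        rw [hmem]
        split_ifs at hi <;> linarith
    have hanti : Antitone fun i => w i - if i ∈ D then w a else 0 := by
      intro i j hij
      dsimp only
      have := hw hij
      by_cases hi : i ∈ D <;> by_cases hj : j ∈ D
      · simp only [hi, hj, if_true]; linarith
      · simp only [hi, hj, if_true, if_false]
        have h1 := hmin i hi
        have h2 : w j ≤ 0 := not_lt.1 fun h => hj ((hmem j).2 h)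
        linarith
      · exact absurd ((hmem i).2 (((hmem j).1 hj).trans_le this)) hi
      · simp only [hi, hj, if_false]; linarith
    have hnn : ∀ i, 0 ≤ w i - if i ∈ D then w a else 0 := by
      intro i
      split_ifs with hi
      · linarith [hmin i hi]
      · linarith [h0 i]
    obtain ⟨c, hc1, hc2, hc3⟩ := ih _ hlt hanti hnn rfl
    · refine ⟨fun E => c E + if E = D then w a else 0, fun E hE => ?_, fun E => ?_, fun i => ?_⟩
      · by_cases hED : E = D
        · subst hED
          intro i j hji hi
          simp only [Finset.mem_coe, hmem] at hi ⊢
          exact hi.trans_le (hw hji)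
        · exact hc1 E (by simpa [hED] using hE)
      · have := hc2 E
        dsimp only
        split_ifs <;> linarith
      · have h1 := hc3 i
        have h2 : ∑ E, (if i ∈ E then c E + (if E = D then w a else 0) else 0) =
            (∑ E, if i ∈ E then c E else 0) + ∑ E, if E = D then (if i ∈ D then w a else 0) else 0 := by
          rw [← Finset.sum_add_distrib]
          refine Finset.sum_congr rfl fun E _ => ?_
          by_cases hED : E = D
          · subst hED; split_ifs <;> simp
          · simp [hED]
        rw [h2, ← h1]
        simp
  · refine ⟨0, by simp, by simp, fun i => ?_⟩
    have : ¬ 0 < w i := fun hi => hne ⟨i, (hmem i).2 hi⟩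
    simp
    exact le_antisymm (not_lt.1 this) (h0 i)

/-- Layer cake decomposition of antitone functions. -/
theorem exists_layers [PartialOrder T] [Fintype T] [DecidableEq T] {w : T → ℝ}
    (hw : Antitone w) : ∃ c : Finset T → ℝ,
      (∀ D, c D ≠ 0 → IsLowerSet (D : Set T)) ∧ (∀ D, D ≠ Finset.univ → 0 ≤ c D) ∧
      ∀ i, w i = ∑ D, if i ∈ D then c D else 0 := by
  obtain ⟨a, ha⟩ : ∃ a, ∀ i, 0 ≤ w i + a := by
    refine ⟨∑ j, |w j|, fun i => ?_⟩
    have := Finset.single_le_sum (f := fun j => |w j|) (fun j _ => abs_nonneg _) (Finset.mem_univ i)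
    have := neg_abs_le (w i)
    linarith
  obtain ⟨c, hc1, hc2, hc3⟩ := exists_layers_of_nonneg (w := fun i => w i + a)
    (fun i j h => by have := hw h; simpa) ha
  refine ⟨fun D => c D - if D = Finset.univ then a else 0, fun D hD => ?_, fun D hD => ?_,
    fun i => ?_⟩
  · by_cases h : D = Finset.univ
    · subst h; simp [isLowerSet_univ]
    · exact hc1 D (by simpa [h] using hD)
  · simpa [hD] using hc2 D
  · have h2 : ∑ D, (if i ∈ D then c D - (if D = Finset.univ then a else 0) else 0) =
        (∑ D, if i ∈ D then c D else 0) - ∑ D : Finset T, if D = Finset.univ then a else 0 := by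
      rw [← Finset.sum_sub_distrib]
      refine Finset.sum_congr rfl fun E _ => ?_
      by_cases hE : E = Finset.univ
      · subst hE; simp
      · simp [hE]
    rw [h2, ← hc3 i]
    simp

theorem sum_eq_sum_layers [Fintype T] [DecidableEq T] {w : T → ℝ} {c : Finset T → ℝ}
    (h : ∀ i, w i = ∑ D, if i ∈ D then c D else 0) (I : Finset T) :
    ∑ i ∈ I, w i = ∑ D : Finset T, c D * (I ∩ D).card := by
  simp_rw [h]
  rw [Finset.sum_comm]
  refine Finset.sum_congr rfl fun D _ => ?_
  rw [← Finset.sum_filter, Finset.filter_mem_eq_inter]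
  simp [mul_comm]

end Subspace

section Generic

variable {E F : Type*} [AddCommGroup E] [Module ℂ E] [AddCommGroup F] [Module ℂ F]

/-- Functions whose restriction to every line is polynomial. -/
def PolyFun (g : E → ℂ) : Prop :=
  ∀ x y : E, ∃ P : Polynomial ℂ, ∀ t : ℂ, g (x + t • y) = P.eval t

theorem PolyFun.const (c : ℂ) : PolyFun fun _ : E => c := fun _ _ => ⟨Polynomial.C c, by simp⟩

theorem PolyFun.add {g h : E → ℂ} (hg : PolyFun g) (hh : PolyFun h) :
    PolyFun fun x => g x + h x := by
  intro x y
  obtain ⟨P, hP⟩ := hg x y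
  obtain ⟨Q, hQ⟩ := hh x y
  exact ⟨P + Q, fun t => by simp [hP, hQ]⟩

theorem PolyFun.mul {g h : E → ℂ} (hg : PolyFun g) (hh : PolyFun h) :
    PolyFun fun x => g x * h x := by
  intro x y
  obtain ⟨P, hP⟩ := hg x y
  obtain ⟨Q, hQ⟩ := hh x y
  exact ⟨P * Q, fun t => by simp [hP, hQ]⟩

theorem PolyFun.sum {ι : Type*} (s : Finset ι) {g : ι → E → ℂ} (hg : ∀ i ∈ s, PolyFun (g i)) :
    PolyFun fun x => ∑ i ∈ s, g i x := by
  classical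
  induction s using Finset.induction_on with
  | empty => simpa using PolyFun.const 0
  | insert a s ha ih =>
    simp_rw [Finset.sum_insert ha]
    exact (hg a (by simp)).add (ih fun i hi => hg i (by simp [hi]))

theorem PolyFun.prod {ι : Type*} (s : Finset ι) {g : ι → E → ℂ} (hg : ∀ i ∈ s, PolyFun (g i)) :
    PolyFun fun x => ∏ i ∈ s, g i x := by
  classical
  induction s using Finset.induction_on with
  | empty => simpa using PolyFun.const 1
  | insert a s ha ih =>
    simp_rw [Finset.prod_insert ha]
    exact (hg a (by simp)).mul (ih fun i hi => hg i (by simp [hi]))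

theorem PolyFun.det {ι : Type*} [Fintype ι] [DecidableEq ι] {M : E → Matrix ι ι ℂ}
    (hM : ∀ i j, PolyFun fun x => M x i j) : PolyFun fun x => (M x).det := by
  simp_rw [Matrix.det_apply']
  exact PolyFun.sum _ fun σ _ => (PolyFun.const _).mul (PolyFun.prod _ fun i _ => hM _ _)

theorem PolyFun.comp_affine {g : F → ℂ} (hg : PolyFun g) (L : E →ₗ[ℂ] F) (c : F) :
    PolyFun fun x => g (c + L x) := by
  intro x y
  obtain ⟨P, hP⟩ := hg (c + L x) (L y)
  refine ⟨P, fun t => ?_⟩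
  show g (c + L (x + t • y)) = _
  rw [← hP, map_add, map_smul, add_assoc]

theorem PolyFun.linear (L : E →ₗ[ℂ] ℂ) : PolyFun fun x => L x := by
  intro x y
  exact ⟨Polynomial.C (L x) + Polynomial.X * Polynomial.C (L y), fun t => by simp; ring⟩

theorem PolyFun.eventually_cofinite {g : E → ℂ} (hg : PolyFun g) {x y : E} {t₀ : ℂ}
    (h : g (x + t₀ • y) ≠ 0) : ∀ᶠ t : ℂ in Filter.cofinite, g (x + t • y) ≠ 0 := by
  obtain ⟨P, hP⟩ := hg x y
  have hP0 : P ≠ 0 := by rintro rfl; exact h (by rw [hP]; simp)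
  rw [Filter.eventually_cofinite]
  refine (P.roots.toFinset.finite_toSet).subset fun t ht => ?_
  simp only [Set.mem_ofPred_eq, not_not] at ht
  rw [hP] at ht
  simp [hP0, ht]

/-- The set `s` contains the nonvanishing locus of a polynomial function that is nonzero at `x`. -/
def GenAt (x : E) (s : Set E) : Prop := ∃ g : E → ℂ, PolyFun g ∧ g x ≠ 0 ∧ ∀ y, g y ≠ 0 → y ∈ s

/-- The set `s` contains a nonempty Zariski open set. -/
def Gen (s : Set E) : Prop := ∃ x, GenAt x s

theorem GenAt.gen {x : E} {s : Set E} (h : GenAt x s) : Gen s := ⟨x, h⟩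

theorem GenAt.mem {x : E} {s : Set E} (h : GenAt x s) : x ∈ s := by
  obtain ⟨g, -, h0, h1⟩ := h
  exact h1 x h0

theorem GenAt.mono {x : E} {s t : Set E} (h : GenAt x s) (hst : s ⊆ t) : GenAt x t := by
  obtain ⟨g, hg, h0, h1⟩ := h
  exact ⟨g, hg, h0, fun y hy => hst (h1 y hy)⟩

theorem Gen.mono {s t : Set E} (h : Gen s) (hst : s ⊆ t) : Gen t := by
  obtain ⟨x, hx⟩ := h
  exact ⟨x, hx.mono hst⟩

theorem GenAt.inter {x : E} {s t : Set E} (hs : GenAt x s) (ht : GenAt x t) :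
    GenAt x (s ∩ t) := by
  obtain ⟨g, hg, g0, g1⟩ := hs
  obtain ⟨h, hh, h0, h1⟩ := ht
  exact ⟨_, hg.mul hh, mul_ne_zero g0 h0, fun y hy =>
    ⟨g1 y (left_ne_zero_of_mul hy), h1 y (right_ne_zero_of_mul hy)⟩⟩

theorem GenAt.eventually {x y : E} {t₀ : ℂ} {s : Set E} (h : GenAt (x + t₀ • y) s) :
    ∀ᶠ t : ℂ in Filter.cofinite, GenAt (x + t • y) s := by
  obtain ⟨g, hg, g0, g1⟩ := h
  exact (hg.eventually_cofinite g0).mono fun t ht => ⟨g, hg, ht, g1⟩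

theorem Gen.inter {s t : Set E} (hs : Gen s) (ht : Gen t) : Gen (s ∩ t) := by
  obtain ⟨x, hx⟩ := hs
  obtain ⟨y, hy⟩ := ht
  have h1 : GenAt (x + (0 : ℂ) • (y - x)) s := by simpa using hx
  have h2 : GenAt (x + (1 : ℂ) • (y - x)) t := by simpa using hy
  obtain ⟨c, hc1, hc2⟩ := (h1.eventually.and h2.eventually).exists
  exact ⟨_, hc1.inter hc2⟩

theorem gen_univ : Gen (Set.univ : Set E) := ⟨0, _, PolyFun.const 1, one_ne_zero, by simp⟩

theorem Gen.genAt {s : Set E} (h : Gen s) : Gen {x | GenAt x s} := by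
  obtain ⟨x, g, hg, g0, g1⟩ := h
  exact ⟨x, g, hg, g0, fun y hy => ⟨g, hg, hy, g1⟩⟩

theorem Gen.iInter {ι : Type*} [Finite ι] {s : ι → Set E} (h : ∀ i, Gen (s i)) :
    Gen {x | ∀ i, x ∈ s i} := by
  classical
  cases nonempty_fintype ι
  have : ∀ u : Finset ι, Gen {x | ∀ i ∈ u, x ∈ s i} := by
    intro u
    induction u using Finset.induction_on with
    | empty => simpa using gen_univ
    | insert a u ha ih => refine ((h a).inter ih).mono ?_; simp; tauto
  simpa using this Finset.univ

theorem Gen.nonempty {s : Set E} (h : Gen s) : s.Nonempty := by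
  obtain ⟨x, hx⟩ := h
  exact ⟨x, hx.mem⟩

/-- Generic sets are dense. -/
theorem Gen.exists_direction {s : Set E} (h : Gen s) (x : E) :
    ∃ y, ∀ᶠ t : ℂ in Filter.cofinite, x + t • y ∈ s := by
  obtain ⟨z, hz⟩ := h
  have h1 : GenAt (x + (1 : ℂ) • (z - x)) s := by simpa using hz
  exact ⟨z - x, h1.eventually.mono fun t ht => ht.mem⟩

theorem GenAt.preimage {s : Set F} {x : E} (L : E →ₗ[ℂ] F) (c : F) (h : GenAt (c + L x) s) :
    GenAt x {x | c + L x ∈ s} := by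
  obtain ⟨g, hg, g0, g1⟩ := h
  exact ⟨_, hg.comp_affine L c, g0, fun y hy => g1 _ hy⟩

theorem Gen.preimage {s : Set F} (h : Gen s) (L : E →ₗ[ℂ] F) (hL : Function.Surjective L) :
    Gen {x | L x ∈ s} := by
  obtain ⟨y, hy⟩ := h
  obtain ⟨x, rfl⟩ := hL y
  exact ⟨x, by simpa using GenAt.preimage (x := x) L 0 (by simpa using hy)⟩

open Module in
/-- The rank of a polynomial family of linear maps is generically at least its value at a point. -/
theorem genAt_rank {V W : Type*} [AddCommGroup V] [Module ℂ V] [AddCommGroup W] [Module ℂ W]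
    [FiniteDimensional ℂ W] (M : E → V →ₗ[ℂ] W)
    (hM : ∀ v (l : W →ₗ[ℂ] ℂ), PolyFun fun x => l (M x v)) (x₀ : E) :
    GenAt x₀ {x | finrank ℂ (LinearMap.range (M x₀)) ≤ finrank ℂ (LinearMap.range (M x))} := by
  set r := finrank ℂ (LinearMap.range (M x₀)) with hr
  let b : Basis (Fin r) ℂ (LinearMap.range (M x₀)) := finBasis ℂ _
  choose v hv using fun i => (b i).2
  obtain ⟨p, hp⟩ := (LinearMap.range (M x₀)).subtype.exists_leftInverse_of_injective
    (Submodule.ker_subtype _)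
  let l : Fin r → W →ₗ[ℂ] ℂ := fun i => (b.coord i).comp p
  refine ⟨fun x => (Matrix.of fun i j => l i (M x (v j))).det, ?_, ?_, ?_⟩
  · exact PolyFun.det fun i j => hM (v j) (l i)
  · have : (Matrix.of fun i j => l i (M x₀ (v j))) = 1 := by
      ext i j
      have h2 : p (b j : W) = b j := LinearMap.congr_fun hp (b j)
      simp [l, hv, h2, Matrix.one_apply, Finsupp.single_apply, eq_comm]
    dsimp only
    rw [this]; simp
  · intro x hx
    have hli : LinearIndependent ℂ fun j => (⟨M x (v j), v j, rfl⟩ : LinearMap.range (M x)) := by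
      rw [Fintype.linearIndependent_iff]
      intro c hc
      have h0 : (Matrix.of fun i j => l i (M x (v j))) *ᵥ c = 0 := by
        ext i
        have := congrArg (fun w : LinearMap.range (M x) => l i w.1) hc
        simpa [Matrix.mulVec, dotProduct, mul_comm] using this
      have := Matrix.eq_zero_of_mulVec_eq_zero hx h0
      exact fun i => congrFun this i
    simpa using hli.fintype_card_le_finrank

open Module in
/-- If the rank of `A + t A'` never exceeds the rank of `A`, then `A'` maps the kernel of `A` into
the range of `A`. -/
theorem mem_range_of_rank_le {V W : Type*} [AddCommGroup V] [Module ℂ V] [AddCommGroup W]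
    [Module ℂ W] [FiniteDimensional ℂ W] (A A' : V →ₗ[ℂ] W)
    (h : ∀ t : ℂ, finrank ℂ (LinearMap.range (A + t • A')) ≤ finrank ℂ (LinearMap.range A))
    {x : V} (hx : A x = 0) : A' x ∈ LinearMap.range A := by
  by_contra hcon
  let M : ℂ → (V × ℂ) →ₗ[ℂ] W := fun t =>
    (A + t • A').coprod (LinearMap.toSpanSingleton ℂ W (A' x))
  have hM : ∀ v (l : W →ₗ[ℂ] ℂ), PolyFun fun t => l (M t v) := by
    intro v l t u
    refine ⟨Polynomial.C (l (A v.1) + t * l (A' v.1) + v.2 * l (A' x)) +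
      Polynomial.X * Polynomial.C (u * l (A' v.1)), fun s => ?_⟩
    simp [M]
    ring
  have hr0 : finrank ℂ (LinearMap.range (M 0)) = finrank ℂ (LinearMap.range A) + 1 := by
    have : LinearMap.range (M 0) = LinearMap.range A ⊔ ℂ ∙ (A' x) := by
      simp only [M, zero_smul, add_zero, LinearMap.range_coprod, LinearMap.range_toSpanSingleton]
    rw [this]
    have hd : LinearMap.range A ⊓ (ℂ ∙ (A' x)) = ⊥ := by
      rw [← disjoint_iff]
      rw [disjoint_comm]
      exact (Submodule.disjoint_span_singleton' (by rintro h0; exact hcon (h0 ▸ zero_mem _))).2 hcon |>.symm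
    have := Submodule.finrank_sup_add_finrank_inf_eq (LinearMap.range A) (ℂ ∙ (A' x))
    rw [hd, finrank_bot, add_zero, finrank_span_singleton] at this
    · exact this
    · rintro h0; exact hcon (h0 ▸ zero_mem _)
  have h1 : GenAt ((0 : ℂ) + (0 : ℂ) • (1 : ℂ)) {t | finrank ℂ (LinearMap.range (M 0)) ≤
      finrank ℂ (LinearMap.range (M t))} := by simpa using genAt_rank M hM 0
  obtain ⟨t, ht, ht0⟩ := (h1.eventually.and
    (Filter.eventually_cofinite_ne (0 : ℂ))).exists
  have ht := ht.mem
  simp only [smul_eq_mul, mul_one, zero_add, Set.mem_ofPred_eq] at ht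
  rw [hr0] at ht
  have h2 : LinearMap.range (M t) ≤ LinearMap.range (A + t • A') := by
    simp only [M, LinearMap.range_coprod, sup_le_iff, le_refl, true_and,
      LinearMap.range_toSpanSingleton, Submodule.span_singleton_le_iff_mem]
    refine ⟨t⁻¹ • x, ?_⟩
    simp [hx, ht0]
  have := Submodule.finrank_mono h2
  have := h t
  omega

end Generic

section Subrepresentation

variable {S T : Type}

/-- Matrices whose nonzero entries have positions in `P`. -/
def entr (P : Finset (S × T)) : Submodule ℂ (Matrix S T ℂ) where
  carrier := {M | ∀ i j, M i j ≠ 0 → (i, j) ∈ P}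
  add_mem' := by
    intro a b ha hb i j hi
    by_cases h : a i j = 0
    · exact hb i j (by simpa [h] using hi)
    · exact ha i j h
  zero_mem' := by intro i j hi; simp at hi
  smul_mem' := by
    intro c a ha i j hi
    exact ha i j (by simp at hi; exact hi.2)

theorem finrank_entr [Fintype S] [Fintype T] (P : Finset (S × T)) :
    Module.finrank ℂ (entr P) = P.card := by
  rw [← finrank_coord P]
  refine LinearEquiv.finrank_eq
    { toFun := fun M => ⟨fun p => M.1 p.1 p.2, fun p hp => M.2 _ _ hp⟩
      map_add' := fun _ _ => rfl
      map_smul' := fun _ _ => rfl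
      invFun := fun v => ⟨Matrix.of fun i j => v.1 (i, j), fun i j h => v.2 _ h⟩
      left_inv := fun _ => rfl
      right_inv := fun _ => rfl }

theorem mem_entr_prod {L : Finset S} {I : Finset T} {M : Matrix S T ℂ} :
    M ∈ entr (L ×ˢ I) ↔ Supp M L I :=
  forall_congr' fun _ => forall_congr' fun _ => imp_congr_right fun _ => Finset.mem_product

open scoped Classical in
/-- The pairs `(k, i) ∈ K × I` with `k ≤ i`. -/
noncomputable def filPos [PartialOrder T] (K I : Finset T) : Finset (T × T) :=
  (K ×ˢ I).filter fun p => p.1 ≤ p.2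

theorem mem_entr_filPos [PartialOrder T] {K I : Finset T} {M : Matrix T T ℂ} :
    M ∈ entr (filPos K I) ↔ Supp M K I ∧ IsUp M := by
  classical
  constructor
  · intro h
    have h' := fun i j hij => Finset.mem_filter.1 (h i j hij)
    exact ⟨fun i j hij => Finset.mem_product.1 (h' i j hij).1, fun i j hij => (h' i j hij).2⟩
  · intro h i j hij
    exact Finset.mem_filter.2 ⟨Finset.mem_product.2 (h.1 i j hij), h.2 i j hij⟩

/-- The Euler form of two filtered representations of the given types. -/
noncomputable def pairing [PartialOrder S] [PartialOrder T] (I : Finset T) (J : Finset S)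
    (K : Finset T) (L : Finset S) : ℤ :=
  (filPos K I).card + (filPos L J).card - L.card * I.card

/-- The filtered map `f` (from `I` to `J`) has a subrepresentation in position `(I', J')`. -/
def HasSub [Fintype S] [Fintype T] [PartialOrder S] [PartialOrder T] (f : Matrix S T ℂ)
    (I : Finset T) (J : Finset S) (I' : Finset T) (J' : Finset S) : Prop :=
  ∃ (C : Matrix T T ℂ) (C' : Matrix S S ℂ) (B : Matrix S T ℂ),
    IsEch C I I' ∧ IsEch C' J J' ∧ Supp B J' I' ∧ f * C = C' * B

theorem hasSub_self [Fintype S] [Fintype T] [PartialOrder S] [PartialOrder T] {f : Matrix S T ℂ}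
    {I : Finset T} {J : Finset S} (hf : Supp f J I) : HasSub f I J I J :=
  ⟨pr I, pr J, f, isEch_pr subset_rfl, isEch_pr subset_rfl, hf, by
    rw [hf.mul_pr subset_rfl, hf.pr_mul subset_rfl]⟩

/-- The restriction of a matrix to the block `J × I`. -/
noncomputable def mask [Fintype S] [Fintype T] (J : Finset S) (I : Finset T) (f : Matrix S T ℂ) :
    Matrix S T ℂ := pr J * f * pr I

theorem supp_mask' [Fintype S] [Fintype T] (J : Finset S) (I : Finset T) (f : Matrix S T ℂ) :
    Supp (mask J I f) J I := supp_mask f J I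

theorem mask_eq [Fintype S] [Fintype T] {J : Finset S} {I : Finset T} {f : Matrix S T ℂ}
    (h : Supp f J I) : mask J I f = f := by
  rw [mask, h.pr_mul subset_rfl, h.mul_pr subset_rfl]

theorem mask_add [Fintype S] [Fintype T] (J : Finset S) (I : Finset T) (f g : Matrix S T ℂ) :
    mask J I (f + g) = mask J I f + mask J I g := by
  simp [mask, Matrix.mul_add, Matrix.add_mul]

theorem mask_sub [Fintype S] [Fintype T] (J : Finset S) (I : Finset T) (f g : Matrix S T ℂ) :
    mask J I (f - g) = mask J I f - mask J I g := by
  simp [mask, Matrix.mul_sub, Matrix.sub_mul]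

theorem mask_mask [Fintype S] [Fintype T] (J : Finset S) (I : Finset T) (f : Matrix S T ℂ) :
    mask J I (mask J I f) = mask J I f := mask_eq (supp_mask' J I f)

/-- A subset invariant under masking is generic at the masked point. -/
theorem GenAt.mask [Fintype S] [Fintype T] {J : Finset S} {I : Finset T} {f : Matrix S T ℂ}
    {P : Matrix S T ℂ → Prop} (h : GenAt f {x | P (mask J I x)}) :
    GenAt (mask J I f) {x | P (mask J I x)} := by
  have h1 : GenAt ((f - _root_.mask J I f) + LinearMap.id (R := ℂ) (_root_.mask J I f))
      {x | P (_root_.mask J I x)} := by simpa using h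
  refine (GenAt.preimage _ _ h1).mono fun x hx => ?_
  simpa [mask_add, mask_sub, mask_mask] using hx

/-- Generic square matrices are invertible. -/
theorem gen_invertible [Fintype S] [Fintype T] {J : Finset S} {I : Finset T}
    (h : I.card = J.card) : Gen {f : Matrix S T ℂ | ∃ F, Supp F I J ∧ mask J I f * F = pr J ∧
      F * mask J I f = pr I} := by
  classical
  let e : I ≃ J := Finset.equivOfCardEq h
  let N : Matrix S T ℂ → Matrix I I ℂ := fun f => Matrix.of fun a b => f (e a) b
  refine ⟨Matrix.of fun s t => if hs : s ∈ J then (if ((e.symm ⟨s, hs⟩ : I) : T) = t then 1 else 0)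
    else 0, fun f => (N f).det, ?_, ?_, ?_⟩
  · refine PolyFun.det fun i j x y => ⟨Polynomial.C (x (e i) j) + Polynomial.X *
      Polynomial.C (y (e i) j), fun t => by simp [N]; ring⟩
  · have : N (Matrix.of fun s t => if hs : s ∈ J then
        (if ((e.symm ⟨s, hs⟩ : I) : T) = t then 1 else 0) else 0) = 1 := by
      ext a b
      simp only [N, Matrix.of_apply, Matrix.one_apply, (e a).2, dif_pos, Subtype.coe_eta,
        Equiv.symm_apply_apply, Subtype.ext_iff]
    dsimp only
    rw [this]; simp
  · intro f hf
    have hu : IsUnit (N f).det := isUnit_iff_ne_zero.2 hf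
    let F : Matrix T S ℂ := Matrix.of fun t s => if h : t ∈ I ∧ s ∈ J then
      (N f)⁻¹ ⟨t, h.1⟩ (e.symm ⟨s, h.2⟩) else 0
    have hF : Supp F I J := fun t s hts => by
      by_contra h; simp [F, h] at hts
    have hm : ∀ s t, mask J I f s t = if s ∈ J ∧ t ∈ I then f s t else 0 := by
      intro s t
      simp [mask, mul_pr_apply, pr_mul_apply]
      split_ifs <;> simp_all
    refine ⟨F, hF, ?_, ?_⟩
    · ext s s'
      rw [Matrix.mul_apply, pr_apply]
      by_cases hs : s ∈ J
      · by_cases hs' : s' ∈ J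
        · have h1 := congrFun (congrFun (Matrix.mul_nonsing_inv _ hu) (e.symm ⟨s, hs⟩))
            (e.symm ⟨s', hs'⟩)
          rw [Matrix.mul_apply, Finset.univ_eq_attach] at h1
          rw [← Finset.sum_subset (Finset.subset_univ I), ← Finset.sum_attach]
          · convert h1 using 1
            · refine Finset.sum_congr rfl fun t _ => ?_
              rw [hm]
              simp [hs, F, hs', N]
            · simp [Matrix.one_apply, hs]
          · intro t _ ht
            rw [hm]; simp [ht]
        · rw [Finset.sum_eq_zero, if_neg]
          · rintro ⟨rfl, h⟩; exact hs' h
          · intro t _; simp [F, hs']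
      · rw [Finset.sum_eq_zero, if_neg (by tauto)]
        intro t _; rw [hm]; simp [hs]
    · ext t t'
      rw [Matrix.mul_apply, pr_apply]
      by_cases ht : t ∈ I
      · by_cases ht' : t' ∈ I
        · have h1 := congrFun (congrFun (Matrix.nonsing_inv_mul _ hu) ⟨t, ht⟩) ⟨t', ht'⟩
          rw [Matrix.mul_apply] at h1
          rw [← Finset.sum_subset (Finset.subset_univ J), ← Finset.sum_attach,
            ← Finset.univ_eq_attach, ← e.sum_comp]
          · convert h1 using 1
            · refine Finset.sum_congr rfl fun a _ => ?_
              rw [hm]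
              simp [ht, F, ht', N]
            · simp [Matrix.one_apply, ht]
          · intro s _ hs
            rw [hm]; simp [hs]
        · rw [Finset.sum_eq_zero, if_neg]
          · rintro ⟨rfl, h⟩; exact ht' h
          · intro s _; rw [hm]; simp [ht']
      · rw [Finset.sum_eq_zero, if_neg (by tauto)]
        intro s _; simp [F, ht]

end Subrepresentation

open Module (finrank)

section Schofield

variable {S T : Type} [Fintype S] [Fintype T] [BlockOrder S] [BlockOrder T]

/-- The map `(φ, ψ) ↦ g φ - ψ f` on filtered matrices. -/
noncomputable def dMap (I : Finset T) (J : Finset S) (K : Finset T) (L : Finset S)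
    (f g : Matrix S T ℂ) : (entr (filPos K I) × entr (filPos L J)) →ₗ[ℂ] Matrix S T ℂ where
  toFun v := mask L K g * v.1.1 - v.2.1 * mask J I f
  map_add' v w := by simp [Matrix.mul_add, Matrix.add_mul]; abel
  map_smul' c v := by simp [smul_sub]

theorem dMap_apply (I : Finset T) (J : Finset S) (K : Finset T) (L : Finset S)
    (f g : Matrix S T ℂ) (v) :
    dMap I J K L f g v = mask L K g * v.1.1 - v.2.1 * mask J I f := rfl

theorem mask_smul (J : Finset S) (I : Finset T) (c : ℂ) (f : Matrix S T ℂ) :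
    mask J I (c • f) = c • mask J I f := by
  simp [mask]

theorem dMap_line (I : Finset T) (J : Finset S) (K : Finset T) (L : Finset S)
    (f g f' g' : Matrix S T ℂ) (t : ℂ) :
    dMap I J K L (f + t • f') (g + t • g') = dMap I J K L f g + t • dMap I J K L f' g' := by
  ext1
  all_goals
    ext1 v
    simp only [dMap_apply, LinearMap.comp_apply, LinearMap.add_apply, LinearMap.smul_apply,
      mask_add, mask_smul, Matrix.add_mul, Matrix.mul_add, smul_sub, Matrix.smul_mul,
      Matrix.mul_smul]
    abel

theorem dMap_range_le (I : Finset T) (J : Finset S) (K : Finset T) (L : Finset S)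
    (f g : Matrix S T ℂ) : LinearMap.range (dMap I J K L f g) ≤ entr (L ×ˢ I) := by
  rintro _ ⟨⟨φ, ψ⟩, rfl⟩
  rw [mem_entr_prod]
  exact ((supp_mask' _ _ _).mul (mem_entr_filPos.1 φ.2).1).sub
    ((mem_entr_filPos.1 ψ.2).1.mul (supp_mask' _ _ _))

theorem dMap_range_eq {I : Finset T} {J : Finset S} {K : Finset T} {L : Finset S}
    {f g : Matrix S T ℂ} (h : L.card * I.card ≤ finrank ℂ (LinearMap.range (dMap I J K L f g))) :
    LinearMap.range (dMap I J K L f g) = entr (L ×ˢ I) := by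
  apply Submodule.eq_of_le_of_finrank_le (dMap_range_le I J K L f g)
  rwa [finrank_entr, Finset.card_product]

theorem dMap_mask (I : Finset T) (J : Finset S) (K : Finset T) (L : Finset S)
    (f g : Matrix S T ℂ) : dMap I J K L (mask J I f) (mask L K g) = dMap I J K L f g := by
  apply LinearMap.ext
  intro v
  simp only [dMap_apply, mask_mask]

theorem genAt_dMap_left (I : Finset T) (J : Finset S) (K : Finset T) (L : Finset S)
    (f₀ g : Matrix S T ℂ) : GenAt f₀ {f | finrank ℂ (LinearMap.range (dMap I J K L f₀ g)) ≤
      finrank ℂ (LinearMap.range (dMap I J K L f g))} := by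
  refine genAt_rank (fun f => dMap I J K L f g) (fun v l x y => ?_) f₀
  refine ⟨Polynomial.C (l (dMap I J K L x g v)) +
    Polynomial.X * Polynomial.C (l (dMap I J K L y 0 v)), fun t => ?_⟩
  have := dMap_line I J K L x g y 0 t
  rw [smul_zero, add_zero] at this
  simp [this]
  ring

theorem genAt_dMap_right (I : Finset T) (J : Finset S) (K : Finset T) (L : Finset S)
    (f g₀ : Matrix S T ℂ) : GenAt g₀ {g | finrank ℂ (LinearMap.range (dMap I J K L f g₀)) ≤
      finrank ℂ (LinearMap.range (dMap I J K L f g))} := by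
  refine genAt_rank (fun g => dMap I J K L f g) (fun v l x y => ?_) g₀
  refine ⟨Polynomial.C (l (dMap I J K L f x v)) +
    Polynomial.X * Polynomial.C (l (dMap I J K L 0 y v)), fun t => ?_⟩
  have := dMap_line I J K L f x 0 y t
  rw [smul_zero, add_zero] at this
  simp [this]
  ring

/-- The maps all of whose subrepresentations pair nonnegatively with `(K, L)`. -/
def subNonneg (I : Finset T) (J : Finset S) (K : Finset T) (L : Finset S) :
    Set (Matrix S T ℂ) :=
  {f | ∀ I' J', I'.card = J'.card → HasSub (mask J I f) I J I' J' → 0 ≤ pairing I' J' K L}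

/-- Factorization of matrices through a column echelon matrix. -/
theorem IsEch.exists_factor {J J' : Finset S} {C' : Matrix S S ℂ} (hC' : IsEch C' J J')
    {I' : Finset T} {M : Matrix S T ℂ} (hM : Supp M J I')
    (h : ∀ v, M *ᵥ v ∈ LinearMap.range C'.mulVecLin) : ∃ B, Supp B J' I' ∧ M = C' * B := by
  classical
  obtain ⟨E, D, hE, hD, hED, hDE, hE', hD'⟩ := hC'.exists_completion
  refine ⟨pr J' * D * M, ?_, ?_⟩
  · rw [Matrix.mul_assoc]
    exact (supp_pr J').mul (hD.supp.mul hM)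
  · apply Matrix.toLin'.injective
    apply LinearMap.ext
    intro v
    obtain ⟨u, hu⟩ := h v
    rw [Matrix.mulVecLin_apply] at hu
    simp only [Matrix.toLin'_apply]
    rw [← Matrix.mul_assoc, ← Matrix.mul_assoc, hC'.supp.mul_pr subset_rfl, ← Matrix.mulVec_mulVec,
      ← hu, Matrix.mulVec_mulVec, Matrix.mul_assoc, hD', hC'.supp.mul_pr subset_rfl]

/-- The kernel of a filtered morphism between invertible representations is a subrepresentation. -/
theorem exists_kernel_sub {I : Finset T} {J : Finset S} {K : Finset T} {L : Finset S}
    {f g : Matrix S T ℂ} {F G : Matrix T S ℂ} (hf : Supp f J I) (hF : Supp F I J)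
    (hfF : f * F = pr J) (hFf : F * f = pr I) (hGg : G * g = pr K)
    {φ : Matrix T T ℂ} {ψ : Matrix S S ℂ} (hφ : Supp φ K I) (hφu : IsUp φ)
    (hψ : Supp ψ L J) (hψu : IsUp ψ) (hk : g * φ = ψ * f) :
    ∃ I' J' C C' B, IsEch C I I' ∧ IsEch C' J J' ∧ Supp B J' I' ∧ f * C = C' * B ∧
      I'.card = J'.card ∧ φ * C = 0 ∧ ψ * C' = 0 ∧
      ∀ v ∈ coord I, φ *ᵥ v = 0 → v ∈ LinearMap.range C.mulVecLin := by
  classical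
  obtain ⟨I', C, hC, hCr⟩ := (hφu.graded_ker.inf (graded_coord I)).exists_echelon inf_le_right
  obtain ⟨J', C', hC', hCr'⟩ := (hψu.graded_ker.inf (graded_coord J)).exists_echelon inf_le_right
  have memC : ∀ v, v ∈ LinearMap.range C.mulVecLin ↔ φ *ᵥ v = 0 ∧ v ∈ coord I := fun v => by
    rw [hCr]; rfl
  have memC' : ∀ v, v ∈ LinearMap.range C'.mulVecLin ↔ ψ *ᵥ v = 0 ∧ v ∈ coord J := fun v => by
    rw [hCr']; rfl
  have hmap : LinearMap.range C'.mulVecLin = (LinearMap.range C.mulVecLin).map f.mulVecLin := by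
    ext v
    rw [memC', Submodule.mem_map]
    constructor
    · rintro ⟨h1, h2⟩
      have hfv : f *ᵥ (F *ᵥ v) = v := by rw [Matrix.mulVec_mulVec, hfF, pr_mulVec h2]
      refine ⟨F *ᵥ v, (memC _).2 ⟨?_, hF.mulVec_mem v⟩, hfv⟩
      have h3 : g *ᵥ (φ *ᵥ (F *ᵥ v)) = 0 := by
        rw [Matrix.mulVec_mulVec, hk, ← Matrix.mulVec_mulVec, hfv, h1]
      have h4 := congrArg (G *ᵥ ·) h3
      simp only [Matrix.mulVec_zero] at h4
      rwa [Matrix.mulVec_mulVec, hGg, pr_mulVec (hφ.mulVec_mem _)] at h4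
    · rintro ⟨u, hu, rfl⟩
      rw [memC] at hu
      refine ⟨?_, hf.mulVec_mem u⟩
      rw [Matrix.mulVecLin_apply, Matrix.mulVec_mulVec, ← hk, ← Matrix.mulVec_mulVec, hu.1,
        Matrix.mulVec_zero]
  obtain ⟨B, hB, hfC⟩ := hC'.exists_factor (M := f * C) (hf.mul hC.supp) fun v => by
    rw [hmap]
    exact ⟨C *ᵥ v, ⟨v, rfl⟩, by simp⟩
  refine ⟨I', J', C, C', B, hC, hC', hB, hfC, ?_, ?_, ?_, fun v hv h => (memC v).2 ⟨h, hv⟩⟩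
  · rw [← hC.finrank_range, ← hC'.finrank_range, hmap, ← LinearMap.range_domRestrict]
    symm
    apply LinearMap.finrank_range_of_inj
    rw [← LinearMap.ker_eq_bot, LinearMap.ker_eq_bot']
    rintro ⟨v, hv⟩ h0
    have h0 : f *ᵥ v = 0 := h0
    have h1 := congrArg (F *ᵥ ·) h0
    simp only [Matrix.mulVec_zero] at h1
    rw [Matrix.mulVec_mulVec, hFf, pr_mulVec ((memC v).1 hv).2] at h1
    exact Subtype.ext h1
  · apply Matrix.toLin'.injective
    apply LinearMap.ext
    intro v
    simpa using ((memC (C *ᵥ v)).1 ⟨v, rfl⟩).1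
  · apply Matrix.toLin'.injective
    apply LinearMap.ext
    intro v
    simpa using ((memC' (C' *ᵥ v)).1 ⟨v, rfl⟩).1

/-- Genericity of the condition defining `subNonneg` passes to subrepresentations. -/
theorem genAt_subNonneg_sub {I : Finset T} {J : Finset S} {K : Finset T} {L : Finset S}
    {f : Matrix S T ℂ} (hf : Supp f J I) (hgen : GenAt f (subNonneg I J K L))
    {I' : Finset T} {J' : Finset S} {C : Matrix T T ℂ} {C' : Matrix S S ℂ} {B : Matrix S T ℂ}
    (hC : IsEch C I I') (hC' : IsEch C' J J') (hB : Supp B J' I') (h : f * C = C' * B) :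
    GenAt B (subNonneg I' J' K L) := by
  obtain ⟨E, D, hE, hD, hED, hDE, hE', hD'⟩ := hC.exists_completion
  let Λ : Matrix S T ℂ →ₗ[ℂ] Matrix S T ℂ :=
    { toFun := fun X => C' * X * (pr I' * D)
      map_add' := fun X Y => by simp [Matrix.mul_add, Matrix.add_mul]
      map_smul' := fun c X => by simp }
  have h1 : GenAt ((f - Λ B) + Λ B) (subNonneg I J K L) := by simpa using hgen
  refine (GenAt.preimage _ _ h1).mono fun X hX I'' J'' hcard ⟨C2, C2', B2, hC2, hC2', hB2, h2⟩ => ?_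
  have hsupp : Supp (f - Λ B + Λ X) J I := by
    have hΛ : ∀ X, Supp (Λ X) J I := fun X => by
      have : Λ X = C' * (X * pr I' * D) := by simp [Λ, Matrix.mul_assoc]
      have h3 : C' * (X * pr I' * D) = pr J * (C' * (X * pr I' * D)) * pr I := by
        rw [← Matrix.mul_assoc (pr J), hC'.supp.pr_mul subset_rfl, 
          Matrix.mul_assoc C', Matrix.mul_assoc (X * pr I'), hD.supp.mul_pr subset_rfl]
      rw [this, h3]
      exact supp_mask _ _ _
    exact (hf.sub (hΛ _)).add (hΛ _)
  refine hX I'' J'' hcard ⟨C * C2, C' * C2', B2, hC.mul hC2, hC'.mul hC2', hB2, ?_⟩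
  rw [mask_eq hsupp]
  have hΛC : ∀ X, Λ X * C = C' * X * pr I' := fun X => by
    show C' * X * (pr I' * D) * C = _
    rw [Matrix.mul_assoc, Matrix.mul_assoc (pr I'), hD', pr_mul_self]
  have h4 : (f - Λ B + Λ X) * C = C' * mask J' I' X := by
    rw [Matrix.add_mul, Matrix.sub_mul, h, hΛC, hΛC, Matrix.mul_assoc C' B, hB.mul_pr subset_rfl,
      sub_self, zero_add, mask, ← Matrix.mul_assoc, ← Matrix.mul_assoc, hC'.supp.mul_pr subset_rfl]
  rw [← Matrix.mul_assoc, h4, Matrix.mul_assoc, h2, Matrix.mul_assoc]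

end Schofield

section SchofieldMain

variable {S T : Type} [Fintype S] [Fintype T] [BlockOrder S] [BlockOrder T]

theorem exists_factor_right {R : Type} [Fintype R] {θ : Matrix S T ℂ} {φ : Matrix R T ℂ}
    (h : ∀ v, φ *ᵥ v = 0 → θ *ᵥ v = 0) : ∃ γ : Matrix S R ℂ, θ = γ * φ := by
  classical
  obtain ⟨l, hl⟩ := LinearMap.exists_extend
    (((LinearMap.ker φ.mulVecLin).liftQ θ.mulVecLin fun v hv => h v hv).comp
      φ.mulVecLin.quotKerEquivRange.symm.toLinearMap)
  refine ⟨LinearMap.toMatrix' l, ?_⟩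
  apply Matrix.toLin'.injective
  apply LinearMap.ext
  intro v
  have h1 := LinearMap.congr_fun hl ⟨φ *ᵥ v, v, rfl⟩
  have h2 : φ.mulVecLin.quotKerEquivRange.symm ⟨φ *ᵥ v, v, rfl⟩ = Submodule.Quotient.mk v := by
    rw [LinearEquiv.symm_apply_eq]; rfl
  simp only [LinearMap.comp_apply, LinearEquiv.coe_coe, h2] at h1
  have h3 : l (φ *ᵥ v) = θ *ᵥ v := h1
  rw [Matrix.toLin'_mul, Matrix.toLin'_toMatrix', LinearMap.comp_apply, Matrix.toLin'_apply,
    Matrix.toLin'_apply, h3]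

/-- The perturbation argument: if the rank at `(f, g)` is maximal with respect to `g`, and the
difference map is surjective on the subrepresentation given by the kernel of `φ`, then it is
surjective. -/
theorem dMap_surjective_of_sub {I : Finset T} {J : Finset S} {K : Finset T} {L : Finset S}
    {f g : Matrix S T ℂ} (hf : Supp f J I) (hg : Supp g L K)
    (hmax : ∀ g', finrank ℂ (LinearMap.range (dMap I J K L f g')) ≤
      finrank ℂ (LinearMap.range (dMap I J K L f g)))
    {φ : Matrix T T ℂ} {ψ : Matrix S S ℂ} (hφ : Supp φ K I) (hφu : IsUp φ)
    (hψ : Supp ψ L J) (hψu : IsUp ψ) (hk : g * φ = ψ * f)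
    {I' : Finset T} {J' : Finset S} {C : Matrix T T ℂ} {C' : Matrix S S ℂ} {B : Matrix S T ℂ}
    (hC : IsEch C I I') (hC' : IsEch C' J J') (hB : Supp B J' I') (hfC : f * C = C' * B)
    (hker : ∀ v ∈ coord I, φ *ᵥ v = 0 → v ∈ LinearMap.range C.mulVecLin)
    (hsurj : L.card * I'.card ≤ finrank ℂ (LinearMap.range (dMap I' J' K L B g))) :
    L.card * I.card ≤ finrank ℂ (LinearMap.range (dMap I J K L f g)) := by
  classical
  suffices h : entr (L ×ˢ I) ≤ LinearMap.range (dMap I J K L f g) by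
    have := Submodule.finrank_mono h
    rwa [finrank_entr, Finset.card_product] at this
  -- elements vanishing on the subrepresentation
  have hvan : ∀ θ, Supp θ L I → θ * C = 0 → θ ∈ LinearMap.range (dMap I J K L f g) := by
    intro θ hθ hθC
    obtain ⟨γ, hγ⟩ := exists_factor_right (θ := θ) (φ := φ) (by
      intro v hv
      have h1 : φ *ᵥ (pr I *ᵥ v) = 0 := by
        rw [Matrix.mulVec_mulVec, hφ.mul_pr subset_rfl, hv]
      obtain ⟨u, hu⟩ := hker _ (pr_mulVec_mem I v) h1
      rw [← hθ.mul_pr subset_rfl, ← Matrix.mulVec_mulVec, ← hu, Matrix.mulVecLin_apply,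
        Matrix.mulVec_mulVec, hθC, Matrix.zero_mulVec])
    let v : entr (filPos K I) × entr (filPos L J) :=
      ⟨⟨φ, mem_entr_filPos.2 ⟨hφ, hφu⟩⟩, ⟨ψ, mem_entr_filPos.2 ⟨hψ, hψu⟩⟩⟩
    have := mem_range_of_rank_le (dMap I J K L f g) (dMap I J K L 0 γ) (x := v) (fun t => by
      have := dMap_line I J K L f g 0 γ t
      rw [smul_zero, add_zero] at this
      rw [← this]
      exact hmax _) (by
        rw [dMap_apply, mask_eq hf, mask_eq hg]
        exact sub_eq_zero.2 hk)
    convert this using 1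
    rw [dMap_apply]
    have h0 : mask J I (0 : Matrix S T ℂ) = 0 := by simp [mask]
    rw [h0, Matrix.mul_zero, sub_zero, mask, Matrix.mul_assoc]
    show θ = pr L * γ * (pr K * φ)
    rw [hφ.pr_mul subset_rfl, Matrix.mul_assoc, ← hγ, hθ.pr_mul subset_rfl]
  intro θ hθ
  rw [mem_entr_prod] at hθ
  obtain ⟨E, D, hE, hD, hED, hDE, hE', hD'⟩ := hC.exists_completion
  obtain ⟨E₂, D₂, hE₂, hD₂, hED₂, hDE₂, hE₂', hD₂'⟩ := hC'.exists_completion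
  have hmem : θ * C ∈ LinearMap.range (dMap I' J' K L B g) := by
    rw [dMap_range_eq hsurj, mem_entr_prod]
    exact hθ.mul hC.supp
  obtain ⟨⟨⟨φ₁, hφ₁⟩, ⟨ψ₁, hψ₁⟩⟩, h1⟩ := hmem
  rw [dMap_apply, mask_eq hB, mask_eq hg] at h1
  simp only at h1
  rw [mem_entr_filPos] at hφ₁ hψ₁
  let v : entr (filPos K I) × entr (filPos L J) :=
    ⟨⟨φ₁ * D, mem_entr_filPos.2 ⟨(hφ₁.1.mono subset_rfl hC.subset).mul hD.supp,
      hφ₁.2.mul hD.up⟩⟩, ⟨ψ₁ * D₂, mem_entr_filPos.2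
      ⟨(hψ₁.1.mono subset_rfl hC'.subset).mul hD₂.supp, hψ₁.2.mul hD₂.up⟩⟩⟩
  have h2 : θ - dMap I J K L f g v ∈ LinearMap.range (dMap I J K L f g) := by
    apply hvan
    · exact hθ.sub (mem_entr_prod.1 (dMap_range_le I J K L f g ⟨v, rfl⟩))
    · rw [dMap_apply, mask_eq hf, mask_eq hg, Matrix.sub_mul, Matrix.sub_mul, Matrix.mul_assoc g,
        Matrix.mul_assoc _ f, hfC]
      show θ * C - (g * (φ₁ * D * C) - ψ₁ * D₂ * (C' * B)) = 0
      rw [Matrix.mul_assoc φ₁, hD', hφ₁.1.mul_pr subset_rfl, ← Matrix.mul_assoc,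
        Matrix.mul_assoc ψ₁, hD₂', hψ₁.1.mul_pr subset_rfl, h1, sub_self]
  have := Submodule.add_mem _ h2 ⟨v, rfl⟩
  rwa [sub_add_cancel] at this

/-- If the generic subrepresentations of type `(I', J')` of the generic representation of type
`(I, J)` pair nonnegatively with `(K, L)`, then `dMap` is generically surjective. -/
theorem exists_dMap_surjective {K : Finset T} {L : Finset S} (hKL : K.card = L.card) (n : ℕ) :
    ∀ (I : Finset T) (J : Finset S), I.card = n → J.card = n → Gen (subNonneg I J K L) →
      ∃ f g, L.card * I.card ≤ finrank ℂ (LinearMap.range (dMap I J K L f g)) := by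
  classical
  induction n using Nat.strong_induction_on with
  | _ n ih =>
  intro I J hI hJ hgen
  by_contra! hcon
  -- the maximal rank
  let ranks : Set ℕ := {r | ∃ f g, finrank ℂ (LinearMap.range (dMap I J K L f g)) = r}
  have hbdd : BddAbove ranks := ⟨L.card * I.card, by rintro r ⟨f, g, rfl⟩; exact (hcon f g).le⟩
  obtain ⟨f₀, g₀, hρ⟩ : sSup ranks ∈ ranks := Nat.sSup_mem ⟨_, 0, 0, rfl⟩ hbdd
  have hle : ∀ f g, finrank ℂ (LinearMap.range (dMap I J K L f g)) ≤
      finrank ℂ (LinearMap.range (dMap I J K L f₀ g₀)) := fun f g => by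
    rw [hρ]; exact le_csSup hbdd ⟨f, g, rfl⟩
  have hsubs : ∀ p : Finset T × Finset S, ∃ h g, (p.1.card < n → p.2.card = p.1.card →
      Gen (subNonneg p.1 p.2 K L) →
      L.card * p.1.card ≤ finrank ℂ (LinearMap.range (dMap p.1 p.2 K L h g))) := by
    intro p
    by_cases hp : p.1.card < n ∧ p.2.card = p.1.card ∧ Gen (subNonneg p.1 p.2 K L)
    · obtain ⟨h, g, hg⟩ := ih _ hp.1 p.1 p.2 rfl hp.2.1 hp.2.2
      exact ⟨h, g, fun _ _ _ => hg⟩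
    · exact ⟨0, 0, fun a b c => absurd ⟨a, b, c⟩ hp⟩
  choose h γ hγ using hsubs
  obtain ⟨g, ⟨⟨hgsub, hginv⟩, hgmax⟩⟩ := (((Gen.iInter fun p : Finset T × Finset S =>
    (genAt_dMap_right p.1 p.2 K L (h p) (γ p)).gen).inter (gen_invertible hKL)).inter
    (genAt_dMap_right I J K L f₀ g₀).gen).nonempty
  obtain ⟨G, hG, hGg', hGg⟩ := hginv
  obtain ⟨f, ⟨⟨hfsub, hfinv⟩, hfmax⟩⟩ := ((hgen.genAt.inter
    (gen_invertible (hI.trans hJ.symm))).inter (genAt_dMap_left I J K L f₀ g).gen).nonempty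
  obtain ⟨F, hF, hfF, hFf⟩ := hfinv
  rw [Set.mem_ofPred_eq] at hfmax hgmax
  have hfmax := hgmax.trans hfmax
  have hfsub' : GenAt (mask J I f) (subNonneg I J K L) := by
    let P : Matrix S T ℂ → Prop := fun f => ∀ I' J', I'.card = J'.card → HasSub f I J I' J' →
      0 ≤ pairing I' J' K L
    rw [Set.mem_ofPred_eq] at hfsub
    exact GenAt.mask (P := P) hfsub
  rw [← dMap_mask I J K L f g] at hfmax
  have hgsub' : ∀ p, finrank ℂ (LinearMap.range (dMap p.1 p.2 K L (h p) (γ p))) ≤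
      finrank ℂ (LinearMap.range (dMap p.1 p.2 K L (mask p.2 p.1 (h p)) (mask L K g))) := by
    intro p; rw [dMap_mask]; exact hgsub p
  have hfs := supp_mask' J I f
  have hgs := supp_mask' L K g
  generalize mask J I f = f at *
  generalize mask L K g = g at *
  clear hgsub hgmax hfsub
  -- a nonzero kernel element
  have hpair : 0 ≤ pairing I J K L := hfsub'.mem I J (hI.trans hJ.symm)
    (by rw [mask_eq hfs]; exact hasSub_self hfs)
  have hdim : finrank ℂ (LinearMap.range (dMap I J K L f g)) <
      finrank ℂ (entr (filPos K I) × entr (filPos L J)) := by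
    refine (hcon f g).trans_le ?_
    rw [Module.finrank_prod, finrank_entr, finrank_entr]
    unfold pairing at hpair
    have : ((L.card * I.card : ℕ) : ℤ) ≤ ((filPos K I).card + (filPos L J).card : ℕ) := by
      push_cast; linarith
    exact_mod_cast this
  have hkne : LinearMap.ker (dMap I J K L f g) ≠ ⊥ := by
    intro h0
    have := LinearMap.finrank_range_add_finrank_ker (dMap I J K L f g)
    rw [h0, finrank_bot] at this
    omega
  obtain ⟨⟨⟨φ, hφ⟩, ⟨ψ, hψ⟩⟩, hk, hne⟩ := Submodule.exists_mem_ne_zero_of_ne_bot hkne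
  rw [LinearMap.mem_ker, dMap_apply, mask_eq hfs, mask_eq hgs] at hk
  have hk : g * φ = ψ * f := sub_eq_zero.1 hk
  rw [mem_entr_filPos] at hφ hψ
  have hφ0 : φ ≠ 0 := by
    rintro rfl
    apply hne
    have : ψ = 0 := by
      rw [← hψ.1.mul_pr subset_rfl, ← hfF, ← Matrix.mul_assoc, ← hk]; simp
    subst this
    rfl
  obtain ⟨I', J', C, C', B, hC, hC', hB, hfC, hcard, hφC, hψC, hker⟩ :=
    exists_kernel_sub hfs hF hfF hFf hGg hφ.1 hφ.2 hψ.1 hψ.2 hk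
  have hI' : I'.card < n := by
    rw [← hI]
    refine Finset.card_lt_card (lt_of_le_of_ne hC.subset ?_)
    rintro rfl
    obtain ⟨D, hD, hCD, -⟩ := hC.exists_inv
    apply hφ0
    rw [← hφ.1.mul_pr subset_rfl, ← hCD, ← Matrix.mul_assoc, hφC, Matrix.zero_mul]
  have hgB := genAt_subNonneg_sub hfs hfsub' hC hC' hB hfC
  have hgα := hγ (I', J') hI' hcard.symm hgB.gen
  have hgα := hgα.trans (hgsub' (I', J'))
  simp only at hgα
  set h₁ := mask J' I' (h (I', J')) with hh₁
  have hh₁s : Supp h₁ J' I' := supp_mask' _ _ _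
  clear_value h₁
  obtain ⟨E, D, hE, hD, hED, hDE, hE', hD'⟩ := hC.exists_completion
  -- deform `f`
  have e1 : GenAt (f + (0 : ℂ) • (C' * (h₁ - B) * (pr I' * D)))
      {x | finrank ℂ (LinearMap.range (dMap I J K L f g)) ≤
      finrank ℂ (LinearMap.range (dMap I J K L x g))} := by
    simpa using genAt_dMap_left I J K L f g
  have e2 : GenAt (B + (1 : ℂ) • (h₁ - B))
      {x | finrank ℂ (LinearMap.range (dMap I' J' K L h₁ g)) ≤
      finrank ℂ (LinearMap.range (dMap I' J' K L x g))} := by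
    simpa using genAt_dMap_left I' J' K L h₁ g
  obtain ⟨t, ht1, ht2⟩ := (e1.eventually.and e2.eventually).exists
  have ht1 := ht1.mem
  have ht2 := ht2.mem
  simp only [Set.mem_ofPred_eq] at ht1 ht2
  have hfs' : Supp (f + t • (C' * (h₁ - B) * (pr I' * D))) J I := by
    refine hfs.add (Supp.smul ?_ t)
    exact (hC'.supp.mul (hh₁s.sub hB)).mul
      (((supp_pr I').mono subset_rfl hC.subset).mul hD.supp)
  have hk' : g * φ = ψ * (f + t • (C' * (h₁ - B) * (pr I' * D))) := by
    rw [Matrix.mul_add, ← hk, Matrix.mul_smul, ← Matrix.mul_assoc ψ,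
      ← Matrix.mul_assoc ψ, hψC]
    simp
  have hfC' : (f + t • (C' * (h₁ - B) * (pr I' * D))) * C = C' * (B + t • (h₁ - B)) := by
    rw [Matrix.add_mul, hfC, Matrix.smul_mul, Matrix.mul_assoc _ (pr I' * D),
      Matrix.mul_assoc (pr I'), hD', pr_mul_self, Matrix.mul_assoc,
      (hh₁s.sub hB).mul_pr subset_rfl, Matrix.mul_add, Matrix.mul_smul]
  have hB' : Supp (B + t • (h₁ - B)) J' I' := hB.add ((hh₁s.sub hB).smul t)
  have hmax : ∀ g', finrank ℂ (LinearMap.range (dMap I J K L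
      (f + t • (C' * (h₁ - B) * (pr I' * D))) g')) ≤ finrank ℂ (LinearMap.range (dMap I J K L
      (f + t • (C' * (h₁ - B) * (pr I' * D))) g)) :=
    fun g' => (hle _ _).trans (hfmax.trans ht1)
  have hs : L.card * I'.card ≤ finrank ℂ (LinearMap.range (dMap I' J' K L
      (B + t • (h₁ - B)) g)) := le_trans hgα ht2
  exact absurd (dMap_surjective_of_sub hfs' hgs hmax hφ.1 hφ.2 hψ.1 hψ.2 hk' hC hC' hB' hfC'
    hker hs) (not_le.2 (hcon _ _))

end SchofieldMain

section PolynomialMap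

/-- Polynomial functions in finitely many variables. -/
def IsMvPoly {σ : Type} (h : (σ → ℂ) → ℂ) : Prop :=
  ∃ p : MvPolynomial σ ℂ, ∀ v, h v = MvPolynomial.eval v p

theorem IsMvPoly.coordinate {σ : Type} (s : σ) : IsMvPoly fun v : σ → ℂ => v s :=
  ⟨MvPolynomial.X s, by simp⟩

theorem IsMvPoly.const {σ : Type} (c : ℂ) : IsMvPoly fun _ : σ → ℂ => c :=
  ⟨MvPolynomial.C c, by simp⟩

theorem IsMvPoly.add {σ : Type} {g h : (σ → ℂ) → ℂ} (hg : IsMvPoly g) (hh : IsMvPoly h) :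
    IsMvPoly fun v => g v + h v := by
  obtain ⟨p, hp⟩ := hg
  obtain ⟨q, hq⟩ := hh
  exact ⟨p + q, by simp [hp, hq]⟩

theorem IsMvPoly.mul {σ : Type} {g h : (σ → ℂ) → ℂ} (hg : IsMvPoly g) (hh : IsMvPoly h) :
    IsMvPoly fun v => g v * h v := by
  obtain ⟨p, hp⟩ := hg
  obtain ⟨q, hq⟩ := hh
  exact ⟨p * q, by simp [hp, hq]⟩

theorem IsMvPoly.sum {σ κ : Type} (s : Finset κ) {g : κ → (σ → ℂ) → ℂ}
    (hg : ∀ i ∈ s, IsMvPoly (g i)) : IsMvPoly fun v => ∑ i ∈ s, g i v := by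
  classical
  induction s using Finset.induction_on with
  | empty => simpa using IsMvPoly.const 0
  | insert a s ha ih =>
    simp only [Finset.sum_insert ha]
    exact (hg a (by simp)).add (ih fun i hi => hg i (by simp [hi]))

theorem polyFun_eval {ι : Type} (q : MvPolynomial ι ℂ) :
    PolyFun fun v : ι → ℂ => MvPolynomial.eval v q := by
  induction q using MvPolynomial.induction_on with
  | C a => simpa using PolyFun.const a
  | add p q hp hq => simpa using hp.add hq
  | mul_X p i hp => simpa using hp.mul (PolyFun.linear (LinearMap.proj i))

theorem gen_of_ne_zero {ι : Type} [Finite ι] {q : MvPolynomial ι ℂ} (hq : q ≠ 0) :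
    Gen {v : ι → ℂ | MvPolynomial.eval v q ≠ 0} := by
  obtain ⟨x, hx⟩ : ∃ x, MvPolynomial.eval x q ≠ 0 := by
    by_contra! h
    exact hq (MvPolynomial.funext fun x => by simp [h])
  exact ⟨x, _, polyFun_eval q, hx, fun y hy => hy⟩

theorem eval_aeval {σ ι : Type} (P : ι → MvPolynomial σ ℂ) (u : σ → ℂ) (q : MvPolynomial ι ℂ) :
    MvPolynomial.eval u (MvPolynomial.aeval P q) =
      MvPolynomial.eval (fun i => MvPolynomial.eval u (P i)) q := by
  induction q using MvPolynomial.induction_on with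
  | C a => simp
  | add p q hp hq => rw [map_add, map_add, map_add, hp, hq]
  | mul_X p i hp => rw [map_mul, map_mul, map_mul, hp, MvPolynomial.aeval_X, MvPolynomial.eval_X]

/-- Chevalley's dichotomy: the image of a polynomial map is generic, or its complement is. -/
theorem gen_range_or_gen_compl {σ ι : Type} [Fintype σ] [Fintype ι]
    (P : ι → MvPolynomial σ ℂ) :
    (Gen (Set.range fun (v : σ → ℂ) i => MvPolynomial.eval v (P i)) ∧
      Fintype.card ι ≤ Fintype.card σ) ∨
    Gen (Set.range fun (v : σ → ℂ) i => MvPolynomial.eval v (P i))ᶜ := by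
  classical
  by_cases hinj : Function.Injective (MvPolynomial.aeval P : MvPolynomial ι ℂ →ₐ[ℂ] MvPolynomial σ ℂ)
  swap
  · right
    rw [injective_iff_map_eq_zero] at hinj
    push Not at hinj
    obtain ⟨q, hq, hq0⟩ := hinj
    refine (gen_of_ne_zero hq0).mono ?_
    rintro _ hv ⟨u, rfl⟩
    rw [Set.mem_ofPred_eq] at hv
    apply hv
    have h := congrArg (MvPolynomial.eval u) hq
    rw [eval_aeval, map_zero] at h
    exact h
  left
  refine ⟨?_, ?_⟩
  · set φ : MvPolynomial ι ℂ →+* MvPolynomial σ ℂ :=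
      (MvPolynomial.aeval P : MvPolynomial ι ℂ →ₐ[ℂ] MvPolynomial σ ℂ).toRingHom with hφ
    have hev : ∀ u q, MvPolynomial.eval u (φ q) =
        MvPolynomial.eval (fun i => MvPolynomial.eval u (P i)) q := by
      exact eval_aeval P
    have hft : φ.FiniteType := by
      refine RingHom.FiniteType.of_comp_finiteType (f := (MvPolynomial.C : ℂ →+* _)) ?_
      have : φ.comp MvPolynomial.C = algebraMap ℂ (MvPolynomial σ ℂ) := by
        ext a; simp [hφ]
      rw [this, RingHom.finiteType_algebraMap]
      infer_instance
    have hfp : φ.FinitePresentation := RingHom.FinitePresentation.of_finiteType.1 hft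
    obtain ⟨D, hD⟩ := PrimeSpectrum.exists_constructibleSetData_iff.2
      (PrimeSpectrum.isConstructible_range_comap hfp)
    have hbot : (⟨⊥, Ideal.isPrime_bot⟩ : PrimeSpectrum (MvPolynomial ι ℂ)) ∈ D.toSet := by
      rw [hD]
      refine ⟨⟨⊥, Ideal.isPrime_bot⟩, ?_⟩
      ext q
      simp only [PrimeSpectrum.comap_asIdeal, Ideal.mem_comap, Ideal.mem_bot]
      exact ⟨fun h => hinj (h.trans (map_zero φ).symm), fun h => by simp [h]⟩
    simp only [PrimeSpectrum.ConstructibleSetData.toSet, Set.mem_iUnion] at hbot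
    obtain ⟨c, hcD, hc⟩ := hbot
    obtain ⟨hc1, hc2⟩ := hc
    have hg0 : ∀ i, c.g i = 0 := fun i => by
      simpa using hc1 ⟨i, rfl⟩
    have hf0 : c.f ≠ 0 := by
      intro h; exact hc2 (by simp [h])
    refine (gen_of_ne_zero hf0).mono fun v hv => ?_
    rw [Set.mem_ofPred_eq] at hv
    have hmem : (⟨MvPolynomial.vanishingIdeal ℂ {v}, inferInstance⟩ :
        PrimeSpectrum (MvPolynomial ι ℂ)) ∈ D.toSet := by
      simp only [PrimeSpectrum.ConstructibleSetData.toSet, Set.mem_iUnion]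
      refine ⟨c, hcD, ?_, ?_⟩
      · rintro _ ⟨i, rfl⟩; simp [hg0]
      · intro h
        have := h (Set.mem_singleton _)
        exact hv (by simpa [MvPolynomial.mem_vanishingIdeal_singleton_iff] using this)
    rw [hD] at hmem
    obtain ⟨Q, hQ⟩ := hmem
    obtain ⟨M, hM, hQM⟩ := Ideal.exists_le_maximal _ Q.2.ne_top
    obtain ⟨u, rfl⟩ := MvPolynomial.isMaximal_iff_eq_vanishingIdeal_singleton.1 hM
    refine ⟨u, ?_⟩
    ext i
    have h1 : (MvPolynomial.X i - MvPolynomial.C (v i)) ∈ (PrimeSpectrum.comap φ Q).asIdeal := by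
      rw [hQ]; simp [MvPolynomial.mem_vanishingIdeal_singleton_iff]
    have h2 := hQM (Ideal.mem_comap.1 h1)
    rw [MvPolynomial.mem_vanishingIdeal_singleton_iff] at h2
    have h3 := hev u (MvPolynomial.X i - MvPolynomial.C (v i))
    rw [MvPolynomial.aeval_eq_eval] at h2
    rw [h2] at h3
    simp at h3
    exact (sub_eq_zero.1 h3.symm)
  · have h : AlgebraicIndependent ℂ P := hinj
    have h1 := h.cardinalMk_le_trdeg
    rw [MvPolynomial.trdeg_of_isDomain] at h1
    simpa using h1

/-- A polynomial map with a point of surjective differential has generic image. -/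
theorem gen_range_of_deriv {σ ι : Type} [Fintype σ] [Fintype ι]
    (P : ι → MvPolynomial σ ℂ) (v₀ : σ → ℂ)
    (h : ∀ y : ι → ℂ, ∃ u : σ → ℂ, ∀ i,
      HasDerivAt (fun t : ℂ => MvPolynomial.eval (v₀ + t • u) (P i)) (y i) 0) :
    Gen (Set.range fun (v : σ → ℂ) i => MvPolynomial.eval v (P i)) := by
  refine (gen_range_or_gen_compl P).elim And.left fun hc => ?_
  set Ψ : (σ → ℂ) → (ι → ℂ) := fun v i => MvPolynomial.eval v (P i) with hΨ
  have hd : AnalyticAt ℂ Ψ v₀ := by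
    rw [analyticAt_pi_iff]
    intro i
    exact AnalyticOnNhd.eval_mvPolynomial (P i) v₀ (Set.mem_univ _)
  have hs := hd.hasStrictFDerivAt
  have hsurj : (fderiv ℂ Ψ v₀).range = ⊤ := by
    rw [eq_top_iff]
    intro y _
    obtain ⟨u, hu⟩ := h y
    refine ⟨u, ?_⟩
    have h1 : HasDerivAt (fun t : ℂ => Ψ (v₀ + t • u)) y 0 := hasDerivAt_pi.2 hu
    have h2 : HasDerivAt (fun t : ℂ => v₀ + t • u) u 0 := by
      simpa using ((hasDerivAt_id (0:ℂ)).smul_const u).const_add v₀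
    have h3 : HasFDerivAt Ψ (fderiv ℂ Ψ v₀) (v₀ + (0:ℂ) • u) := by simpa using hs.hasFDerivAt
    have h4 := HasFDerivAt.comp_hasDerivAt (f := fun t : ℂ => v₀ + t • u) (0:ℂ) h3 h2
    exact h4.unique h1
  have hmap := hs.map_nhds_eq_of_surj hsurj
  have hr : Set.range Ψ ∈ nhds (Ψ v₀) := by
    rw [← hmap]; exact Filter.range_mem_map
  obtain ⟨y, hy⟩ := hc.exists_direction (Ψ v₀)
  have hy2 : ∀ᶠ t : ℂ in nhdsWithin 0 {0}ᶜ, Ψ v₀ + t • y ∈ (Set.range Ψ)ᶜ :=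
    hy.filter_mono (nhdsNE_le_cofinite 0)
  have hcont : Filter.Tendsto (fun t : ℂ => Ψ v₀ + t • y) (nhdsWithin 0 {0}ᶜ) (nhds (Ψ v₀)) := by
    have : Continuous fun t : ℂ => Ψ v₀ + t • y := by fun_prop
    simpa using (this.tendsto 0).mono_left nhdsWithin_le_nhds
  obtain ⟨t, ht1, ht2⟩ := (hy2.and (hcont hr)).exists
  exact absurd ht2 ht1

end PolynomialMap

section Dominance

variable {S T : Type} [Fintype S] [Fintype T]

/-- A generic map from `I` to `J` has a subrepresentation in position `(I', J')`. -/
def Dom [PartialOrder S] [PartialOrder T] (I : Finset T) (J : Finset S) (I' : Finset T)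
    (J' : Finset S) : Prop :=
  Gen {f : Matrix S T ℂ | HasSub (mask J I f) I J I' J'}

theorem IsEch.exists_normalized [PartialOrder T] [DecidableEq T] {C : Matrix T T ℂ}
    {I I' : Finset T} (h : IsEch C I I') :
    ∃ D N : Matrix T T ℂ, IsEch D I' I' ∧ N ∈ entr (filPos (I \ I') I') ∧ C * D = pr I' + N ∧
      C = C * D * (pr I' * C) := by
  have h1 : IsEch (pr I' * C) I' I' := by
    refine ⟨?_, (isUp_pr I').mul h.up, fun a ha => ?_⟩
    · exact (supp_pr I').mul h.supp
    · rw [pr_mul_apply, if_pos ha]; exact h.diag a ha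
  obtain ⟨D, hD, hCD, hDC⟩ := h1.exists_inv
  refine ⟨D, pr (I \ I') * (C * D), hD, mem_entr_filPos.2 ⟨?_, ?_⟩, ?_, ?_⟩
  · exact (supp_pr _).mul (h.supp.mul hD.supp)
  · exact (isUp_pr _).mul (h.up.mul hD.up)
  · have h2 : pr I * (C * D) = C * D := (h.supp.mul hD.supp).pr_mul subset_rfl
    rw [← pr_add_pr_sdiff h.subset, Matrix.add_mul, ← Matrix.mul_assoc, hCD] at h2
    exact h2.symm
  · rw [Matrix.mul_assoc, hDC, h.supp.mul_pr subset_rfl]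

theorem supp_mul_eq_zero {R : Type} [Fintype R] {S T : Type} {A : Matrix S R ℂ} {B : Matrix R T ℂ}
    {J : Finset S} {K L : Finset R} {I : Finset T} (hA : Supp A J K) (hB : Supp B L I)
    (h : Disjoint K L) : A * B = 0 := by
  ext j i
  rw [Matrix.mul_apply]
  refine Finset.sum_eq_zero fun k _ => ?_
  by_contra h0
  exact Finset.disjoint_left.1 h (hA j k (left_ne_zero_of_mul h0)).2
    (hB k i (right_ne_zero_of_mul h0)).1

/-- The maps with a subrepresentation in position `(I', J')`, in parametrized form. -/
theorem hasSub_mask_iff [PartialOrder S] [PartialOrder T] [DecidableEq S] [DecidableEq T]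
    {I I' : Finset T} {J J' : Finset S} (hI : I' ⊆ I) (hJ : J' ⊆ J) (f : Matrix S T ℂ) :
    HasSub (mask J I f) I J I' J' ↔ ∃ n ∈ entr (filPos (J \ J') J'),
      ∃ f₀ ∈ entr (Finset.univ \ ((J \ J') ×ˢ I')), ∃ n' ∈ entr (filPos (I \ I') I'),
        f = (1 + n) * f₀ * (1 + n') := by
  constructor
  · rintro ⟨C, C', B, hC, hC', hB, hf⟩
    obtain ⟨D, N, hD, hN, hCD, -⟩ := hC.exists_normalized
    obtain ⟨D', N', hD', hN', hCD', hC'D'⟩ := hC'.exists_normalized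
    have sN := (mem_entr_filPos.1 hN).1
    have sN' := (mem_entr_filPos.1 hN').1
    have hNN : N * N = 0 := supp_mul_eq_zero sN sN Finset.disjoint_sdiff
    have hNN' : N' * N' = 0 := supp_mul_eq_zero sN' sN' Finset.disjoint_sdiff
    refine ⟨N', hN', (1 - N') * f * (1 + N), ?_, -N, neg_mem hN, ?_⟩
    · have key : mask (J \ J') I' ((1 - N') * f * (1 + N)) = 0 := by
        have e1 : (1 + N) * pr I' = pr I * (pr I' + N) := by
          rw [Matrix.add_mul, Matrix.mul_add, sN.mul_pr subset_rfl, Matrix.one_mul,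
            sN.pr_mul Finset.sdiff_subset, (supp_pr I').pr_mul hI]
        have e2 : pr (J \ J') * (1 - N') = (pr (J \ J') - N') * pr J := by
          rw [Matrix.mul_sub, Matrix.sub_mul, sN'.pr_mul subset_rfl, Matrix.mul_one,
            sN'.mul_pr hJ, (supp_pr (J \ J')).mul_pr Finset.sdiff_subset]
        have e3 : (pr (J \ J') - N') * (pr J' + N') = 0 := by
          rw [Matrix.sub_mul, Matrix.mul_add, Matrix.mul_add, sN'.pr_mul subset_rfl,
            sN'.mul_pr subset_rfl, hNN',
            supp_mul_eq_zero (supp_pr _) (supp_pr J') Finset.sdiff_disjoint]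
          simp
        calc mask (J \ J') I' ((1 - N') * f * (1 + N))
            = (pr (J \ J') * (1 - N')) * f * ((1 + N) * pr I') := by
              simp only [mask, Matrix.mul_assoc]
          _ = (pr (J \ J') - N') * (mask J I f * C) * D := by
              rw [e1, e2, ← hCD]; simp only [mask, Matrix.mul_assoc]
          _ = ((pr (J \ J') - N') * (C' * D')) * (pr J' * C') * B * D := by
              rw [hf]; nth_rw 1 [hC'D']; simp only [Matrix.mul_assoc]
          _ = 0 := by rw [hCD', e3]; simp
      intro i j hij
      simp only [Finset.mem_sdiff, Finset.mem_univ, true_and, Finset.mem_product]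
      intro hmem
      have := congrFun (congrFun key i) j
      rw [mask, mul_pr_apply, if_pos hmem.2, pr_mul_apply,
        if_pos (by simpa using hmem.1)] at this
      exact hij this
    · have a1 : (1 + N') * (1 - N') = 1 := by
        simp [Matrix.mul_sub, Matrix.add_mul, hNN']
      have a2 : (1 + N) * (1 + -N) = 1 := by
        simp [Matrix.mul_add, Matrix.add_mul, hNN]
      calc f = ((1 + N') * (1 - N')) * f * ((1 + N) * (1 + -N)) := by rw [a1, a2]; simp
        _ = _ := by simp only [Matrix.mul_assoc]
  · rintro ⟨n, hn, f₀, hf₀, n', hn', rfl⟩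
    have sn := (mem_entr_filPos.1 hn).1
    have sn' := (mem_entr_filPos.1 hn').1
    have un := (mem_entr_filPos.1 hn).2
    have un' := (mem_entr_filPos.1 hn').2
    have hnn' : n' * n' = 0 := supp_mul_eq_zero sn' sn' Finset.disjoint_sdiff
    refine ⟨pr I' - n', pr J' + n, pr J' * f₀ * pr I', ⟨?_, (isUp_pr _).sub un', ?_⟩,
      ⟨?_, (isUp_pr _).add un, ?_⟩, supp_mask' J' I' f₀, ?_⟩
    · exact ((supp_pr I').mono hI subset_rfl).sub (sn'.mono Finset.sdiff_subset subset_rfl)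
    · intro a ha
      have : n' a a = 0 := sn'.eq_zero (by simp [ha])
      simp [pr_apply, ha, this]
    · exact ((supp_pr J').mono hJ subset_rfl).add (sn.mono Finset.sdiff_subset subset_rfl)
    · intro a ha
      have : n a a = 0 := sn.eq_zero (by simp [ha])
      simp [pr_apply, ha, this]
    · have e1 : (1 + n') * pr I * (pr I' - n') = pr I' := by
        rw [Matrix.mul_assoc, Matrix.mul_sub, (supp_pr I').pr_mul hI,
          sn'.pr_mul Finset.sdiff_subset, Matrix.mul_sub, Matrix.add_mul, Matrix.add_mul, hnn',
          sn'.mul_pr subset_rfl]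
        simp
      have e2 : pr J * (1 + n) = pr J + n := by
        rw [Matrix.mul_add, sn.pr_mul Finset.sdiff_subset, Matrix.mul_one]
      have e3 : pr (J \ J') * (f₀ * pr I') = 0 := by
        ext i j
        rw [pr_mul_apply, mul_pr_apply]
        split_ifs with h1 h2
        · by_contra h0
          have := hf₀ i j h0
          simp only [Finset.mem_sdiff, Finset.mem_univ, true_and, Finset.mem_product] at this h1
          exact this ⟨h1, h2⟩
        · rfl
        · rfl
      have e4 : pr J * (f₀ * pr I') = pr J' * (f₀ * pr I') := by
        rw [← pr_add_pr_sdiff hJ, Matrix.add_mul, e3, add_zero]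
      calc mask J I ((1 + n) * f₀ * (1 + n')) * (pr I' - n')
          = (pr J * (1 + n)) * f₀ * ((1 + n') * pr I * (pr I' - n')) := by
            simp only [mask, Matrix.mul_assoc]
        _ = (pr J + n) * (f₀ * pr I') := by rw [e1, e2, Matrix.mul_assoc]
        _ = (pr J' + n) * (pr J' * f₀ * pr I') := by
            have e5 : pr J' * (pr J' * f₀ * pr I') = pr J' * f₀ * pr I' := by
              simp only [← Matrix.mul_assoc, pr_mul_self]
            have e6 : n * (pr J' * f₀ * pr I') = n * (f₀ * pr I') := by
              rw [Matrix.mul_assoc, ← Matrix.mul_assoc n, sn.mul_pr subset_rfl]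
            rw [Matrix.add_mul, Matrix.add_mul, e4, e5, e6, Matrix.mul_assoc]

/-- The matrix with prescribed entries at the positions in `P`. -/
noncomputable def entrMat [DecidableEq S] [DecidableEq T] (P : Finset (S × T)) (u : P → ℂ) :
    Matrix S T ℂ :=
  Matrix.of fun i j => if h : (i, j) ∈ P then u ⟨(i, j), h⟩ else 0

theorem entrMat_mem [DecidableEq S] [DecidableEq T] (P : Finset (S × T)) (u : P → ℂ) :
    entrMat P u ∈ entr P := by
  intro i j h
  by_contra h0
  simp [entrMat, h0] at h

theorem exists_entrMat [DecidableEq S] [DecidableEq T] {P : Finset (S × T)} {M : Matrix S T ℂ}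
    (h : M ∈ entr P) : ∃ u, entrMat P u = M := by
  refine ⟨fun p => M p.1.1 p.1.2, ?_⟩
  ext i j
  simp only [entrMat, Matrix.of_apply]
  split_ifs with h0
  · rfl
  · by_contra h1; exact h0 (h i j (Ne.symm h1))

theorem entrMat_add_smul [DecidableEq S] [DecidableEq T] (P : Finset (S × T)) (u v : P → ℂ)
    (t : ℂ) : entrMat P (u + t • v) = entrMat P u + t • entrMat P v := by
  ext i j
  simp only [entrMat, Matrix.of_apply, Matrix.add_apply, Matrix.smul_apply]
  split_ifs <;> simp

theorem isMvPoly_entrMat {σ : Type} [DecidableEq S] [DecidableEq T] (P : Finset (S × T))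
    (e : P → σ) (i : S) (j : T) :
    IsMvPoly fun v : σ → ℂ => entrMat P (fun p => v (e p)) i j := by
  by_cases h : (i, j) ∈ P
  · simpa [entrMat, h] using IsMvPoly.coordinate (e ⟨(i, j), h⟩)
  · simpa [entrMat, h] using IsMvPoly.const 0

/-- The index type of the parametrization of the maps with a subrepresentation. -/
abbrev SubParam [PartialOrder S] [PartialOrder T] [DecidableEq S] [DecidableEq T]
    (I : Finset T) (J : Finset S) (I' : Finset T) (J' : Finset S) : Type :=
  filPos (J \ J') J' ⊕ ((Finset.univ \ ((J \ J') ×ˢ I') : Finset (S × T)) ⊕ filPos (I \ I') I')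

/-- The parametrization of the maps with a subrepresentation in position `(I', J')`. -/
noncomputable def subParam [PartialOrder S] [PartialOrder T] [DecidableEq S] [DecidableEq T]
    (I : Finset T) (J : Finset S) (I' : Finset T) (J' : Finset S)
    (v : SubParam I J I' J' → ℂ) : Matrix S T ℂ :=
  (1 + entrMat _ fun p => v (Sum.inl p)) * (entrMat _ fun p => v (Sum.inr (Sum.inl p))) *
    (1 + entrMat _ fun p => v (Sum.inr (Sum.inr p)))

theorem range_subParam [PartialOrder S] [PartialOrder T] [DecidableEq S] [DecidableEq T]
    {I I' : Finset T} {J J' : Finset S} (hI : I' ⊆ I) (hJ : J' ⊆ J) (f : Matrix S T ℂ) :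
    HasSub (mask J I f) I J I' J' ↔ f ∈ Set.range (subParam I J I' J') := by
  rw [hasSub_mask_iff hI hJ]
  constructor
  · rintro ⟨n, hn, f₀, hf₀, n', hn', rfl⟩
    obtain ⟨u, rfl⟩ := exists_entrMat hn
    obtain ⟨u', rfl⟩ := exists_entrMat hf₀
    obtain ⟨u'', rfl⟩ := exists_entrMat hn'
    exact ⟨Sum.elim u (Sum.elim u' u''), rfl⟩
  · rintro ⟨v, rfl⟩
    exact ⟨_, entrMat_mem _ _, _, entrMat_mem _ _, _, entrMat_mem _ _, rfl⟩

theorem isMvPoly_subParam [PartialOrder S] [PartialOrder T] [DecidableEq S] [DecidableEq T]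
    (I I' : Finset T) (J J' : Finset S) (i : S) (j : T) :
    IsMvPoly fun v => subParam I J I' J' v i j := by
  have hone : ∀ {R : Type} [Fintype R] [DecidableEq R] (P : Finset (R × R))
      (e : P → SubParam I J I' J') (a b : R), IsMvPoly fun v : SubParam I J I' J' → ℂ =>
        (1 + entrMat P fun p => v (e p)) a b := by
    intro R _ _ P e a b
    simp only [Matrix.add_apply]
    exact (IsMvPoly.const _).add (isMvPoly_entrMat P e a b)
  simp only [subParam, Matrix.mul_apply]
  refine IsMvPoly.sum _ fun b _ => IsMvPoly.mul ?_ (hone _ _ _ _)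
  exact IsMvPoly.sum _ fun c _ => (hone _ _ _ _).mul (isMvPoly_entrMat _ _ _ _)

theorem card_subParam [PartialOrder S] [PartialOrder T] [DecidableEq S] [DecidableEq T]
    (I I' : Finset T) (J J' : Finset S) :
    (Fintype.card (SubParam I J I' J') : ℤ) =
      Fintype.card (S × T) + pairing I' J' (I \ I') (J \ J') := by
  have h := Finset.card_sdiff_add_card_eq_card
    (Finset.subset_univ ((J \ J') ×ˢ I' : Finset (S × T)))
  rw [Finset.card_univ, Finset.card_product] at h
  simp only [Fintype.card_sum, Fintype.card_coe, pairing]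
  push_cast
  zify at h
  linarith

/-- Matrices as functions of pairs. -/
def pairEquiv (S T : Type) : Matrix S T ℂ ≃ₗ[ℂ] (S × T → ℂ) where
  toFun M p := M p.1 p.2
  map_add' _ _ := rfl
  map_smul' _ _ := rfl
  invFun v := Matrix.of fun i j => v (i, j)
  left_inv _ := rfl
  right_inv _ := rfl

theorem exists_poly_subParam [PartialOrder S] [PartialOrder T] [DecidableEq S] [DecidableEq T]
    {I I' : Finset T} {J J' : Finset S} (hI : I' ⊆ I) (hJ : J' ⊆ J) :
    ∃ P : S × T → MvPolynomial (SubParam I J I' J') ℂ,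
      (∀ v p, MvPolynomial.eval v (P p) = subParam I J I' J' v p.1 p.2) ∧
      ∀ f : Matrix S T ℂ, HasSub (mask J I f) I J I' J' ↔
        pairEquiv S T f ∈ Set.range fun v p => MvPolynomial.eval v (P p) := by
  choose P hP using fun p : S × T => isMvPoly_subParam I I' J J' p.1 p.2
  refine ⟨P, fun v p => (hP p v).symm, fun f => ?_⟩
  rw [range_subParam hI hJ]
  have : (fun v p => MvPolynomial.eval v (P p)) =
      fun v => pairEquiv S T (subParam I J I' J' v) := by
    ext v p; exact (hP p v).symm
  rw [this]
  simp only [Set.mem_range, EmbeddingLike.apply_eq_iff_eq]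

/-- Dichotomy: positions of subrepresentations of a generic map. -/
theorem dom_or_gen_not [PartialOrder S] [PartialOrder T] [DecidableEq S] [DecidableEq T]
    {I I' : Finset T} {J J' : Finset S} :
    (Dom I J I' J' ∧ 0 ≤ pairing I' J' (I \ I') (J \ J')) ∨
      Gen {f : Matrix S T ℂ | ¬ HasSub (mask J I f) I J I' J'} := by
  by_cases hIJ : I' ⊆ I ∧ J' ⊆ J
  swap
  · right
    refine gen_univ.mono fun f _ => ?_
    rintro ⟨C, C', B, hC, hC', -⟩
    exact hIJ ⟨hC.subset, hC'.subset⟩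
  obtain ⟨P, -, hP⟩ := exists_poly_subParam hIJ.1 hIJ.2
  rcases gen_range_or_gen_compl P with ⟨h, hc⟩ | h
  · left
    refine ⟨(h.preimage (pairEquiv S T).toLinearMap (pairEquiv S T).surjective).mono
      fun f hf => (hP f).2 hf, ?_⟩
    have := card_subParam I I' J J'
    zify at hc
    linarith
  · right
    exact (h.preimage (pairEquiv S T).toLinearMap (pairEquiv S T).surjective).mono
      fun f hf h' => hf ((hP f).1 h')

theorem Dom.pairing_nonneg [PartialOrder S] [PartialOrder T] [DecidableEq S] [DecidableEq T]
    {I I' : Finset T} {J J' : Finset S} (h : Dom I J I' J') :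
    0 ≤ pairing I' J' (I \ I') (J \ J') := by
  rcases dom_or_gen_not (I := I) (J := J) (I' := I') (J' := J') with h' | h'
  · exact h'.2
  · obtain ⟨f, hf, hf'⟩ := (h.inter h').nonempty
    exact absurd hf hf'

theorem line_subParam {n : Matrix S S ℂ} {B Z Y : Matrix S T ℂ} {n' : Matrix T T ℂ} [DecidableEq S]
    [DecidableEq T] (t : ℂ) (hY : Y = Z - n * B + B * n') :
    (1 + (0 + t • -n)) * (B + t • Z) * (1 + (0 + t • n')) =
        B + t • Y + t ^ 2 • (-n * Z - n * B * n' + Z * n') + t ^ 3 • (-n * Z * n') := by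
  subst hY
  simp only [zero_add, Matrix.mul_add, Matrix.add_mul, Matrix.one_mul, Matrix.mul_one,
    Matrix.smul_mul, Matrix.mul_smul, Matrix.neg_mul, smul_neg, Matrix.mul_assoc]
  module

theorem dom_of_dMap [BlockOrder S] [BlockOrder T] [DecidableEq S] [DecidableEq T]
    {I I' : Finset T} {J J' : Finset S} (hI : I' ⊆ I) (hJ : J' ⊆ J) {f g : Matrix S T ℂ}
    (h : (J \ J').card * I'.card ≤
      Module.finrank ℂ (LinearMap.range (dMap I' J' (I \ I') (J \ J') f g))) :
    Dom I J I' J' := by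
  obtain ⟨P, hP, hPs⟩ := exists_poly_subParam hI hJ
  have hsurj := dMap_range_eq h
  set B := mask J' I' f + mask (J \ J') (I \ I') g with hB
  have hBm : B ∈ entr (Finset.univ \ ((J \ J') ×ˢ I')) := by
    intro i j hij
    simp only [Finset.mem_sdiff, Finset.mem_univ, true_and, Finset.mem_product]
    rintro ⟨⟨-, h1⟩, h2⟩
    apply hij
    rw [hB, Matrix.add_apply, (supp_mask' J' I' f).eq_zero (by tauto),
      (supp_mask' (J \ J') (I \ I') g).eq_zero (by simp [h2]), add_zero]
  obtain ⟨uB, huB⟩ := exists_entrMat hBm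
  refine ((gen_range_of_deriv P (Sum.elim 0 (Sum.elim uB 0)) fun y => ?_).preimage
    (pairEquiv S T).toLinearMap (pairEquiv S T).surjective).mono fun f hf => (hPs f).2 hf
  set Y : Matrix S T ℂ := (pairEquiv S T).symm y with hY
  have hYm : mask (J \ J') I' Y ∈ LinearMap.range (dMap I' J' (I \ I') (J \ J') f g) := by
    rw [hsurj]; exact mem_entr_prod.2 (supp_mask' _ _ _)
  obtain ⟨⟨⟨n', hn'⟩, ⟨n, hn⟩⟩, hv⟩ := hYm
  rw [dMap_apply] at hv
  simp only at hv
  have sn := (mem_entr_filPos.1 hn).1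
  have sn' := (mem_entr_filPos.1 hn').1
  have hδ : Y + n * B - B * n' ∈ entr (Finset.univ \ ((J \ J') ×ˢ I')) := by
    have e1 : mask (J \ J') I' (n * B) = n * mask J' I' f := by
      rw [hB, Matrix.mul_add, mask_add, mask_eq (sn.mul (supp_mask' J' I' f)),
        supp_mul_eq_zero sn (supp_mask' (J \ J') (I \ I') g) Finset.disjoint_sdiff]
      simp [mask]
    have e2 : mask (J \ J') I' (B * n') = mask (J \ J') (I \ I') g * n' := by
      rw [hB, Matrix.add_mul, mask_add, mask_eq ((supp_mask' (J \ J') (I \ I') g).mul sn'),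
        supp_mul_eq_zero (supp_mask' J' I' f) sn' Finset.disjoint_sdiff]
      simp [mask]
    have e3 : mask (J \ J') I' (Y + n * B - B * n') = 0 := by
      rw [mask_sub, mask_add, e1, e2, ← hv]; abel
    intro i j hij
    simp only [Finset.mem_sdiff, Finset.mem_univ, true_and, Finset.mem_product]
    intro hmem
    have := congrFun (congrFun e3 i) j
    rw [mask, mul_pr_apply, if_pos hmem.2, pr_mul_apply, if_pos (by simpa using hmem.1)] at this
    exact hij this
  obtain ⟨un, hun⟩ := exists_entrMat (neg_mem hn)
  obtain ⟨un', hun'⟩ := exists_entrMat hn'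
  obtain ⟨uδ, huδ⟩ := exists_entrMat hδ
  refine ⟨Sum.elim un (Sum.elim uδ un'), fun p => ?_⟩
  have hfun : ∀ t : ℂ, MvPolynomial.eval (Sum.elim (0 : filPos (J \ J') J' → ℂ)
      (Sum.elim uB (0 : filPos (I \ I') I' → ℂ)) + t • Sum.elim un (Sum.elim uδ un')) (P p) =
      B p.1 p.2 + t * y p + t ^ 2 * ((-n * (Y + n * B - B * n') - n * B * n' +
        (Y + n * B - B * n') * n') p.1 p.2) +
        t ^ 3 * ((-n * (Y + n * B - B * n') * n') p.1 p.2) := by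
    intro t
    rw [hP]
    have e1 : (fun p => (Sum.elim (0 : filPos (J \ J') J' → ℂ)
      (Sum.elim uB (0 : filPos (I \ I') I' → ℂ)) + t • Sum.elim un (Sum.elim uδ un')) (Sum.inl p))
        = 0 + t • un := rfl
    have e2 : (fun p => (Sum.elim (0 : filPos (J \ J') J' → ℂ)
      (Sum.elim uB (0 : filPos (I \ I') I' → ℂ)) + t • Sum.elim un (Sum.elim uδ un'))
        (Sum.inr (Sum.inl p))) = uB + t • uδ := rfl
    have e3 : (fun p => (Sum.elim (0 : filPos (J \ J') J' → ℂ)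
      (Sum.elim uB (0 : filPos (I \ I') I' → ℂ)) + t • Sum.elim un (Sum.elim uδ un'))
        (Sum.inr (Sum.inr p))) = 0 + t • un' := rfl
    have z1 : entrMat (filPos (J \ J') J') 0 = 0 := by ext i j; simp [entrMat]
    have z2 : entrMat (filPos (I \ I') I') 0 = 0 := by ext i j; simp [entrMat]
    rw [subParam, e1, e2, e3, entrMat_add_smul, entrMat_add_smul, entrMat_add_smul, hun, hun',
      huB, huδ, z1, z2]
    have hyY : y p = Y p.1 p.2 := rfl
    rw [hyY]
    rw [line_subParam t (Y := Y) (by abel)]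
    simp only [Matrix.add_apply, Matrix.smul_apply, smul_eq_mul]
  have hd : HasDerivAt (fun t : ℂ => B p.1 p.2 + t * y p +
      t ^ 2 * ((-n * (Y + n * B - B * n') - n * B * n' +
        (Y + n * B - B * n') * n') p.1 p.2) +
        t ^ 3 * ((-n * (Y + n * B - B * n') * n') p.1 p.2)) (y p) 0 := by
    generalize ((-n * (Y + n * B - B * n') - n * B * n' + (Y + n * B - B * n') * n') p.1 p.2) = c1
    generalize ((-n * (Y + n * B - B * n') * n') p.1 p.2) = c2
    have h1 := (((((hasDerivAt_id (0:ℂ)).mul_const (y p)).const_add (B p.1 p.2)).add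
      (((hasDerivAt_id (0:ℂ)).pow 2).mul_const c1)).add
      (((hasDerivAt_id (0:ℂ)).pow 3).mul_const c2))
    refine (h1.congr_deriv ?_).congr_of_eventuallyEq (Filter.Eventually.of_forall fun t => ?_)
    · simp
    · simp
  exact hd.congr_of_eventuallyEq (Filter.Eventually.of_forall hfun)

end Dominance

section Cholesky

variable {T : Type} [Fintype T] [BlockOrder T]

theorem supp_vecMulVec {I : Finset T} {a : T} [DecidableEq T] {u : T → ℂ} (hu : u ∈ coord I) (ha : a ∈ I) :
    Supp (Matrix.vecMulVec u (Pi.single a 1)) I I := by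
  intro i j h
  rw [Matrix.vecMulVec_apply] at h
  refine ⟨hu i (left_ne_zero_of_mul h), ?_⟩
  have : j = a := by
    by_contra hne
    exact right_ne_zero_of_mul h (by simp [hne])
  rwa [this]

/-- Block Cholesky decomposition: a block-diagonal Hermitian matrix which is positive definite on
the coordinates in `I` can be brought to the identity by a triangular change of basis. -/
theorem exists_cholesky (H : Matrix T T ℂ) (hH : H.IsHermitian) (I : Finset T)
    (hblk : ∀ a ∈ I, ∀ b ∈ I, H a b ≠ 0 → blk a = blk b)
    (hpos : ∀ v ∈ coord I, v ≠ 0 → 0 < (star v ⬝ᵥ H *ᵥ v).re) :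
    ∃ R, IsEch R I I ∧ Rᴴ * H * R = pr I := by
  classical
  induction hn : I.card generalizing I with
  | zero =>
    obtain rfl := Finset.card_eq_zero.1 hn
    refine ⟨0, ⟨Supp.zero, fun i j h => absurd rfl h, by simp⟩, ?_⟩
    ext i j; simp [pr_apply]
  | succ n ih =>
    have hne : I.Nonempty := Finset.card_pos.1 (by omega)
    obtain ⟨a, ha, hmax⟩ := Finset.exists_maximal hne
    have hsub : I.erase a ⊆ I := Finset.erase_subset _ _
    obtain ⟨R₁, hR₁, hHR⟩ := ih (I.erase a) (fun b hb c hc => hblk b (hsub hb) c (hsub hc))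
      (fun v hv => hpos v (coord_mono hsub hv)) (by rw [Finset.card_erase_of_mem ha]; omega)
    set e : T → ℂ := Pi.single a 1 with he
    set u : T → ℂ := e - (R₁ * R₁ᴴ * H) *ᵥ e with hu
    have hRu : (R₁ᴴ * H) *ᵥ u = 0 := by
      have : R₁ᴴ * H * (R₁ * R₁ᴴ * H) = R₁ᴴ * H := by
        calc R₁ᴴ * H * (R₁ * R₁ᴴ * H) = (R₁ᴴ * H * R₁) * R₁ᴴ * H := by
              simp only [Matrix.mul_assoc]
          _ = R₁ᴴ * H := by rw [hHR, hR₁.supp.conjTranspose.pr_mul subset_rfl]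
      rw [hu, Matrix.mulVec_sub, Matrix.mulVec_mulVec, this, sub_self]
    have hw : (R₁ * R₁ᴴ * H) *ᵥ e ∈ coord (I.erase a) := by
      rw [Matrix.mul_assoc, ← Matrix.mulVec_mulVec]; exact hR₁.supp.mulVec_mem _
    have hea : e ∈ coord I := by
      intro i hi
      by_cases h : i = a
      · rwa [h]
      · simp [he, h] at hi
    have huI : u ∈ coord I := Submodule.sub_mem _ hea (coord_mono hsub hw)
    have hua : u a = 1 := by
      rw [hu, Pi.sub_apply, mem_coord'.1 hw a (by simp)]; simp [he]
    have hu0 : u ≠ 0 := fun h => by simp [h] at hua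
    have hup : ∀ b, u b ≠ 0 → b ≤ a := by
      intro b hb
      by_cases hba : b = a
      · exact hba.le
      have hb2 : ((R₁ * R₁ᴴ * H) *ᵥ e) b ≠ 0 := by
        intro h; apply hb; rw [hu, Pi.sub_apply, h]; simp [he, hba]
      have hbI := hw b hb2
      rw [he, Matrix.mulVec_single_one, Matrix.col_apply, Matrix.mul_assoc] at hb2
      obtain ⟨c, -, hc⟩ := Finset.exists_ne_zero_of_sum_ne_zero hb2
      have h1 := left_ne_zero_of_mul hc
      obtain ⟨d, -, hd⟩ := Finset.exists_ne_zero_of_sum_ne_zero (right_ne_zero_of_mul hc)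
      have h2 : R₁ d c ≠ 0 := by simpa using left_ne_zero_of_mul hd
      have h3 := hblk d (hsub (hR₁.supp d c h2).1) a ha (right_ne_zero_of_mul hd)
      have h4 : blk b = blk a := by
        rw [BlockOrder.blk_eq_of_le (hR₁.up b c h1), ← BlockOrder.blk_eq_of_le (hR₁.up d c h2), h3]
      rcases (BlockOrder.blk_eq_iff b a).1 h4 with h | h
      · exact h
      · exact hmax (hsub hbI) h
    set ρ : ℝ := (star u ⬝ᵥ H *ᵥ u).re with hρ
    have hρ0 : 0 < ρ := hpos u huI hu0
    have hρ' : star u ⬝ᵥ H *ᵥ u = (ρ : ℂ) := by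
      have := hH.im_star_dotProduct_mulVec_self u
      apply Complex.ext
      · simp [hρ]
      · simpa using this
    set c : ℂ := (((Real.sqrt ρ)⁻¹ : ℝ) : ℂ) with hc
    have hc0 : c ≠ 0 := by
      rw [hc]; exact_mod_cast (inv_pos.2 (Real.sqrt_pos.2 hρ0)).ne'
    have hcc : star c * c * ρ = 1 := by
      have h1 : (Real.sqrt ρ)⁻¹ * (Real.sqrt ρ)⁻¹ * ρ = 1 := by
        rw [← mul_inv, Real.mul_self_sqrt hρ0.le, inv_mul_cancel₀ hρ0.ne']
      rw [hc, Complex.star_def, Complex.conj_ofReal]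
      exact_mod_cast h1
    set V := Matrix.vecMulVec (c • u) e with hV
    have hcu : c • u ∈ coord I := Submodule.smul_mem _ _ huI
    have h1 : R₁ᴴ * H * V = 0 := by
      rw [hV, Matrix.mul_vecMulVec, Matrix.mulVec_smul, hRu]; simp
    have h2 : Vᴴ * H * R₁ = 0 := by
      have := congrArg Matrix.conjTranspose h1
      rw [Matrix.conjTranspose_mul, Matrix.conjTranspose_mul, hH.eq,
        Matrix.conjTranspose_conjTranspose, Matrix.conjTranspose_zero] at this
      rw [Matrix.mul_assoc, this]
    have hse : star e = e := by
      ext i; by_cases h : i = a <;> simp [he, h]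
    have h3 : Vᴴ * H * V = Matrix.vecMulVec e e := by
      rw [Matrix.mul_assoc, hV, Matrix.mul_vecMulVec, Matrix.conjTranspose_vecMulVec, hse,
        Matrix.vecMulVec_mul_vecMulVec]
      have : star (c • u) ⬝ᵥ H *ᵥ (c • u) = 1 := by
        rw [Matrix.mulVec_smul, star_smul, smul_dotProduct, dotProduct_smul, hρ', smul_smul,
          smul_eq_mul, hcc]
      rw [this, one_smul]
    refine ⟨R₁ + V, ⟨(hR₁.supp.mono hsub hsub).add (supp_vecMulVec hcu ha), hR₁.up.add ?_, ?_⟩, ?_⟩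
    · intro i j hij
      rw [hV, Matrix.vecMulVec_apply] at hij
      have hj : j = a := by
        by_contra hne
        exact right_ne_zero_of_mul hij (by simp [he, hne])
      rw [hj]
      apply hup
      have := left_ne_zero_of_mul hij
      simp at this; exact this.2
    · intro b hb
      rw [Matrix.add_apply, hV, Matrix.vecMulVec_apply]
      by_cases hba : b = a
      · subst hba
        rw [hR₁.supp.eq_zero (by simp)]
        simp [he, hua, hc0]
      · simpa [he, hba] using hR₁.diag b (by simp [hb, hba])
    · rw [Matrix.conjTranspose_add, Matrix.add_mul, Matrix.add_mul, Matrix.mul_add, Matrix.mul_add,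
        h1, h2, h3, hHR, add_zero, zero_add]
      ext i j
      rw [Matrix.add_apply, pr_apply, pr_apply, Matrix.vecMulVec_apply]
      by_cases hij : i = j
      · subst hij
        by_cases hia : i = a
        · subst hia; simp [he, ha]
        · simp [he, hia]
      · by_cases hia : i = a
        · have : j ≠ a := fun h => hij (hia.trans h.symm)
          simp [he, hij, this]
        · simp [he, hij, hia]

open scoped ComplexOrder in
/-- Orthonormalization of the columns of an echelon matrix. -/
theorem IsEch.exists_orthonormal {C : Matrix T T ℂ} {I I' : Finset T} (h : IsEch C I I') :
    ∃ R, IsEch R I' I' ∧ (C * R)ᴴ * (C * R) = pr I' := by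
  obtain ⟨R, hR, hHR⟩ := exists_cholesky (Cᴴ * C) (Matrix.isHermitian_conjTranspose_mul_self C) I'
    (fun a _ b _ hab => by
      obtain ⟨c, -, hc⟩ := Finset.exists_ne_zero_of_sum_ne_zero hab
      have h1 : C c a ≠ 0 := by simpa using left_ne_zero_of_mul hc
      rw [← BlockOrder.blk_eq_of_le (h.up c a h1),
        BlockOrder.blk_eq_of_le (h.up c b (right_ne_zero_of_mul hc))])
    (fun v hv hv0 => by
      have hCv : C *ᵥ v ≠ 0 := fun h0 => hv0 (h.mulVec_eq_zero hv h0)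
      have : star v ⬝ᵥ (Cᴴ * C) *ᵥ v = star (C *ᵥ v) ⬝ᵥ (C *ᵥ v) := by
        rw [← Matrix.mulVec_mulVec, Matrix.star_mulVec, Matrix.dotProduct_mulVec]
      rw [this]
      have h2 := (dotProduct_star_self_pos_iff (v := C *ᵥ v)).2 hCv
      exact (Complex.lt_def.1 h2).1)
  refine ⟨R, hR, ?_⟩
  rw [Matrix.conjTranspose_mul, ← hHR]
  simp only [Matrix.mul_assoc]

end Cholesky

section Inequality

variable {S T : Type} [Fintype S] [Fintype T] [BlockOrder S] [BlockOrder T]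

open scoped Classical in
/-- There is a partial isometry `U` with initial space `I` and final space `J` such that each
diagonal block of `Uᴴ diag(x) U` is `diag(w)`. -/
def LRU (I : Finset T) (J : Finset S) (w : T → ℝ) (x : S → ℝ) : Prop :=
  ∃ U : Matrix S T ℂ, Supp U J I ∧ Uᴴ * U = pr I ∧ U * Uᴴ = pr J ∧
    ∀ i ∈ I, ∀ i' ∈ I, blk i = blk i' →
      (Uᴴ * Matrix.diagonal (fun s => (x s : ℂ)) * U) i i' = if i = i' then (w i : ℂ) else 0

/-- Orthonormal echelon bases of a subrepresentation. -/
theorem HasSub.exists_orthonormal {f : Matrix S T ℂ} {I I' : Finset T} {J J' : Finset S}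
    (h : HasSub f I J I' J') : ∃ (Q : Matrix T T ℂ) (Q' : Matrix S S ℂ),
      (Supp Q I I' ∧ IsUp Q ∧ Qᴴ * Q = pr I') ∧ (Supp Q' J J' ∧ IsUp Q' ∧ Q'ᴴ * Q' = pr J') ∧
      f * Q = Q' * (Q'ᴴ * f * Q) := by
  obtain ⟨C, C', B, hC, hC', hB, hf⟩ := h
  obtain ⟨R, hR, hQ⟩ := hC.exists_orthonormal
  obtain ⟨R', hR', hQ'⟩ := hC'.exists_orthonormal
  obtain ⟨D, hD, hRD, hDR⟩ := hR'.exists_inv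
  refine ⟨C * R, C' * R', ⟨(hC.mul hR).supp, (hC.mul hR).up, hQ⟩,
    ⟨(hC'.mul hR').supp, (hC'.mul hR').up, hQ'⟩, ?_⟩
  have h1 : f * (C * R) = (C' * R') * (D * B * R) := by
    calc f * (C * R) = (C' * pr J') * B * R := by
          rw [hC'.supp.mul_pr subset_rfl, ← hf, Matrix.mul_assoc]
      _ = _ := by rw [← hRD]; simp only [Matrix.mul_assoc]
  have h2 : (C' * R')ᴴ * f * (C * R) = D * B * R := by
    rw [Matrix.mul_assoc, h1, ← Matrix.mul_assoc, hQ', ← Matrix.mul_assoc, ← Matrix.mul_assoc,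
      hD.supp.pr_mul subset_rfl]
  rw [h2, h1]

theorem sum_norm_sq_col {R T : Type} [Fintype R] [DecidableEq T] {Q : Matrix R T ℂ} {I : Finset T}
    (h : Qᴴ * Q = pr I) (j : T) : ∑ k, ‖Q k j‖ ^ 2 = if j ∈ I then 1 else 0 := by
  have h1 := congrFun (congrFun h j) j
  rw [Matrix.mul_apply, pr_apply] at h1
  simp only [true_and] at h1
  have : ((∑ k, ‖Q k j‖ ^ 2 : ℝ) : ℂ) = if j ∈ I then 1 else 0 := by
    push_cast
    rw [← h1]
    refine Finset.sum_congr rfl fun k _ => ?_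
    rw [Matrix.conjTranspose_apply, Complex.star_def, Complex.conj_mul']
  split_ifs at this ⊢ <;> exact_mod_cast this

theorem norm_entry_le_one {R T : Type} [Fintype R] {Q : Matrix R T ℂ} {I : Finset T}
    (h : Qᴴ * Q = pr I) (i : R) (j : T) : ‖Q i j‖ ≤ 1 := by
  classical
  have h3 := Finset.single_le_sum (f := fun k => ‖Q k j‖ ^ 2) (fun k _ => sq_nonneg _)
    (Finset.mem_univ i)
  have h4 : ‖Q i j‖ ^ 2 ≤ 1 := by
    refine h3.trans ?_
    rw [sum_norm_sq_col h]; split_ifs <;> norm_num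
  nlinarith [norm_nonneg (Q i j)]

theorem trace_pr (I : Finset T) : (pr I).trace = I.card := by
  classical
  simp [Matrix.trace, pr_apply]

/-- An isometry between coordinate spaces of the same dimension is unitary. -/
theorem mul_conjTranspose_eq_pr {B : Matrix S T ℂ} {I : Finset T} {J : Finset S}
    (hB : Supp B J I) (h : Bᴴ * B = pr I) (hc : I.card = J.card) : B * Bᴴ = pr J := by
  have h1 : B * Bᴴ * pr J = B * Bᴴ := (hB.mul hB.conjTranspose).mul_pr subset_rfl
  have h2 : pr J * (B * Bᴴ) = B * Bᴴ := (hB.mul hB.conjTranspose).pr_mul subset_rfl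
  have h3 : B * Bᴴ * (B * Bᴴ) = B * Bᴴ := by
    rw [Matrix.mul_assoc, ← Matrix.mul_assoc Bᴴ, h, hB.conjTranspose.pr_mul subset_rfl]
  have h4 : (pr J - B * Bᴴ)ᴴ * (pr J - B * Bᴴ) = pr J - B * Bᴴ := by
    rw [Matrix.conjTranspose_sub, pr_conjTranspose, Matrix.conjTranspose_mul,
      Matrix.conjTranspose_conjTranspose, Matrix.sub_mul, Matrix.mul_sub, Matrix.mul_sub, h1, h2,
      h3, pr_mul_self]
    simp
  have h5 : (pr J - B * Bᴴ).trace = 0 := by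
    rw [Matrix.trace_sub, Matrix.trace_mul_comm, h, trace_pr, trace_pr, hc, sub_self]
  rw [← h4] at h5
  open scoped ComplexOrder in
  exact (sub_eq_zero.1 (Matrix.trace_conjTranspose_mul_self_eq_zero_iff.1 h5)).symm

/-- Limits of subrepresentations, in orthonormal form. -/
theorem Dom.exists_orthonormal {I I' : Finset T} {J J' : Finset S} (h : Dom I J I' J')
    {U : Matrix S T ℂ} (hU : Supp U J I) : ∃ (Q : Matrix T T ℂ) (Q' : Matrix S S ℂ),
      (Supp Q I I' ∧ IsUp Q ∧ Qᴴ * Q = pr I') ∧ (Supp Q' J J' ∧ IsUp Q' ∧ Q'ᴴ * Q' = pr J') ∧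
      U * Q = Q' * (Q'ᴴ * U * Q) := by
  classical
  obtain ⟨y, hy⟩ := h.exists_direction U
  have hy2 : ∀ᶠ t : ℂ in nhdsWithin 0 {0}ᶜ, HasSub (mask J I (U + t • y)) I J I' J' :=
    hy.filter_mono (nhdsNE_le_cofinite 0)
  have hlim : Filter.Tendsto (fun t : ℂ => mask J I (U + t • y)) (nhdsWithin 0 {0}ᶜ)
      (nhds (mask J I U)) := by
    have : Continuous fun t : ℂ => mask J I (U + t • y) := by
      unfold mask; fun_prop
    simpa using (this.tendsto 0).mono_left nhdsWithin_le_nhds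
  rw [mask_eq hU] at hlim
  obtain ⟨t, ht⟩ := Filter.exists_seq_tendsto (nhdsWithin (0:ℂ) {0}ᶜ)
  obtain ⟨N, hN⟩ := Filter.eventually_atTop.1 (ht.eventually hy2)
  choose Q Q' hQ hQ' hQQ using fun n : ℕ =>
    (hN (n + N) (Nat.le_add_left _ _)).exists_orthonormal
  set K : Set ((T → T → ℂ) × (S → S → ℂ)) :=
    (Set.univ.pi fun _ => Set.univ.pi fun _ => Metric.closedBall (0:ℂ) 1) ×ˢ
      (Set.univ.pi fun _ => Set.univ.pi fun _ => Metric.closedBall (0:ℂ) 1) with hK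
  have hKc : IsCompact K :=
    (isCompact_univ_pi fun _ => isCompact_univ_pi fun _ => isCompact_closedBall _ _).prod
      (isCompact_univ_pi fun _ => isCompact_univ_pi fun _ => isCompact_closedBall _ _)
  obtain ⟨⟨q, q'⟩, -, φ, hφ, hq⟩ := hKc.tendsto_subseq (x := fun n => ((Q n, Q' n) : (T → T → ℂ) × (S → S → ℂ)))
    (fun n => ⟨fun i _ j _ => by simpa using norm_entry_le_one (hQ n).2.2 i j,
      fun i _ j _ => by simpa using norm_entry_le_one (hQ' n).2.2 i j⟩)
  have hq1 : Filter.Tendsto (fun n => Q (φ n)) Filter.atTop (nhds q) :=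
    (continuous_fst.tendsto _).comp hq
  have hq2 : Filter.Tendsto (fun n => Q' (φ n)) Filter.atTop (nhds q') :=
    (continuous_snd.tendsto _).comp hq
  have hent : ∀ {R : Type} {A : ℕ → Matrix R R ℂ} {a : Matrix R R ℂ} (P : R → R → Prop),
      Filter.Tendsto A Filter.atTop (nhds a) → (∀ n i j, A n i j ≠ 0 → P i j) →
      ∀ i j, a i j ≠ 0 → P i j := by
    intro R A a P hA hP i j hij
    by_contra hcon
    apply hij
    have h1 : Filter.Tendsto (fun n => A n i j) Filter.atTop (nhds (a i j)) :=
      tendsto_pi_nhds.1 (tendsto_pi_nhds.1 hA i) j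
    refine tendsto_nhds_unique h1 ?_
    have : (fun n => A n i j) = fun _ => 0 := by
      ext n; by_contra h0; exact hcon (hP n i j h0)
    rw [this]; exact tendsto_const_nhds
  have horth : ∀ {R : Type} [Fintype R] {A : ℕ → Matrix R R ℂ} {a b : Matrix R R ℂ},
      Filter.Tendsto A Filter.atTop (nhds a) → (∀ n, (A n)ᴴ * A n = b) → aᴴ * a = b := by
    intro R _ A a b hA hb
    have hc : Continuous fun M : Matrix R R ℂ => Mᴴ * M := by fun_prop
    refine tendsto_nhds_unique ((hc.tendsto a).comp hA) ?_
    have : (fun M : Matrix R R ℂ => Mᴴ * M) ∘ A = fun _ => b := funext hb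
    rw [this]; exact tendsto_const_nhds
  have hf : Filter.Tendsto (fun n => mask J I (U + t (φ n + N) • y)) Filter.atTop (nhds U) :=
    (hlim.comp ht).comp ((Filter.tendsto_add_atTop_nat N).comp hφ.tendsto_atTop)
  refine ⟨q, q', ⟨hent _ hq1 fun n => (hQ _).1, hent _ hq1 fun n => (hQ _).2.1,
    horth hq1 fun n => (hQ _).2.2⟩, ⟨hent _ hq2 fun n => (hQ' _).1, hent _ hq2 fun n => (hQ' _).2.1,
    horth hq2 fun n => (hQ' _).2.2⟩, ?_⟩
  have hc1 : Continuous fun p : Matrix S T ℂ × Matrix T T ℂ × Matrix S S ℂ => p.1 * p.2.1 := by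
    fun_prop
  have hc2 : Continuous fun p : Matrix S T ℂ × Matrix T T ℂ × Matrix S S ℂ =>
      p.2.2 * (p.2.2ᴴ * p.1 * p.2.1) := by fun_prop
  have hp := hf.prodMk_nhds (hq1.prodMk_nhds hq2)
  refine tendsto_nhds_unique ((hc1.tendsto _).comp hp) (((hc2.tendsto _).comp hp).congr fun n => ?_)
  exact (hQQ (φ n)).symm

theorem sum_le_trace_of_up {I I' : Finset T} {w : T → ℝ} (hw : Antitone w) {Q : Matrix T T ℂ}
    (hQ : Supp Q I I' ∧ IsUp Q ∧ Qᴴ * Q = pr I') {M : Matrix T T ℂ}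
    (hM : ∀ i ∈ I, ∀ i' ∈ I, blk i = blk i' → ∀ _ : Decidable (i = i'), M i i' = if i = i' then (w i : ℂ) else 0) :
    (∑ i ∈ I', w i : ℝ) ≤ (Qᴴ * M * Q).trace.re := by
  classical
  have hcol : ∀ j, (Qᴴ * M * Q) j j = ((∑ i, ‖Q i j‖ ^ 2 * w i : ℝ) : ℂ) := by
    intro j
    rw [Matrix.mul_assoc, Matrix.mul_apply]
    push_cast
    refine Finset.sum_congr rfl fun i _ => ?_
    rw [Matrix.conjTranspose_apply, Matrix.mul_apply]
    by_cases hij : Q i j = 0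
    · simp [hij]
    rw [Finset.sum_eq_single i]
    · rw [hM i (hQ.1 i j hij).1 i (hQ.1 i j hij).1 rfl inferInstance, if_pos rfl, Complex.star_def,
        mul_comm (w i : ℂ), ← mul_assoc, Complex.conj_mul']
    · intro i' _ hne
      by_cases hi'j : Q i' j = 0
      · simp [hi'j]
      rw [hM i (hQ.1 i j hij).1 i' (hQ.1 i' j hi'j).1 (by
        rw [BlockOrder.blk_eq_of_le (hQ.2.1 i j hij), BlockOrder.blk_eq_of_le (hQ.2.1 i' j hi'j)])
        inferInstance, if_neg (Ne.symm hne), zero_mul]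
    · simp
  have htr : (Qᴴ * M * Q).trace.re = ∑ j, ∑ i, ‖Q i j‖ ^ 2 * w i := by
    rw [Matrix.trace, Complex.re_sum]
    refine Finset.sum_congr rfl fun j _ => ?_
    rw [Matrix.diag_apply, hcol, Complex.ofReal_re]
  rw [htr]
  have hz : ∀ j, j ∉ I' → ∑ i, ‖Q i j‖ ^ 2 * w i = 0 := by
    intro j hj
    refine Finset.sum_eq_zero fun i _ => ?_
    rw [hQ.1.eq_zero (by tauto)]; simp
  rw [← Finset.sum_subset (Finset.subset_univ I') (fun j _ hj => hz j hj)]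
  refine Finset.sum_le_sum fun j hj => ?_
  calc w j = ∑ i, ‖Q i j‖ ^ 2 * w j := by
        rw [← Finset.sum_mul, sum_norm_sq_col hQ.2.2, if_pos hj, one_mul]
    _ ≤ _ := by
        refine Finset.sum_le_sum fun i _ => ?_
        by_cases hij : Q i j = 0
        · simp [hij]
        · exact mul_le_mul_of_nonneg_left (hw (hQ.2.1 i j hij)) (sq_nonneg _)

/-- Positions of subrepresentations of a generic map give inequalities. -/
theorem LRU.sum_le_sum {I I' : Finset T} {J J' : Finset S} {w : T → ℝ} {x : S → ℝ}
    (h : LRU I J w x)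
    (hd : Dom I J I' J') (hc : I'.card = J'.card) (hw : Antitone w) (hx : Monotone x) :
    ∑ i ∈ I', w i ≤ ∑ j ∈ J', x j := by
  classical
  obtain ⟨U, hU, hUU, hUU', hUx⟩ := h
  obtain ⟨Q, Q', hQ, hQ', hQQ⟩ := hd.exists_orthonormal hU
  set X : Matrix S S ℂ := Matrix.diagonal fun s => (x s : ℂ) with hX
  set B := Q'ᴴ * U * Q with hB
  have hBs : Supp B J' I' := by
    rw [hB, Matrix.mul_assoc]; exact hQ'.1.conjTranspose.mul (hU.mul hQ.1)
  have hBB : Bᴴ * B = pr I' := by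
    have h1 : (U * Q)ᴴ * (U * Q) = pr I' := by
      rw [Matrix.conjTranspose_mul, Matrix.mul_assoc, ← Matrix.mul_assoc Uᴴ, hUU,
        hQ.1.pr_mul subset_rfl, hQ.2.2]
    rw [hQQ, Matrix.conjTranspose_mul, Matrix.mul_assoc, ← Matrix.mul_assoc Q'ᴴ, hQ'.2.2,
      hBs.pr_mul subset_rfl] at h1
    exact h1
  have hBB' : B * Bᴴ = pr J' := mul_conjTranspose_eq_pr hBs hBB hc
  have h1 := sum_le_trace_of_up hw hQ (M := Uᴴ * X * U) (fun i hi i' hi' hb inst => by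
    convert hUx i hi i' hi' hb)
  have h2 := sum_le_trace_of_up (w := fun s => - x s) (fun a b hab => neg_le_neg (hx hab)) hQ'
    (M := -X) (fun i hi i' hi' hb inst => by
      rw [hX, Matrix.neg_apply, Matrix.diagonal_apply]
      split_ifs <;> simp)
  have h3 : (Qᴴ * (Uᴴ * X * U) * Q).trace = (Q'ᴴ * X * Q').trace := by
    calc (Qᴴ * (Uᴴ * X * U) * Q).trace = ((U * Q)ᴴ * X * (U * Q)).trace := by
          rw [Matrix.conjTranspose_mul]; simp only [Matrix.mul_assoc]
      _ = (Bᴴ * (Q'ᴴ * X * Q' * B)).trace := by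
          rw [hQQ, Matrix.conjTranspose_mul]; simp only [Matrix.mul_assoc]
      _ = (Q'ᴴ * X * (Q' * (B * Bᴴ))).trace := by
          rw [Matrix.trace_mul_comm]; simp only [Matrix.mul_assoc]
      _ = _ := by rw [hBB', hQ'.1.mul_pr subset_rfl]
  have h4 : (Q'ᴴ * -X * Q').trace.re = - (Q'ᴴ * X * Q').trace.re := by
    rw [Matrix.mul_neg, Matrix.neg_mul, Matrix.trace_neg, Complex.neg_re]
  rw [h4, Finset.sum_neg_distrib] at h2
  rw [h3] at h1
  linarith

end Inequality

section CauchyBinet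

variable {T ι : Type} [Fintype T] [Fintype ι] [DecidableEq ι]

theorem det_mul_eq_sum (B : Matrix ι T ℂ) (A : Matrix T ι ℂ) :
    (B * A).det = ∑ σ : ι → T, (∏ i, B i (σ i)) * (A.submatrix σ id).det := by
  classical
  have h1 : (B * A) = fun i => ∑ t, B i t • A t := by
    ext i j
    simp [Matrix.mul_apply]
  change (Matrix.detRowAlternating (R := ℂ) (n := ι)).toMultilinearMap (B * A) = _
  rw [h1]
  refine (MultilinearMap.map_sum _ fun i t => B i t • A t).trans ?_
  refine Finset.sum_congr rfl fun σ _ => ?_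
  rw [MultilinearMap.map_smul_univ]
  rfl

/-- A symmetrised form of the Cauchy-Binet formula. -/
theorem factorial_mul_det_mul (B : Matrix ι T ℂ) (A : Matrix T ι ℂ) :
    (Fintype.card ι).factorial * (B * A).det =
      ∑ σ : ι → T, (B.submatrix id σ).det * (A.submatrix σ id).det := by
  have h1 : ∀ τ : Equiv.Perm ι, (B * A).det =
      ∑ σ : ι → T, (Equiv.Perm.sign τ : ℂ) * (∏ i, B i (σ (τ i))) * (A.submatrix σ id).det := by
    intro τ
    rw [det_mul_eq_sum, ← Equiv.sum_comp (Equiv.arrowCongr τ.symm (Equiv.refl T))]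
    refine Finset.sum_congr rfl fun σ _ => ?_
    have : A.submatrix (Equiv.arrowCongr τ.symm (Equiv.refl T) σ) id =
        (A.submatrix σ id).submatrix τ id := by
      ext; simp
    rw [this, Matrix.det_permute]
    simp only [Equiv.arrowCongr_apply, Equiv.coe_refl, Function.comp, id, Equiv.symm_symm]
    ring
  calc (Fintype.card ι).factorial * (B * A).det
      = ∑ _τ : Equiv.Perm ι, (B * A).det := by
        rw [Finset.sum_const, Finset.card_univ, Fintype.card_perm, nsmul_eq_mul]
    _ = ∑ τ : Equiv.Perm ι, ∑ σ : ι → T,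
          (Equiv.Perm.sign τ : ℂ) * (∏ i, B i (σ (τ i))) * (A.submatrix σ id).det :=
        Finset.sum_congr rfl fun τ _ => h1 τ
    _ = _ := by
        rw [Finset.sum_comm]
        refine Finset.sum_congr rfl fun σ _ => ?_
        rw [← Finset.sum_mul, ← Matrix.det_transpose (B.submatrix id σ), Matrix.det_apply' (B.submatrix id σ)ᵀ]
        rfl

/-- The determinant of `Aᴴ (exp lam) A`, up to a factorial, as a sum of exponentials. -/
noncomputable def expSum (A : Matrix T ι ℂ) (lam : T → ℝ) : ℝ :=
  ∑ σ : ι → T, Real.exp (∑ i, lam (σ i)) * ‖(A.submatrix σ id).det‖ ^ 2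

theorem factorial_mul_det_exp [DecidableEq T] (A : Matrix T ι ℂ) (lam : T → ℝ) :
    (Fintype.card ι).factorial *
      (Aᴴ * Matrix.diagonal (fun t => ((Real.exp (lam t) : ℝ) : ℂ)) * A).det =
        (expSum A lam : ℂ) := by
  rw [factorial_mul_det_mul, expSum]
  push_cast
  refine Finset.sum_congr rfl fun σ _ => ?_
  have : (Aᴴ * Matrix.diagonal (fun t => Complex.exp (lam t))).submatrix id σ =
      (A.submatrix σ id)ᴴ * Matrix.diagonal (fun i => Complex.exp (lam (σ i))) := by
    ext i j
    simp [Matrix.mul_diagonal]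
  rw [this, Matrix.det_mul, Matrix.det_conjTranspose, Matrix.det_diagonal, Complex.exp_sum,
    Complex.star_def, ← Complex.conj_mul']
  ring

theorem expSum_pos {A : Matrix T ι ℂ} {σ : ι → T} (h : (A.submatrix σ id).det ≠ 0)
    (lam : T → ℝ) : 0 < expSum A lam :=
  Finset.sum_pos' (fun _ _ => by positivity) ⟨σ, Finset.mem_univ _, by positivity⟩

theorem exists_det_submatrix_ne_zero {A : Matrix T ι ℂ} (h : ∀ v, A *ᵥ v = 0 → v = 0) :
    ∃ σ : ι → T, (A.submatrix σ id).det ≠ 0 := by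
  classical
  by_contra! hcon
  have h1 := factorial_mul_det_mul Aᴴ A
  rw [Finset.sum_eq_zero fun σ _ => by rw [hcon σ, mul_zero]] at h1
  have h2 : (Aᴴ * A).det = 0 := by
    rcases mul_eq_zero.1 h1 with h | h
    · exact absurd (by exact_mod_cast h) (Nat.factorial_ne_zero _)
    · exact h
  obtain ⟨v, hv, hv0⟩ := Matrix.exists_mulVec_eq_zero_iff.2 h2
  refine hv (h v ?_)
  have h3 : star (A *ᵥ v) ⬝ᵥ (A *ᵥ v) = 0 := by
    rw [Matrix.star_mulVec, ← Matrix.dotProduct_mulVec, Matrix.mulVec_mulVec, hv0, dotProduct_zero]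
  open scoped ComplexOrder in
  exact dotProduct_star_self_eq_zero.1 h3

theorem log_expSum_convex {A : Matrix T ι ℂ} {σ : ι → T} (h : (A.submatrix σ id).det ≠ 0)
    (lam : T → ℝ) {s : ℝ} (hs0 : 0 ≤ s) (hs1 : s ≤ 1) :
    Real.log (expSum A (s • lam)) ≤
      (1 - s) * Real.log (expSum A 0) + s * Real.log (expSum A lam) := by
  set a := Real.log (expSum A 0) with ha
  set b := Real.log (expSum A lam) with hb
  have ha' : Real.exp a = expSum A 0 := Real.exp_log (expSum_pos h _)
  have hb' : Real.exp b = expSum A lam := Real.exp_log (expSum_pos h _)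
  rw [Real.log_le_iff_le_exp (expSum_pos h _)]
  have h1 : expSum A (s • lam) ≤ ∑ σ : ι → T, Real.exp ((1 - s) * a + s * b) *
      ((1 - s) * (Real.exp (-a) * ‖(A.submatrix σ id).det‖ ^ 2) +
        s * (Real.exp (-b) * (Real.exp (∑ i, lam (σ i)) * ‖(A.submatrix σ id).det‖ ^ 2))) := by
    refine Finset.sum_le_sum fun σ _ => ?_
    have h2 := convexOn_exp.2 (Set.mem_univ (-a)) (Set.mem_univ (∑ i, lam (σ i) - b))
      (sub_nonneg.2 hs1) hs0 (by ring)
    simp only [smul_eq_mul] at h2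
    have h3 : Real.exp (∑ i, (s • lam) (σ i)) = Real.exp ((1 - s) * a + s * b) *
        Real.exp ((1 - s) * -a + s * (∑ i, lam (σ i) - b)) := by
      rw [← Real.exp_add]
      congr 1
      simp only [Pi.smul_apply, smul_eq_mul, ← Finset.mul_sum]
      ring
    rw [h3, mul_assoc]
    refine mul_le_mul_of_nonneg_left ?_ (Real.exp_pos _).le
    calc _ ≤ ((1 - s) * Real.exp (-a) + s * Real.exp (∑ i, lam (σ i) - b)) *
          ‖(A.submatrix σ id).det‖ ^ 2 := mul_le_mul_of_nonneg_right h2 (by positivity)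
      _ = _ := by rw [sub_eq_add_neg _ b, Real.exp_add]; ring
  refine h1.trans (le_of_eq ?_)
  rw [← Finset.mul_sum, Finset.sum_add_distrib, ← Finset.mul_sum, ← Finset.mul_sum,
    ← Finset.mul_sum, ← Finset.mul_sum]
  have h4 : ∑ σ : ι → T, ‖(A.submatrix σ id).det‖ ^ 2 = Real.exp a := by
    rw [ha', expSum]; simp
  have h5 : ∑ σ : ι → T, Real.exp (∑ i, lam (σ i)) * ‖(A.submatrix σ id).det‖ ^ 2 = Real.exp b := by
    rw [hb', expSum]
  rw [h4, h5, ← Real.exp_add, ← Real.exp_add]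
  simp

theorem log_expSum_ge {A : Matrix T ι ℂ} {σ : ι → T} (h : (A.submatrix σ id).det ≠ 0)
    (lam : T → ℝ) :
    (∑ i, lam (σ i)) + Real.log (‖(A.submatrix σ id).det‖ ^ 2) ≤ Real.log (expSum A lam) := by
  rw [← Real.log_exp (∑ i, lam (σ i)), ← Real.log_mul (Real.exp_pos _).ne' (by positivity)]
  refine Real.log_le_log (by positivity) ?_
  exact Finset.single_le_sum (f := fun σ : ι → T => Real.exp (∑ i, lam (σ i)) *
    ‖(A.submatrix σ id).det‖ ^ 2) (fun _ _ => by positivity) (Finset.mem_univ σ)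

theorem injective_of_det_submatrix_ne_zero {A : Matrix T ι ℂ} {σ : ι → T}
    (h : (A.submatrix σ id).det ≠ 0) : Function.Injective σ := by
  intro i j hij
  by_contra hne
  exact h (Matrix.det_zero_of_row_eq hne (by ext k; simp [hij]))

theorem expSum_eq_of_card {A : Matrix T ι ℂ} (hc : Fintype.card ι = Fintype.card T)
    (lam : T → ℝ) : expSum A lam = Real.exp (∑ t, lam t) * expSum A 0 := by
  rw [expSum, expSum, Finset.mul_sum]
  refine Finset.sum_congr rfl fun σ _ => ?_
  by_cases h : (A.submatrix σ id).det = 0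
  · simp [h]
  have hb : Function.Bijective σ :=
    (Fintype.bijective_iff_injective_and_card σ).2 ⟨injective_of_det_submatrix_ne_zero h, hc⟩
  rw [hb.sum_comp lam]
  simp

theorem continuous_expSum : Continuous fun p : Matrix T ι ℂ × (T → ℝ) => expSum p.1 p.2 := by
  unfold expSum
  refine continuous_finsetSum _ fun σ _ => Continuous.mul ?_ ?_
  · fun_prop
  · refine ((Continuous.matrix_det ?_).norm).pow 2
    exact continuous_fst.matrix_submatrix _ _

end CauchyBinet

section Minimum

variable {T : Type} [Fintype T] [DecidableEq T]

/-- A combination of logarithms of minors of `Aᴴ kᴴ (exp lam) k A`. -/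
noncomputable def weightedLog {α : Type} [Fintype α] {ι : α → Type} [∀ a, Fintype (ι a)]
    [∀ a, DecidableEq (ι a)] (A : ∀ a, Matrix T (ι a) ℂ) (c : α → ℝ) (k : Matrix T T ℂ)
    (lam : T → ℝ) : ℝ :=
  ∑ a, c a * Real.log (expSum (k * A a) lam)

/-- A coercive function of a diagonal matrix. -/
noncomputable def coerc (lam : T → ℝ) : ℝ :=
  Real.log (∑ t, Real.exp (lam t) + Real.exp (-∑ t, lam t))

theorem norm_le_coerc (lam : T → ℝ) : ‖lam‖ ≤ (Fintype.card T + 1) * coerc lam := by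
  set R := coerc lam with hR
  have hpos : 0 < ∑ t, Real.exp (lam t) + Real.exp (-∑ t, lam t) := by positivity
  have h1 : ∀ t, lam t ≤ R := by
    intro t
    rw [hR, coerc, Real.le_log_iff_exp_le hpos]
    have := Finset.single_le_sum (f := fun t => Real.exp (lam t)) (fun _ _ => (Real.exp_pos _).le)
      (Finset.mem_univ t)
    have := Real.exp_pos (-∑ t, lam t)
    linarith
  have h2 : -∑ t, lam t ≤ R := by
    rw [hR, coerc, Real.le_log_iff_exp_le hpos]
    have : 0 ≤ ∑ t, Real.exp (lam t) := by positivity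
    linarith
  have h3 : ∀ s : Finset T, ∑ t ∈ s, lam t ≤ s.card * R := fun s =>
    (Finset.sum_le_sum fun t _ => h1 t).trans (by simp)
  have h4 : 0 ≤ R := by
    have := h3 Finset.univ
    have h5 : (0:ℝ) ≤ (Finset.univ : Finset T).card := by positivity
    by_contra hneg
    push Not at hneg
    nlinarith
  have hN : (0:ℝ) ≤ Fintype.card T := by positivity
  refine (pi_norm_le_iff_of_nonneg (by positivity)).2 fun t => ?_
  rw [Real.norm_eq_abs, abs_le]
  have h5 := h3 (Finset.univ.erase t)
  have h6 := Finset.add_sum_erase Finset.univ lam (Finset.mem_univ t)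
  have h7 : ((Finset.univ.erase t).card : ℝ) ≤ Fintype.card T := by
    exact_mod_cast (Finset.card_le_univ _)
  have h8 := h1 t
  constructor <;> nlinarith

theorem continuous_coerc : Continuous (coerc : (T → ℝ) → ℝ) := by
  unfold coerc
  exact Continuous.log (by fun_prop) fun lam => by positivity

variable {α : Type} [Fintype α] {ι : α → Type} [∀ a, Fintype (ι a)] [∀ a, DecidableEq (ι a)]
  {A : ∀ a, Matrix T (ι a) ℂ} {c : α → ℝ}

theorem exists_det_mul_ne_zero (hA : ∀ a v, A a *ᵥ v = 0 → v = 0) {k : Matrix T T ℂ}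
    (hk : kᴴ * k = 1) (a : α) : ∃ σ : ι a → T, ((k * A a).submatrix σ id).det ≠ 0 := by
  refine exists_det_submatrix_ne_zero fun v hv => hA a v ?_
  have : kᴴ *ᵥ ((k * A a) *ᵥ v) = A a *ᵥ v := by
    rw [Matrix.mulVec_mulVec, ← Matrix.mul_assoc, hk, Matrix.one_mul]
  rw [← this, hv, Matrix.mulVec_zero]

theorem weightedLog_convex (hA : ∀ a v, A a *ᵥ v = 0 → v = 0)
    (hc : ∀ a, 0 ≤ c a ∨ Fintype.card (ι a) = Fintype.card T) {k : Matrix T T ℂ}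
    (hk : kᴴ * k = 1) (lam : T → ℝ) {s : ℝ} (hs0 : 0 ≤ s) (hs1 : s ≤ 1) :
    weightedLog A c k (s • lam) ≤ (1 - s) * weightedLog A c k 0 + s * weightedLog A c k lam := by
  unfold weightedLog
  rw [Finset.mul_sum, Finset.mul_sum, ← Finset.sum_add_distrib]
  refine Finset.sum_le_sum fun a _ => ?_
  obtain ⟨σ, hσ⟩ := exists_det_mul_ne_zero hA hk a
  rcases hc a with h | h
  · have := mul_le_mul_of_nonneg_left (log_expSum_convex hσ lam hs0 hs1) h
    linarith
  · rw [expSum_eq_of_card h (s • lam), expSum_eq_of_card h lam,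
      Real.log_mul (Real.exp_pos _).ne' (expSum_pos hσ _).ne',
      Real.log_mul (Real.exp_pos _).ne' (expSum_pos hσ _).ne', Real.log_exp, Real.log_exp]
    simp only [Pi.smul_apply, smul_eq_mul, ← Finset.mul_sum]
    exact le_of_eq (by ring)

theorem continuousAt_weightedLog (hA : ∀ a v, A a *ᵥ v = 0 → v = 0) {k : Matrix T T ℂ}
    (hk : kᴴ * k = 1) (lam : T → ℝ) :
    ContinuousAt (fun p : (T → T → ℂ) × (T → ℝ) => weightedLog A c p.1 p.2) (k, lam) := by
  unfold weightedLog
  refine tendsto_finsetSum _ fun a _ => Filter.Tendsto.const_mul _ ?_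
  obtain ⟨σ, hσ⟩ := exists_det_mul_ne_zero hA hk a
  refine ContinuousAt.log ?_ (expSum_pos hσ _).ne'
  have h1 : Continuous fun p : Matrix T T ℂ × (T → ℝ) => ((p.1 * A a, p.2) : _ × (T → ℝ)) := by
    fun_prop
  exact (continuous_expSum.comp h1).continuousAt

theorem exists_weightedLog_min (hA : ∀ a v, A a *ᵥ v = 0 → v = 0)
    (hc : ∀ a, 0 ≤ c a ∨ Fintype.card (ι a) = Fintype.card T)
    {K : Set (T → T → ℂ)} (hK : IsCompact K) (hK1 : K.Nonempty)
    (hKu : ∀ k : Matrix T T ℂ, k ∈ K → kᴴ * k = 1)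
    (hslope : ∀ k ∈ K, ∀ lam, ∃ C, ∀ t : ℝ, 0 ≤ t → C ≤ weightedLog A c k (t • lam))
    {δ : ℝ} (hδ : 0 < δ) :
    ∃ k0 ∈ K, ∃ lam0, ∀ k ∈ K, ∀ lam, weightedLog A c k0 lam0 + δ * coerc lam0 ≤
      weightedLog A c k lam + δ * coerc lam := by
  have hcont : ∀ k ∈ K, ∀ lam : T → ℝ, ContinuousAt
      (fun p : (T → T → ℂ) × (T → ℝ) => weightedLog A c p.1 p.2) (k, lam) :=
    fun k hk lam => continuousAt_weightedLog hA (hKu k hk) lam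
  obtain ⟨M, hM⟩ : ∃ M, ∀ k ∈ K, weightedLog A c k 0 ≤ M := by
    have : ContinuousOn (fun k : T → T → ℂ => weightedLog A c k 0) K := fun k hk =>
      ((hcont k hk 0).comp (f := fun k : T → T → ℂ => (k, (0 : T → ℝ)))
        (by fun_prop)).continuousWithinAt
    obtain ⟨M, hM⟩ := hK.bddAbove_image this
    exact ⟨M, fun k hk => hM ⟨k, hk, rfl⟩⟩
  set F : (T → T → ℂ) × (T → ℝ) → ℝ := fun p => weightedLog A c p.1 p.2 + δ * coerc p.2 with hF
  obtain ⟨e, he⟩ := hK1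
  set g := F (e, 0) with hg
  set N : ℝ := Fintype.card T + 1 with hN
  have hNpos : 0 < N := by positivity
  have key : ∃ R : ℕ, ∀ k ∈ K, ∀ lam, F (k, lam) ≤ g → ‖lam‖ ≤ R := by
    by_contra! hcon
    choose k hk lam hle hlt using hcon
    have hpos : ∀ n, 0 < ‖lam n‖ := fun n => lt_of_le_of_lt (Nat.cast_nonneg n) (hlt n)
    have hW : ∀ n, weightedLog A c (k n) (lam n) ≤ g - δ / N * ‖lam n‖ := by
      intro n
      have h1 := hle n
      have h2 := norm_le_coerc (lam n)
      have h3 : δ / N * ‖lam n‖ ≤ δ * coerc (lam n) := by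
        rw [div_mul_eq_mul_div, div_le_iff₀ hNpos]
        calc δ * ‖lam n‖ ≤ δ * (N * coerc (lam n)) := mul_le_mul_of_nonneg_left h2 hδ.le
          _ = _ := by ring
      simp only [hF] at h1
      linarith
    obtain ⟨⟨k0, u⟩, hku, φ, hφ, hlim⟩ := (hK.prod (isCompact_sphere (0 : T → ℝ) 1)).tendsto_subseq
      (x := fun n => (k n, (‖lam n‖)⁻¹ • lam n)) (fun n => ⟨hk n, by
        simp [norm_smul, (hpos n).ne']⟩)
    have hub : ∀ t : ℝ, 0 ≤ t → weightedLog A c k0 (t • u) ≤ |M| + |g| - δ / N * t := by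
      intro t ht
      have hlim2 : Filter.Tendsto (fun n => (k (φ n), t • ((‖lam (φ n)‖)⁻¹ • lam (φ n))))
          Filter.atTop (nhds (k0, t • u)) := by
        have : Continuous fun p : (T → T → ℂ) × (T → ℝ) => (p.1, t • p.2) := by fun_prop
        exact (this.tendsto _).comp hlim
      refine le_of_tendsto ((hcont k0 hku.1 (t • u)).tendsto.comp hlim2) ?_
      obtain ⟨n0, hn0⟩ := exists_nat_ge t
      filter_upwards [Filter.eventually_ge_atTop n0] with n hn
      have hn1 : t ≤ ‖lam (φ n)‖ := by
        have h1 : (n0 : ℝ) ≤ φ n := by exact_mod_cast hn.trans (hφ.id_le n)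
        linarith [hlt (φ n)]
      have hp := hpos (φ n)
      have h1 := weightedLog_convex hA hc (hKu _ (hk (φ n))) (lam (φ n))
        (s := t * (‖lam (φ n)‖)⁻¹) (by positivity) (by
          rw [← div_eq_mul_inv]; exact (div_le_one hp).2 hn1)
      simp only [Function.comp]
      rw [smul_smul]
      refine h1.trans ?_
      set s := t * (‖lam (φ n)‖)⁻¹ with hs
      have hs0 : 0 ≤ s := by positivity
      have hs1 : s ≤ 1 := by rw [hs, ← div_eq_mul_inv]; exact (div_le_one hp).2 hn1
      have h2 := mul_le_mul_of_nonneg_left (hM _ (hk (φ n))) (sub_nonneg.2 hs1)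
      have h3 := mul_le_mul_of_nonneg_left (hW (φ n)) hs0
      have h4 : s * (g - δ / N * ‖lam (φ n)‖) = s * g - δ / N * t := by
        rw [hs]; field_simp
      have h5 : (1 - s) * M ≤ |M| := by nlinarith [le_abs_self M, abs_nonneg M]
      have h6 : s * g ≤ |g| := by nlinarith [le_abs_self g, abs_nonneg g]
      linarith
    obtain ⟨C, hC⟩ := hslope k0 hku.1 u
    have hdn : 0 < δ / N := by positivity
    set t := (|M| + |g| + |C| + 1) / (δ / N) with ht
    have ht0 : 0 ≤ t := by positivity
    have h1 := hub t ht0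
    have h2 := hC t ht0
    have h3 : δ / N * t = |M| + |g| + |C| + 1 := by rw [ht]; field_simp
    linarith [neg_abs_le C]
  obtain ⟨R, hR⟩ := key
  have hcomp : IsCompact (K ×ˢ Metric.closedBall (0 : T → ℝ) R) :=
    hK.prod (isCompact_closedBall _ _)
  have hFc : ContinuousOn F (K ×ˢ Metric.closedBall (0 : T → ℝ) R) := by
    rintro ⟨k, lam⟩ ⟨hk, -⟩
    exact ((hcont k hk lam).add (by
      exact (continuous_const.mul (continuous_coerc.comp continuous_snd)).continuousAt)).continuousWithinAt
  have h10 : ((e, 0) : (T → T → ℂ) × (T → ℝ)) ∈ K ×ˢ Metric.closedBall (0 : T → ℝ) R :=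
    ⟨he, by simp⟩
  obtain ⟨⟨k0, lam0⟩, hmem, hmin⟩ := hcomp.exists_isMinOn ⟨_, h10⟩ hFc
  have hmin' := isMinOn_iff.1 hmin
  refine ⟨k0, hmem.1, lam0, fun k hk lam => ?_⟩
  change F (k0, lam0) ≤ F (k, lam)
  by_cases hlam : F (k, lam) ≤ g
  · exact hmin' (k, lam) ⟨hk, by simpa using hR k hk lam hlam⟩
  · exact (hmin' _ h10).trans (not_le.1 hlam).le

end Minimum

section Greedy

variable {T : Type} [Fintype T]

theorem exists_chain_monotone (lam : T → ℝ) :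
    ∃ O : BlockOrder T, (∀ a b, O.blk a = O.blk b) ∧ ∀ a b, O.le a b → lam a ≤ lam b := by
  classical
  let e : T → ℝ ×ₗ Fin (Fintype.card T) := fun t => toLex (lam t, Fintype.equivFin T t)
  have he : Function.Injective e := by
    intro a b hab
    have h1 := congrArg ofLex hab
    simp only [e, ofLex_toLex, Prod.mk.injEq] at h1
    exact (Fintype.equivFin T).injective h1.2
  let P : PartialOrder T := PartialOrder.lift e he
  refine ⟨{ P with blk := fun _ => true, blk_eq_iff := fun a b => ?_ }, fun _ _ => rfl, ?_⟩
  · simp only [true_iff]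
    exact le_total (e a) (e b)
  · intro a b hab
    exact (Prod.Lex.toLex_le_toLex'.1 hab).1

/-- Simultaneous greedy choice of coordinates for subspaces. -/
theorem exists_greedy [DecidableEq T] (lam : T → ℝ) : ∃ d : Finset T → ℝ, (∀ D, D ≠ Finset.univ → 0 ≤ d D) ∧
    (∀ P : Finset T, ∑ i ∈ P, lam i = -∑ D, d D * (P ∩ D).card) ∧
    ∀ W : Submodule ℂ (T → ℂ), ∃ P : Finset T, P.card = Module.finrank ℂ W ∧
      (∀ v ∈ W, (∀ i ∈ P, v i = 0) → v = 0) ∧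
      ∀ D, d D ≠ 0 → (P ∩ D).card = Module.finrank ℂ ↥(W ⊓ coord D) := by
  obtain ⟨O, hO, hlam⟩ := exists_chain_monotone lam
  obtain ⟨d, hd1, hd2, hd3⟩ := exists_layers (w := fun t => - lam t)
    (fun a b hab => neg_le_neg (hlam a b hab))
  refine ⟨d, hd2, fun P => ?_, fun W => ?_⟩
  · rw [← sum_eq_sum_layers hd3 P, Finset.sum_neg_distrib, neg_neg]
  · have hgr : Graded W := by
      intro v hv b
      by_cases h : ∀ i : T, blk i = b
      · have : toBlk b v = v := by ext i; simp [toBlk, h i]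
        rwa [this]
      · push Not at h
        obtain ⟨i0, hi0⟩ := h
        have : toBlk b v = 0 := by
          ext i
          have : blk i ≠ b := by rw [hO i i0]; exact hi0
          simp [toBlk, this]
        rw [this]; exact zero_mem _
    obtain ⟨P, C, hC, rfl⟩ := hgr.exists_echelon (I := Finset.univ) (by rw [coord_univ]; exact le_top)
    refine ⟨P, hC.finrank_range.symm, ?_, fun D hD => (hC.finrank_inf_coord (hd1 D hD)).symm⟩
    rintro _ ⟨u, rfl⟩ hz
    have hu : C *ᵥ u = C *ᵥ (pr P *ᵥ u) := by
      rw [Matrix.mulVec_mulVec, hC.supp.mul_pr subset_rfl]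
    rw [Matrix.mulVecLin_apply, hu] at hz ⊢
    have hP := pr_mulVec_mem P u
    generalize pr P *ᵥ u = u' at hz hP ⊢
    by_contra hne
    have hu0 : u' ≠ 0 := fun h => hne (by rw [h, Matrix.mulVec_zero])
    obtain ⟨a, ha, hmax⟩ := BlockOrder.exists_top hu0 (fun i j _ _ => hO i j)
    have h1 : (C *ᵥ u') a = C a a * u' a := by
      rw [Matrix.mulVec, dotProduct, Finset.sum_eq_single a]
      · intro b _ hb
        by_contra h0
        exact hb (le_antisymm (hmax b (right_ne_zero_of_mul h0))
          (hC.up a b (left_ne_zero_of_mul h0)))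
      · simp
    exact mul_ne_zero (hC.diag a (hP a ha)) ha (h1.symm.trans (hz a (hP a ha)))

theorem exists_log_expSum_slope [DecidableEq T] {ι : Type} [Fintype ι] [DecidableEq ι] {A : Matrix T ι ℂ}
    {P : Finset T} (hP : P.card = Module.finrank ℂ (LinearMap.range A.mulVecLin))
    (hA : ∀ v, A *ᵥ v = 0 → v = 0)
    (hinj : ∀ v ∈ LinearMap.range A.mulVecLin, (∀ i ∈ P, v i = 0) → v = 0) {c : ℝ}
    (hc : 0 ≤ c ∨ Fintype.card ι = Fintype.card T) (lam : T → ℝ) :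
    ∃ C : ℝ, ∀ t : ℝ, C + c * (t * ∑ i ∈ P, lam i) ≤ c * Real.log (expSum A (t • lam)) := by
  have hcard : P.card = Fintype.card ι := by
    rw [hP, LinearMap.finrank_range_of_inj, Module.finrank_fintype_fun_eq_card]
    intro a b hab
    rw [← sub_eq_zero] at hab ⊢
    exact hA _ (by rw [Matrix.mulVec_sub]; exact hab)
  let e : ι ≃ P := Fintype.equivOfCardEq (by simp [hcard])
  let σ : ι → T := fun i => (e i : T)
  have hdet : (A.submatrix σ id).det ≠ 0 := by
    intro h0
    obtain ⟨v, hv, hv0⟩ := Matrix.exists_mulVec_eq_zero_iff.2 h0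
    refine hv (hA v (hinj _ ⟨v, rfl⟩ fun i hi => ?_))
    have := congrFun hv0 (e.symm ⟨i, hi⟩)
    simpa [Matrix.mulVec, dotProduct, σ] using this
  have hsum : ∀ l : T → ℝ, ∑ i, l (σ i) = ∑ i ∈ P, l i := by
    intro l
    rw [← Finset.sum_coe_sort P, ← e.sum_comp]
  rcases hc with h | h
  · refine ⟨c * Real.log (‖(A.submatrix σ id).det‖ ^ 2), fun t => ?_⟩
    have := mul_le_mul_of_nonneg_left (log_expSum_ge hdet (t • lam)) h
    rw [hsum] at this
    simp only [Pi.smul_apply, smul_eq_mul, ← Finset.mul_sum] at this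
    linarith
  · have hPu : P = Finset.univ := (Finset.card_eq_iff_eq_univ P).1 (hcard.trans h)
    refine ⟨c * Real.log (expSum A 0), fun t => ?_⟩
    rw [expSum_eq_of_card h (t • lam), Real.log_mul (Real.exp_pos _).ne' (expSum_pos hdet _).ne',
      Real.log_exp, hPu]
    simp only [Pi.smul_apply, smul_eq_mul, ← Finset.mul_sum]
    exact le_of_eq (by ring)

end Greedy

section Slope

variable {S T : Type} [Fintype S] [Fintype T] [DecidableEq S] [DecidableEq T]

theorem range_submatrix_val (M : Matrix T S ℂ) (D : Finset S) :
    LinearMap.range (M.submatrix id (Subtype.val : D → S)).mulVecLin =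
      (coord D).map M.mulVecLin := by
  ext v
  simp only [LinearMap.mem_range, Submodule.mem_map, Matrix.mulVecLin_apply]
  constructor
  · rintro ⟨u, rfl⟩
    refine ⟨fun s => if h : s ∈ D then u ⟨s, h⟩ else 0, mem_coord'.2 fun i hi => by simp [hi], ?_⟩
    ext i
    simp only [Matrix.mulVec, dotProduct, Matrix.submatrix_apply, id]
    rw [← Finset.sum_subset (Finset.subset_univ D) (fun s _ hs => by simp [hs]),
      ← Finset.sum_coe_sort D]
    exact Finset.sum_congr rfl fun s _ => by simp
  · rintro ⟨u, hu, rfl⟩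
    refine ⟨fun s => u s, ?_⟩
    ext i
    simp only [Matrix.mulVec, dotProduct, Matrix.submatrix_apply, id]
    rw [← Finset.sum_subset (Finset.subset_univ D)
      (fun s _ hs => by rw [mem_coord'.1 hu s hs, mul_zero]), ← Finset.sum_coe_sort D]

theorem submatrix_val_injective {M : Matrix T S ℂ} (hM : ∀ v, M *ᵥ v = 0 → v = 0) (D : Finset S)
    (v : D → ℂ) (hv : M.submatrix id (Subtype.val : D → S) *ᵥ v = 0) : v = 0 := by
  set u : S → ℂ := fun s => if h : s ∈ D then v ⟨s, h⟩ else 0 with hu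
  have h1 : M *ᵥ u = 0 := by
    rw [← hv]
    ext i
    simp only [Matrix.mulVec, dotProduct, Matrix.submatrix_apply, id]
    rw [← Finset.sum_subset (Finset.subset_univ D) (fun s _ hs => by simp [hu, hs]),
      ← Finset.sum_coe_sort D]
    exact Finset.sum_congr rfl fun s _ => by simp [hu]
  ext s
  have := congrFun (hM u h1) s
  simpa [hu] using this

theorem finrank_map_inf_coord {M : Matrix T S ℂ} (hM : ∀ v, M *ᵥ v = 0 → v = 0)
    (W : Submodule ℂ (S → ℂ)) (Q : Finset T) :
    Module.finrank ℂ ↥(W.map M.mulVecLin ⊓ coord Q) =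
      Module.finrank ℂ ↥((coord Q).comap M.mulVecLin ⊓ W) := by
  have hinj : Function.Injective M.mulVecLin := by
    intro a b hab
    rw [← sub_eq_zero] at hab ⊢
    exact hM _ (by rw [Matrix.mulVec_sub]; exact hab)
  rw [(Submodule.equivMapOfInjective M.mulVecLin hinj
    ((coord Q).comap M.mulVecLin ⊓ W)).finrank_eq]
  refine congrArg (fun V : Submodule ℂ (T → ℂ) => Module.finrank ℂ V) ?_
  ext v
  simp only [Submodule.mem_inf, Submodule.mem_map, Submodule.mem_comap]
  constructor
  · rintro ⟨⟨u, hu, rfl⟩, hv⟩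
    exact ⟨u, ⟨hv, hu⟩, rfl⟩
  · rintro ⟨u, ⟨hv, hu⟩, rfl⟩
    exact ⟨⟨u, hu, rfl⟩, hv⟩

variable [BlockOrder S] [BlockOrder T]

/-- The matrix `M` preserves the blocks. -/
def IsBlk (M : Matrix T T ℂ) : Prop := ∀ i j, M i j ≠ 0 → blk i = blk j

theorem IsBlk.toBlk_mulVec {M : Matrix T T ℂ} (hM : IsBlk M) (b : Bool) (v : T → ℂ) :
    M *ᵥ toBlk b v = toBlk b (M *ᵥ v) := by
  ext i
  simp only [Matrix.mulVec, dotProduct, toBlk]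
  split_ifs with h
  · refine Finset.sum_congr rfl fun j _ => ?_
    by_cases h0 : M i j = 0
    · simp [h0]
    · rw [if_pos ((hM i j h0).symm.trans h)]
  · refine Finset.sum_eq_zero fun j _ => ?_
    by_cases h0 : M i j = 0
    · simp [h0]
    · rw [if_neg (fun h' => h ((hM i j h0).trans h')), mul_zero]

theorem exists_hasSub_of_comap (hS : ∀ s s' : S, blk s = blk s') {f : Matrix S T ℂ}
    {g : Matrix T S ℂ} (hfg : f * g = 1) (hgf : g * f = 1) {k : Matrix T T ℂ} (hk : IsBlk k)
    (Q : Finset T) : ∃ I' J', I'.card = J'.card ∧ HasSub f Finset.univ Finset.univ I' J' ∧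
      (∀ D : Finset T, IsLowerSet (D : Set T) → Module.finrank ℂ
        ↥((coord Q).comap k.mulVecLin ⊓ coord D) = (I' ∩ D).card) ∧
      ∀ D : Finset S, IsLowerSet (D : Set S) → Module.finrank ℂ
        ↥((coord Q).comap (k * g).mulVecLin ⊓ coord D) = (J' ∩ D).card := by
  have h1 : Graded ((coord Q).comap k.mulVecLin) := by
    intro v hv b
    rw [Submodule.mem_comap, Matrix.mulVecLin_apply, hk.toBlk_mulVec]
    exact graded_coord Q _ hv b
  have h2 : Graded ((coord Q).comap (k * g).mulVecLin) := by
    intro v hv b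
    by_cases h : ∀ i : S, blk i = b
    · have : toBlk b v = v := by ext i; simp [toBlk, h i]
      rwa [this]
    · push Not at h
      obtain ⟨i0, hi0⟩ := h
      have : toBlk b v = 0 := by
        ext i
        have : blk i ≠ b := by rw [hS i i0]; exact hi0
        simp [toBlk, this]
      rw [this]; exact zero_mem _
  obtain ⟨I', C, hC, hCr⟩ := h1.exists_echelon (I := Finset.univ) (by rw [coord_univ]; exact le_top)
  obtain ⟨J', C', hC', hCr'⟩ :=
    h2.exists_echelon (I := Finset.univ) (by rw [coord_univ]; exact le_top)
  refine ⟨I', J', ?_, ?_, fun D hD => ?_, fun D hD => ?_⟩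
  · rw [← hC.finrank_range, ← hC'.finrank_range, hCr, hCr']
    have hg : Function.Injective g.mulVecLin := by
      intro a b hab
      have := congrArg (fun v => f *ᵥ v) hab
      simpa [Matrix.mulVec_mulVec, hfg] using this
    rw [(Submodule.equivMapOfInjective g.mulVecLin hg
      ((coord Q).comap (k * g).mulVecLin)).finrank_eq]
    refine congrArg (fun V : Submodule ℂ (T → ℂ) => Module.finrank ℂ V) ?_
    ext v
    simp only [Submodule.mem_map, Submodule.mem_comap, Matrix.mulVecLin_apply]
    constructor
    · intro hv
      refine ⟨f *ᵥ v, ?_, by rw [Matrix.mulVec_mulVec, hgf, Matrix.one_mulVec]⟩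
      rwa [Matrix.mulVec_mulVec, Matrix.mul_assoc, hgf, Matrix.mul_one]
    · rintro ⟨u, hu, rfl⟩
      rwa [Matrix.mulVec_mulVec]
  · have hsup : Supp (f * C) Finset.univ I' :=
      Supp.mul (J := Finset.univ) (I := Finset.univ)
        (fun _ _ _ => ⟨Finset.mem_univ _, Finset.mem_univ _⟩) hC.supp
    obtain ⟨B, hB, hfC⟩ := hC'.exists_factor hsup fun v => by
      rw [hCr', Submodule.mem_comap, Matrix.mulVecLin_apply, Matrix.mulVec_mulVec,
        ← Matrix.mul_assoc, Matrix.mul_assoc k, hgf, Matrix.mul_one, ← Matrix.mulVec_mulVec]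
      have : C.mulVecLin v ∈ LinearMap.range C.mulVecLin := ⟨v, rfl⟩
      rw [hCr] at this
      exact this
    exact ⟨C, C', B, hC, hC', hB, hfC⟩
  · rw [← hCr]; exact hC.finrank_inf_coord hD
  · rw [← hCr']; exact hC'.finrank_inf_coord hD

/-- The lower bound for the slopes of the Kempf-Ness function. -/
theorem weightedLog_slope (hS : ∀ s s' : S, blk s = blk s') {f : Matrix S T ℂ}
    {g : Matrix T S ℂ} (hfg : f * g = 1) (hgf : g * f = 1) {w : T → ℝ} {x : S → ℝ}
    (hsum : ∑ i, w i = ∑ j, x j)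
    (hsub : ∀ I' J', I'.card = J'.card → HasSub f Finset.univ Finset.univ I' J' →
      ∑ i ∈ I', w i ≤ ∑ j ∈ J', x j)
    {c : Finset T → ℝ} {c' : Finset S → ℝ}
    (hc1 : ∀ D, c D ≠ 0 → IsLowerSet (D : Set T)) (hc2 : ∀ D, D ≠ Finset.univ → 0 ≤ c D)
    (hc3 : ∀ i, w i = ∑ D, if i ∈ D then c D else 0)
    (hc1' : ∀ D, c' D ≠ 0 → IsLowerSet (D : Set S)) (hc2' : ∀ D, D ≠ Finset.univ → 0 ≤ c' D)
    (hc3' : ∀ j, - x j = ∑ D, if j ∈ D then c' D else 0)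
    {k : Matrix T T ℂ} (hk : IsBlk k) (hk1 : kᴴ * k = 1) (lam : T → ℝ) :
    ∃ C, ∀ t : ℝ, 0 ≤ t → C ≤
      weightedLog (fun D : Finset T => (1 : Matrix T T ℂ).submatrix id (Subtype.val : D → T)) c k
        (t • lam) +
      weightedLog (fun D : Finset S => g.submatrix id (Subtype.val : D → S)) c' k (t • lam) := by
  have hkinj : ∀ v, k *ᵥ v = 0 → v = 0 := fun v hv => by
    have := congrArg (fun v => kᴴ *ᵥ v) hv
    simpa [Matrix.mulVec_mulVec, hk1] using this
  have hkginj : ∀ v, (k * g) *ᵥ v = 0 → v = 0 := fun v hv => by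
    have := congrArg (fun v => (f * kᴴ) *ᵥ v) hv
    simpa [Matrix.mulVec_mulVec, Matrix.mul_assoc, ← Matrix.mul_assoc kᴴ, hk1, hfg] using this
  have hcard : Fintype.card S = Fintype.card T := by
    have := Matrix.square_of_invertible f g hfg hgf
    exact this
  obtain ⟨d, hd1, hd2, hd3⟩ := exists_greedy lam
  choose P hP1 hP2 hP3 using fun D : Finset T => hd3 (LinearMap.range
    (k * (1 : Matrix T T ℂ).submatrix id (Subtype.val : D → T)).mulVecLin)
  choose P' hP1' hP2' hP3' using fun D : Finset S => hd3 (LinearMap.range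
    (k * g.submatrix id (Subtype.val : D → S)).mulVecLin)
  have heq : ∀ D : Finset T, k * (1 : Matrix T T ℂ).submatrix id (Subtype.val : D → T) =
      k.submatrix id (Subtype.val : D → T) := fun D => by
    change (k * 1).submatrix id _ = _
    rw [Matrix.mul_one]
  have heq' : ∀ D : Finset S, k * g.submatrix id (Subtype.val : D → S) =
      (k * g).submatrix id (Subtype.val : D → S) := fun D => rfl
  have hcc : ∀ D : Finset T, 0 ≤ c D ∨ Fintype.card D = Fintype.card T := fun D => by
    by_cases h : D = Finset.univ
    · right; simp [h]
    · exact Or.inl (hc2 D h)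
  have hcc' : ∀ D : Finset S, 0 ≤ c' D ∨ Fintype.card D = Fintype.card T := fun D => by
    by_cases h : D = Finset.univ
    · right; simp [h, hcard]
    · exact Or.inl (hc2' D h)
  choose C hC using fun D : Finset T => exists_log_expSum_slope (hP1 D)
    (fun v hv => submatrix_val_injective hkinj D v (by rw [← heq]; exact hv)) (hP2 D) (hcc D) lam
  choose C' hC' using fun D : Finset S => exists_log_expSum_slope (hP1' D)
    (fun v hv => submatrix_val_injective hkginj D v hv) (hP2' D) (hcc' D) lam
  have hr : ∀ Q, 0 ≤ - (d Q * (∑ D, c D * (P D ∩ Q).card + ∑ D, c' D * (P' D ∩ Q).card)) := by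
    intro Q
    by_cases hdQ : d Q = 0
    · simp [hdQ]
    obtain ⟨I', J', hIJ, hsubQ, hI, hJ⟩ := exists_hasSub_of_comap hS hfg hgf hk Q
    have e1 : ∀ D, c D * (P D ∩ Q).card = c D * (I' ∩ D).card := by
      intro D
      by_cases h0 : c D = 0
      · simp [h0]
      rw [hP3 D Q hdQ, heq, range_submatrix_val, finrank_map_inf_coord hkinj, hI D (hc1 D h0)]
    have e2 : ∀ D, c' D * (P' D ∩ Q).card = c' D * (J' ∩ D).card := by
      intro D
      by_cases h0 : c' D = 0
      · simp [h0]
      rw [hP3' D Q hdQ, heq', range_submatrix_val, finrank_map_inf_coord hkginj, hJ D (hc1' D h0)]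
    simp_rw [e1, e2]
    rw [← sum_eq_sum_layers hc3, ← sum_eq_sum_layers hc3', Finset.sum_neg_distrib]
    have h1 := hsub I' J' hIJ hsubQ
    by_cases hQ : Q = Finset.univ
    · have hI' : I' = Finset.univ := by
        rw [← Finset.card_eq_iff_eq_univ]
        have := hI Finset.univ (by simp [isLowerSet_univ])
        rw [hQ, coord_univ, Finset.inter_univ, Submodule.comap_top, inf_top_eq, finrank_top,
          Module.finrank_fintype_fun_eq_card] at this
        exact this.symm
      have hJ' : J' = Finset.univ := by
        rw [← Finset.card_eq_iff_eq_univ, ← hIJ, hI', Finset.card_univ, hcard]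
      rw [hI', hJ', hsum]; simp
    · have := hd1 Q hQ
      nlinarith
  refine ⟨∑ D, C D + ∑ D, C' D, fun t ht => ?_⟩
  have h1 : ∑ D, c D * ∑ i ∈ P D, lam i + ∑ D, c' D * ∑ i ∈ P' D, lam i =
      ∑ Q, - (d Q * (∑ D, c D * (P D ∩ Q).card + ∑ D, c' D * (P' D ∩ Q).card)) := by
    simp_rw [hd2, mul_add, neg_add, Finset.sum_add_distrib, Finset.mul_sum, mul_neg,
      Finset.mul_sum, Finset.sum_neg_distrib]
    rw [Finset.sum_comm, Finset.sum_comm (s := (Finset.univ : Finset (Finset S)))]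
    congr 2 <;>
    exact Finset.sum_congr rfl fun _ _ => Finset.sum_congr rfl fun _ _ => by ring
  have h2 : 0 ≤ ∑ D, c D * ∑ i ∈ P D, lam i + ∑ D, c' D * ∑ i ∈ P' D, lam i := by
    rw [h1]; exact Finset.sum_nonneg fun Q _ => hr Q
  have h3 := Finset.sum_le_sum fun D (_ : D ∈ Finset.univ) => hC D t
  have h4 := Finset.sum_le_sum fun D (_ : D ∈ Finset.univ) => hC' D t
  rw [Finset.sum_add_distrib] at h3 h4
  have h5 : ∑ D, c D * (t * ∑ i ∈ P D, lam i) = t * ∑ D, c D * ∑ i ∈ P D, lam i := by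
    rw [Finset.mul_sum]; exact Finset.sum_congr rfl fun _ _ => by ring
  have h6 : ∑ D, c' D * (t * ∑ i ∈ P' D, lam i) = t * ∑ D, c' D * ∑ i ∈ P' D, lam i := by
    rw [Finset.mul_sum]; exact Finset.sum_congr rfl fun _ _ => by ring
  rw [h5] at h3
  rw [h6] at h4
  have h7 := mul_nonneg ht h2
  unfold weightedLog
  linarith

end Slope

section Spectral

variable {T : Type} [Fintype T] [DecidableEq T]

theorem Matrix.IsHermitian.exists_unitary_diagonal {H : Matrix T T ℂ} (hH : H.IsHermitian) :
    ∃ (U : Matrix T T ℂ) (ev : T → ℝ), U * Uᴴ = 1 ∧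
      H = U * Matrix.diagonal (fun t => (ev t : ℂ)) * Uᴴ := by
  refine ⟨(hH.eigenvectorUnitary : Matrix _ _ ℂ), hH.eigenvalues,
    Matrix.mem_unitaryGroup_iff.1 (SetLike.coe_mem _), ?_⟩
  conv_lhs => rw [hH.spectral_theorem, Unitary.conjStarAlgAut_apply]
  rfl

/-- The spectral theorem for a matrix preserving the fibres of a map. -/
theorem exists_fiber_diagonalization (b : T → Bool) {H : Matrix T T ℂ} (hH : H.IsHermitian)
    (hb : ∀ i j, H i j ≠ 0 → b i = b j) : ∃ (k : Matrix T T ℂ) (μ : T → ℝ),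
      (∀ i j, k i j ≠ 0 → b i = b j) ∧ kᴴ * k = 1 ∧
        H = kᴴ * Matrix.diagonal (fun t => (μ t : ℂ)) * k := by
  set e := Equiv.sigmaFiberEquiv b with he
  have hex := fun y : Bool =>
    (hH.submatrix (Subtype.val : {t // b t = y} → T)).exists_unitary_diagonal
  choose U ev hU1 hspec using hex
  have hHe : H.submatrix e e = Matrix.blockDiagonal' fun y =>
      H.submatrix (Subtype.val : {t // b t = y} → T) Subtype.val := by
    ext ⟨y, t, ht⟩ ⟨y', t', ht'⟩
    by_cases hy : y = y'
    · subst hy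
      rw [Matrix.blockDiagonal'_apply_eq]; rfl
    · rw [Matrix.blockDiagonal'_apply_ne _ _ _ hy]
      by_contra h0
      exact hy (ht.symm.trans ((hb _ _ h0).trans ht'))
  set K : Matrix (Σ y : Bool, {t // b t = y}) (Σ y : Bool, {t // b t = y}) ℂ :=
    Matrix.blockDiagonal' fun y => (U y)ᴴ with hK
  have hK1 : Kᴴ * K = 1 := by
    rw [hK, Matrix.blockDiagonal'_conjTranspose, ← Matrix.blockDiagonal'_mul]
    simp_rw [Matrix.conjTranspose_conjTranspose, hU1]
    exact Matrix.blockDiagonal'_one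
  have hKH : H.submatrix e e = Kᴴ * Matrix.diagonal
      (fun p : Σ y : Bool, {t // b t = y} => (ev p.1 p.2 : ℂ)) * K := by
    rw [hHe]
    rw [funext hspec, hK, Matrix.blockDiagonal'_conjTranspose, ← Matrix.blockDiagonal'_diagonal
      (fun y t => (ev y t : ℂ)), ← Matrix.blockDiagonal'_mul,
      ← Matrix.blockDiagonal'_mul]
    simp_rw [Matrix.conjTranspose_conjTranspose]
  refine ⟨K.submatrix e.symm e.symm, fun t => ev (e.symm t).1 (e.symm t).2,
    fun i j hij => ?_, ?_, ?_⟩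
  · by_contra h
    refine hij ?_
    rw [Matrix.submatrix_apply, hK]
    exact Matrix.blockDiagonal'_apply_ne _ _ _ h
  · rw [Matrix.conjTranspose_submatrix, Matrix.submatrix_mul_equiv, hK1, Matrix.submatrix_one_equiv]
  · have : H = (H.submatrix e e).submatrix e.symm e.symm := by
      rw [Matrix.submatrix_submatrix]; simp
    rw [this, hKH, Matrix.conjTranspose_submatrix,
      ← Matrix.submatrix_mul_equiv _ _ _ e.symm, ← Matrix.submatrix_mul_equiv _ _ _ e.symm,
      Matrix.submatrix_diagonal_equiv]
    rfl

theorem exists_gram_eq_exp (b : T → Bool) {M N : Matrix T T ℂ} (hNM : N * M = 1)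
    (hb : ∀ i j, M i j ≠ 0 → b i = b j) : ∃ (k : Matrix T T ℂ) (lam : T → ℝ),
      (∀ i j, k i j ≠ 0 → b i = b j) ∧ kᴴ * k = 1 ∧
        Mᴴ * M = kᴴ * Matrix.diagonal (fun t => ((Real.exp (lam t) : ℝ) : ℂ)) * k := by
  obtain ⟨k, μ, hkb, hk1, hk⟩ := exists_fiber_diagonalization b
    (Matrix.isHermitian_conjTranspose_mul_self M) (fun i j hij => by
      rw [Matrix.mul_apply] at hij
      obtain ⟨l, -, hl⟩ := Finset.exists_ne_zero_of_sum_ne_zero hij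
      rw [Matrix.conjTranspose_apply] at hl
      exact (hb l i (fun h => hl (by simp [h]))).symm.trans (hb l j (fun h => hl (by simp [h]))))
  have hk2 : k * kᴴ = 1 := mul_eq_one_comm.1 hk1
  have h1 : Matrix.diagonal (fun t => (μ t : ℂ)) = (M * kᴴ)ᴴ * (M * kᴴ) := by
    rw [Matrix.conjTranspose_mul, Matrix.conjTranspose_conjTranspose, Matrix.mul_assoc,
      ← Matrix.mul_assoc Mᴴ, hk]
    simp only [← Matrix.mul_assoc]
    rw [hk2, Matrix.one_mul, Matrix.mul_assoc, hk2, Matrix.mul_one]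
  have h2 : ∀ t, μ t = ∑ j, ‖(M * kᴴ) j t‖ ^ 2 := by
    intro t
    have := congrFun (congrFun h1 t) t
    rw [Matrix.diagonal_apply_eq, Matrix.mul_apply] at this
    apply Complex.ofReal_injective
    rw [this]
    push_cast
    refine Finset.sum_congr rfl fun j _ => ?_
    rw [Matrix.conjTranspose_apply]
    exact Complex.conj_mul' _
  have h3 : ∀ t, 0 < μ t := by
    intro t
    rw [h2]
    refine lt_of_le_of_ne (Finset.sum_nonneg fun _ _ => sq_nonneg _) fun h0 => ?_
    have h4 : ∀ j, (M * kᴴ) j t = 0 := fun j => by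
      have := (Finset.sum_eq_zero_iff_of_nonneg (fun _ _ => sq_nonneg _)).1 h0.symm j
        (Finset.mem_univ j)
      simpa using this
    have h5 : (k * N) * (M * kᴴ) = 1 := by
      rw [Matrix.mul_assoc, ← Matrix.mul_assoc N, hNM, Matrix.one_mul, hk2]
    have h6 := congrFun (congrFun h5 t) t
    rw [Matrix.mul_apply, Matrix.one_apply_eq] at h6
    simp [h4] at h6
  refine ⟨k, fun t => Real.log (μ t), hkb, hk1, ?_⟩
  simp_rw [Real.exp_log (h3 _)]
  exact hk

end Spectral

section Minor

variable {T : Type} [Fintype T] [DecidableEq T]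

theorem det_one_add_smul_vecMulVec (u : T → ℂ) (s : ℝ) :
    (1 + (s : ℂ) • Matrix.vecMulVec u (star u)).det = ((1 + s * ∑ i, ‖u i‖ ^ 2 : ℝ) : ℂ) := by
  have : (s : ℂ) • Matrix.vecMulVec u (star u) =
      Matrix.replicateCol Unit ((s : ℂ) • u) * Matrix.replicateRow Unit (star u) := by
    rw [← Matrix.vecMulVec_eq Unit, Matrix.smul_vecMulVec]
  rw [this, Matrix.det_one_add_replicateCol_mul_replicateRow]
  push_cast
  congr 1
  rw [dotProduct, Finset.mul_sum]
  refine Finset.sum_congr rfl fun i _ => ?_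
  simp only [Pi.star_apply, Pi.smul_apply, smul_eq_mul]
  rw [← Complex.conj_mul' (u i)]
  simp only [Complex.star_def]
  ring

theorem IsUp.submatrix_mul [PartialOrder T] {M N : Matrix T T ℂ} (hN : IsUp N) {D : Finset T}
    (hD : IsLowerSet (D : Set T)) : (M * N).submatrix (Subtype.val : D → T) Subtype.val =
      M.submatrix (Subtype.val : D → T) (Subtype.val : D → T) * N.submatrix (Subtype.val : D → T) (Subtype.val : D → T) := by
  ext i j
  simp only [Matrix.submatrix_apply, Matrix.mul_apply]
  rw [Finset.sum_coe_sort D (fun l => M i l * N l j)]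
  symm
  refine Finset.sum_subset (Finset.subset_univ D) fun l _ hl => ?_
  by_contra h0
  exact hl (hD (hN l j (right_ne_zero_of_mul h0)) j.2)

theorem IsUp.submatrix_conjTranspose_mul [PartialOrder T] {M N : Matrix T T ℂ} (hN : IsUp N)
    {D : Finset T} (hD : IsLowerSet (D : Set T)) :
    (Nᴴ * M).submatrix (Subtype.val : D → T) Subtype.val =
      (N.submatrix (Subtype.val : D → T) (Subtype.val : D → T))ᴴ * M.submatrix (Subtype.val : D → T) (Subtype.val : D → T) := by
  have := congrArg Matrix.conjTranspose (hN.submatrix_mul (M := Mᴴ) hD)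
  rw [Matrix.conjTranspose_submatrix, Matrix.conjTranspose_mul, Matrix.conjTranspose_mul,
    Matrix.conjTranspose_conjTranspose] at this
  rw [this, Matrix.conjTranspose_submatrix Mᴴ, Matrix.conjTranspose_conjTranspose]

/-- Lower minors of a rank one perturbation of a positive definite matrix. -/
theorem exists_det_lower_minor [PartialOrder T] {q r : Matrix T T ℂ} (hq : IsUp q)
    (hrq : r * q = 1) {D : Finset T} (hD : IsLowerSet (D : Set T)) :
    ∃ a : ℝ, 0 < a ∧ ∀ (u : T → ℂ) (s : ℝ),
      ((qᴴ * (1 + (s : ℂ) • Matrix.vecMulVec u (star u)) * q).submatrix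
        (Subtype.val : D → T) Subtype.val).det = ((a * (1 + s * ∑ i ∈ D, ‖u i‖ ^ 2) : ℝ) : ℂ) := by
  set qD : Matrix D D ℂ := q.submatrix Subtype.val Subtype.val with hqD
  have h1 : r.submatrix (Subtype.val : D → T) (Subtype.val : D → T) * qD = 1 := by
    rw [← hq.submatrix_mul hD, hrq]
    ext i j
    simp only [Matrix.submatrix_apply, Matrix.one_apply, Subtype.val_inj]
  have h2 : qD.det ≠ 0 := by
    intro h
    have := congrArg Matrix.det h1
    rw [Matrix.det_mul, h, mul_zero, Matrix.det_one] at this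
    exact zero_ne_one this
  refine ⟨‖qD.det‖ ^ 2, by positivity, fun u s => ?_⟩
  have h3 : (1 + (s : ℂ) • Matrix.vecMulVec u (star u)).submatrix (Subtype.val : D → T) Subtype.val =
      1 + (s : ℂ) • Matrix.vecMulVec (fun i : D => u i) (star fun i : D => u i) := by
    ext i j
    simp only [Matrix.submatrix_apply, Matrix.one_apply, Subtype.val_inj, Matrix.add_apply,
      Matrix.smul_apply, Matrix.vecMulVec_apply, Pi.star_apply]
  rw [hq.submatrix_mul hD, hq.submatrix_conjTranspose_mul hD, h3, Matrix.det_mul, Matrix.det_mul,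
    det_one_add_smul_vecMulVec, Matrix.det_conjTranspose,
    Finset.sum_coe_sort D (fun i => ‖u i‖ ^ 2), Complex.ofReal_mul]
  push_cast
  rw [← Complex.conj_mul' qD.det, Complex.star_def]
  ring

end Minor

section Variation

theorem exists_add_sq_eq {n s : ℝ} (h : 0 < 1 + s * n) :
    ∃ t : ℝ, 2 * t + t ^ 2 * n = s ∧ 0 < 1 + t * n := by
  set r := Real.sqrt (1 + s * n) with hr
  have hr0 : 0 < r := Real.sqrt_pos.2 h
  have hr2 : r ^ 2 = 1 + s * n := Real.sq_sqrt h.le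
  have h1 : 1 + s / (1 + r) * n = r := by
    field_simp; linear_combination -hr2
  have h2 : (s / (1 + r)) * (1 + r) = s := by field_simp
  refine ⟨s / (1 + r), ?_, by rw [h1]; exact hr0⟩
  linear_combination h2 + (s / (1 + r)) * h1

theorem abs_sum_le_of_min {α : Type} [Fintype α] {c K nn : α → ℝ} {δ τ β e n : ℝ}
    (hK : ∀ a, 0 < K a) (hδ : 0 ≤ δ) (he : 0 < e) (hτ : 0 ≤ τ) (hβ : 0 ≤ β) (hβ' : β ≤ n * τ)
    (hn : 0 ≤ n)
    (h : ∀ s, 0 < 1 + s * n →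
      ∑ a, c a * Real.log (K a * (1 + 0 * nn a)) + δ * Real.log (τ + 0 * β + (e * (1 + 0 * n))⁻¹) ≤
      ∑ a, c a * Real.log (K a * (1 + s * nn a)) + δ * Real.log (τ + s * β + (e * (1 + s * n))⁻¹)) :
    |∑ a, c a * nn a| ≤ δ * n := by
  set F : ℝ → ℝ := fun s => ∑ a, c a * Real.log (K a * (1 + s * nn a)) +
    δ * Real.log (τ + s * β + (e * (1 + s * n))⁻¹) with hF
  have hlin : ∀ b, HasDerivAt (fun s : ℝ => s * b) b 0 := fun b => by
    simpa using (hasDerivAt_id (0 : ℝ)).mul_const b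
  have h1 : ∀ a, HasDerivAt (fun s => c a * Real.log (K a * (1 + s * nn a))) (c a * nn a) 0 := by
    intro a
    have := ((((hlin (nn a)).const_add 1).const_mul (K a)).log
      (by simpa using (hK a).ne')).const_mul (c a)
    refine this.congr_deriv ?_
    have := (hK a).ne'
    simp only [zero_mul, add_zero, mul_one]
    field_simp
  have hpos : τ + 0 * β + (e * (1 + 0 * n))⁻¹ ≠ 0 := by
    have : 0 < e⁻¹ := inv_pos.2 he
    simp only [zero_mul, add_zero, mul_one]
    positivity
  have h2 : HasDerivAt (fun s => δ * Real.log (τ + s * β + (e * (1 + s * n))⁻¹))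
      (δ * ((β - n * e⁻¹) / (τ + e⁻¹))) 0 := by
    have h3 := (((hlin n).const_add 1).const_mul e).fun_inv (by simpa using he.ne')
    have := ((((hlin β).const_add τ).add h3).log hpos).const_mul δ
    refine HasDerivAt.congr_deriv (f' := _) this ?_
    simp only [Pi.add_apply, zero_mul, add_zero, mul_one]
    congr 2
    field_simp
    ring
  have h4 : HasDerivAt F (∑ a, c a * nn a + δ * ((β - n * e⁻¹) / (τ + e⁻¹))) 0 :=
    (HasDerivAt.fun_sum fun a _ => h1 a).add h2
  have h5 : IsLocalMin F 0 := by
    have hev : ∀ᶠ s in nhds (0 : ℝ), 0 < 1 + s * n := by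
      have : ContinuousAt (fun s : ℝ => 1 + s * n) 0 := by fun_prop
      exact this.eventually (lt_mem_nhds (by simp))
    filter_upwards [hev] with s hs using h s hs
  have h6 := h5.hasDerivAt_eq_zero h4
  have he' : 0 < e⁻¹ := inv_pos.2 he
  have hd : 0 < τ + e⁻¹ := by positivity
  have h7 : |(β - n * e⁻¹) / (τ + e⁻¹)| ≤ n := by
    rw [abs_div, abs_of_pos hd, div_le_iff₀ hd, abs_le]
    have := mul_nonneg hn he'.le
    have := mul_nonneg hn hτ
    constructor <;> nlinarith
  have h8 : ∑ a, c a * nn a = - (δ * ((β - n * e⁻¹) / (τ + e⁻¹))) := by linarith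
  rw [h8, abs_neg, abs_mul, abs_of_nonneg hδ]
  exact mul_le_mul_of_nonneg_left h7 hδ

variable {T : Type} [Fintype T] [DecidableEq T]

theorem expSum_mul_eq {ι : Type} [Fintype ι] [DecidableEq ι] (A : Matrix T ι ℂ) {k M : Matrix T T ℂ}
    {lam : T → ℝ} (h : M = kᴴ * Matrix.diagonal (fun t => ((Real.exp (lam t) : ℝ) : ℂ)) * k) :
    (expSum (k * A) lam : ℂ) = (Fintype.card ι).factorial * (Aᴴ * M * A).det := by
  rw [← factorial_mul_det_exp, h, Matrix.conjTranspose_mul]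
  simp only [Matrix.mul_assoc]

theorem coerc_eq {k M : Matrix T T ℂ} {lam : T → ℝ} (hk : kᴴ * k = 1)
    (h : M = kᴴ * Matrix.diagonal (fun t => ((Real.exp (lam t) : ℝ) : ℂ)) * k) :
    coerc lam = Real.log (M.trace.re + (M.det.re)⁻¹) := by
  have hk' : k * kᴴ = 1 := mul_eq_one_comm.1 hk
  have h1 : M.trace = ((∑ t, Real.exp (lam t) : ℝ) : ℂ) := by
    rw [h, Matrix.trace_mul_comm, ← Matrix.mul_assoc, hk', Matrix.one_mul, Matrix.trace_diagonal]
    push_cast; rfl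
  have h2 : M.det = ((Real.exp (∑ t, lam t) : ℝ) : ℂ) := by
    have h3 := congrArg Matrix.det hk
    rw [Matrix.det_mul, Matrix.det_one] at h3
    rw [h, Matrix.det_mul, Matrix.det_mul, mul_right_comm, h3, one_mul, Matrix.det_diagonal,
      Real.exp_sum]
    push_cast; rfl
  rw [coerc, h1, h2, Complex.ofReal_re, Complex.ofReal_re, Real.exp_neg]

theorem trace_perturb (p : Matrix T T ℂ) (v : T → ℂ) : ∃ τ β : ℝ, 0 ≤ τ ∧ 0 ≤ β ∧
    β ≤ (∑ i, ‖v i‖ ^ 2) * τ ∧ ∀ s : ℝ,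
      (pᴴ * (1 + (s : ℂ) • Matrix.vecMulVec v (star v)) * p).trace.re = τ + s * β := by
  have hn : ∀ M : Matrix T T ℂ, (Mᴴ * M).trace = ((∑ j, ∑ i, ‖M i j‖ ^ 2 : ℝ) : ℂ) := by
    intro M
    simp only [Matrix.trace, Matrix.diag_apply, Matrix.mul_apply, Matrix.conjTranspose_apply]
    push_cast
    exact Finset.sum_congr rfl fun j _ => Finset.sum_congr rfl fun i _ => Complex.conj_mul' _
  refine ⟨∑ j, ∑ i, ‖p i j‖ ^ 2, ∑ j, ‖∑ i, star (v i) * p i j‖ ^ 2, by positivity, by positivity,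
    ?_, fun s => ?_⟩
  · rw [Finset.mul_sum]
    refine Finset.sum_le_sum fun j _ => ?_
    calc ‖∑ i, star (v i) * p i j‖ ^ 2 ≤ (∑ i, ‖v i‖ * ‖p i j‖) ^ 2 := by
          gcongr
          refine (norm_sum_le _ _).trans (Finset.sum_le_sum fun i _ => ?_)
          rw [norm_mul, norm_star]
      _ ≤ _ := Finset.sum_mul_sq_le_sq_mul_sq _ _ _
  · rw [Matrix.mul_add, Matrix.add_mul, Matrix.mul_one, Matrix.trace_add, hn, Complex.add_re,
      Complex.ofReal_re, Matrix.mul_smul, Matrix.smul_mul, Matrix.trace_smul, smul_eq_mul,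
      Complex.re_ofReal_mul]
    congr 2
    rw [Matrix.mul_vecMulVec, Matrix.vecMulVec_mul, Matrix.trace_vecMulVec, dotProduct,
      Complex.re_sum]
    refine Finset.sum_congr rfl fun j _ => ?_
    have : (pᴴ *ᵥ v) j = star (∑ i, star (v i) * p i j) := by
      simp [Matrix.mulVec, dotProduct, Matrix.conjTranspose_apply, star_sum, mul_comm]
    rw [this]
    have h3 : (star v ᵥ* p) j = ∑ i, star (v i) * p i j := rfl
    rw [h3, Complex.star_def, Complex.conj_mul']
    norm_cast

theorem gram_perturb (p : Matrix T T ℂ) (v : T → ℂ) (t : ℝ) :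
    ((1 + (t : ℂ) • Matrix.vecMulVec v (star v)) * p)ᴴ *
      ((1 + (t : ℂ) • Matrix.vecMulVec v (star v)) * p) =
      pᴴ * (1 + ((2 * t + t ^ 2 * ∑ i, ‖v i‖ ^ 2 : ℝ) : ℂ) • Matrix.vecMulVec v (star v)) * p := by
  have h1 : (Matrix.vecMulVec v (star v))ᴴ = Matrix.vecMulVec v (star v) := by
    rw [Matrix.conjTranspose_vecMulVec, star_star]
  have h2 : Matrix.vecMulVec v (star v) * Matrix.vecMulVec v (star v) =
      ((∑ i, ‖v i‖ ^ 2 : ℝ) : ℂ) • Matrix.vecMulVec v (star v) := by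
    rw [Matrix.vecMulVec_mul_vecMulVec]
    have : star v ⬝ᵥ v = ((∑ i, ‖v i‖ ^ 2 : ℝ) : ℂ) := by
      push_cast
      exact Finset.sum_congr rfl fun i _ => Complex.conj_mul' _
    rw [this]
    ext i j
    simp [Matrix.vecMulVec_apply, mul_left_comm]
  rw [Matrix.conjTranspose_mul, Matrix.conjTranspose_add, Matrix.conjTranspose_one,
    Matrix.conjTranspose_smul, h1, Complex.star_def, Complex.conj_ofReal, Matrix.mul_assoc,
    ← Matrix.mul_assoc _ _ p, ← Matrix.mul_assoc]
  congr 2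
  rw [Matrix.add_mul, Matrix.mul_add, Matrix.mul_add, Matrix.mul_one, Matrix.one_mul,
    Matrix.smul_mul, Matrix.smul_mul, Matrix.mul_one, Matrix.mul_smul, h2]
  push_cast
  module

theorem exists_inv_perturb (v : T → ℂ) {t : ℝ} (ht : 0 < 1 + t * ∑ i, ‖v i‖ ^ 2) :
    ∃ N : Matrix T T ℂ, N * (1 + (t : ℂ) • Matrix.vecMulVec v (star v)) = 1 := by
  have h : IsUnit (1 + (t : ℂ) • Matrix.vecMulVec v (star v)).det := by
    rw [det_one_add_smul_vecMulVec, isUnit_iff_ne_zero]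
    exact_mod_cast ht.ne'
  exact ⟨_, Matrix.nonsing_inv_mul _ h⟩

end Variation

section Approx

variable {S T : Type} [Fintype S] [Fintype T] [DecidableEq S] [DecidableEq T]

/-- The index types of the lower minors on both sides. -/
def MinorIndex : Finset T ⊕ Finset S → Type
  | .inl D => D
  | .inr D => D

instance (a : Finset T ⊕ Finset S) : Fintype (MinorIndex a) :=
  match a with
  | .inl D => inferInstanceAs (Fintype D)
  | .inr D => inferInstanceAs (Fintype D)

instance (a : Finset T ⊕ Finset S) : DecidableEq (MinorIndex a) :=
  match a with
  | .inl D => inferInstanceAs (DecidableEq D)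
  | .inr D => inferInstanceAs (DecidableEq D)

/-- The coordinate frames of the lower minors on both sides. -/
def minorFrame (g : Matrix T S ℂ) : ∀ a : Finset T ⊕ Finset S, Matrix T (MinorIndex a) ℂ
  | .inl D => (1 : Matrix T T ℂ).submatrix id (Subtype.val : D → T)
  | .inr D => g.submatrix id (Subtype.val : D → S)

theorem weightedLog_minorFrame (g : Matrix T S ℂ) (c : Finset T → ℝ) (c' : Finset S → ℝ)
    (k : Matrix T T ℂ) (lam : T → ℝ) :
    weightedLog (minorFrame g) (Sum.elim c c') k lam =
      weightedLog (fun D : Finset T => (1 : Matrix T T ℂ).submatrix id (Subtype.val : D → T)) c k lam +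
      weightedLog (fun D : Finset S => g.submatrix id (Subtype.val : D → S)) c' k lam := by
  unfold weightedLog
  rw [Fintype.sum_sum_type]
  rfl

theorem isCompact_isBlk_unitary [BlockOrder T] :
    IsCompact {k : T → T → ℂ | (Matrix.of k)ᴴ * Matrix.of k = 1 ∧ IsBlk (Matrix.of k)} := by
  refine IsCompact.of_isClosed_subset (isCompact_univ_pi fun _ : T => isCompact_univ_pi fun _ : T =>
    isCompact_closedBall (0 : ℂ) 1) ?_ ?_
  · have h1 : IsClosed {k : T → T → ℂ | (Matrix.of k)ᴴ * Matrix.of k = 1} := by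
      have : Continuous fun k : T → T → ℂ => (Matrix.of k)ᴴ * Matrix.of k := by
        have h0 : Continuous fun k : T → T → ℂ => Matrix.of k := continuous_id
        fun_prop
      exact isClosed_eq this continuous_const
    have h2 : {k : T → T → ℂ | IsBlk (Matrix.of k)} =
        ⋂ i, ⋂ j, {k : T → T → ℂ | k i j ≠ 0 → blk i = blk j} := by
      ext k; simp [IsBlk]
    have h3 : IsClosed {k : T → T → ℂ | IsBlk (Matrix.of k)} := by
      rw [h2]
      refine isClosed_iInter fun i => isClosed_iInter fun j => ?_
      by_cases h : blk i = blk j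
      · simp [h]
      · simp only [h, imp_false, not_not]
        exact isClosed_eq (by fun_prop) continuous_const
    exact h1.inter h3
  · intro k hk i _ j _
    rw [mem_closedBall_zero_iff]
    have : (Matrix.of k)ᴴ * Matrix.of k = pr Finset.univ := by rw [pr_univ]; exact hk.1
    exact norm_entry_le_one this i j

theorem exists_cholesky_gram {R : Type} [Fintype R] [BlockOrder T] {M : Matrix R T ℂ}
    {N : Matrix T R ℂ} (hNM : N * M = 1) (hb : ∀ i j, (Mᴴ * M) i j ≠ 0 → blk i = blk j) :
    ∃ p r : Matrix T T ℂ, IsUp p ∧ r * p = 1 ∧ p * r = 1 ∧ rᴴ * (Mᴴ * M) * r = 1 ∧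
      Mᴴ * M = pᴴ * p := by
  obtain ⟨r, hr, hr1⟩ := exists_cholesky (Mᴴ * M) (Matrix.isHermitian_conjTranspose_mul_self M)
    Finset.univ (fun a _ b _ => hb a b) fun v _ hv => by
      have h1 : M *ᵥ v ≠ 0 := fun h => hv (by
        have := congrArg (fun u => N *ᵥ u) h
        simpa [Matrix.mulVec_mulVec, hNM] using this)
      rw [← Matrix.mulVec_mulVec, Matrix.dotProduct_mulVec, ← Matrix.star_mulVec]
      have h2 : star (M *ᵥ v) ⬝ᵥ (M *ᵥ v) = ((∑ i, ‖(M *ᵥ v) i‖ ^ 2 : ℝ) : ℂ) := by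
        push_cast
        exact Finset.sum_congr rfl fun i _ => Complex.conj_mul' _
      rw [h2, Complex.ofReal_re]
      obtain ⟨i, hi⟩ := Function.ne_iff.1 h1
      refine Finset.sum_pos' (fun _ _ => sq_nonneg _) ⟨i, Finset.mem_univ _, ?_⟩
      have : 0 < ‖(M *ᵥ v) i‖ := norm_pos_iff.2 hi
      positivity
  obtain ⟨p, hp, hrp, hpr⟩ := hr.exists_inv
  rw [pr_univ] at hr1 hrp hpr
  refine ⟨p, r, hp.up, hrp, hpr, hr1, ?_⟩
  calc Mᴴ * M = (r * p)ᴴ * (Mᴴ * M) * (r * p) := by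
        rw [hrp, Matrix.conjTranspose_one, Matrix.one_mul, Matrix.mul_one]
    _ = pᴴ * (rᴴ * (Mᴴ * M) * r) * p := by
        rw [Matrix.conjTranspose_mul]; simp only [Matrix.mul_assoc]
    _ = pᴴ * p := by rw [hr1, Matrix.mul_one]

theorem sum_layers_mul {T : Type} [Fintype T] [DecidableEq T] {w : T → ℝ} {c : Finset T → ℝ}
    (hc : ∀ i, w i = ∑ D, if i ∈ D then c D else 0) (y : T → ℝ) :
    ∑ D, c D * ∑ i ∈ D, y i = ∑ i, w i * y i := by
  simp_rw [hc, Finset.sum_mul]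
  rw [Finset.sum_comm]
  refine Finset.sum_congr rfl fun D _ => ?_
  rw [Finset.mul_sum, ← Finset.sum_subset (Finset.subset_univ D) (fun i _ hi => by simp [hi])]
  exact Finset.sum_congr rfl fun i hi => by simp [hi]

variable [BlockOrder S] [BlockOrder T]

/-- Approximate solutions of the moment map equation. -/
theorem exists_approx (hS : ∀ s s' : S, blk s = blk s') {f : Matrix S T ℂ}
    {g : Matrix T S ℂ} (hfg : f * g = 1) (hgf : g * f = 1) {w : T → ℝ} {x : S → ℝ}
    (hw : Antitone w) (hx : Monotone x) (hsum : ∑ i, w i = ∑ j, x j)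
    (hsub : ∀ I' J', I'.card = J'.card → HasSub f Finset.univ Finset.univ I' J' →
      ∑ i ∈ I', w i ≤ ∑ j ∈ J', x j) {δ : ℝ} (hδ : 0 < δ) :
    ∃ V : Matrix T S ℂ, Vᴴ * V = 1 ∧ V * Vᴴ = 1 ∧ ∀ v : T → ℂ,
      (∀ i j, v i ≠ 0 → v j ≠ 0 → blk i = blk j) →
      |∑ i, w i * ‖v i‖ ^ 2 - ∑ j, x j * ‖(Vᴴ *ᵥ v) j‖ ^ 2| ≤ δ * ∑ i, ‖v i‖ ^ 2 := by
  obtain ⟨c, hc1, hc2, hc3⟩ := exists_layers hw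
  obtain ⟨c', hc1', hc2', hc3'⟩ := exists_layers (w := fun j => - x j) fun a b h => neg_le_neg (hx h)
  have hcard : Fintype.card S = Fintype.card T := Matrix.square_of_invertible f g hfg hgf
  have hginj : ∀ v, g *ᵥ v = 0 → v = 0 := fun v hv => by
    have := congrArg (fun v => f *ᵥ v) hv
    simpa [Matrix.mulVec_mulVec, hfg] using this
  obtain ⟨k0, ⟨hk0, hk0b⟩, lam0, hmin⟩ := exists_weightedLog_min (A := minorFrame g)
    (c := Sum.elim c c')
    (fun a v hv => match a with
      | .inl D => submatrix_val_injective (M := 1) (fun v hv => by simpa using hv) D v hv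
      | .inr D => submatrix_val_injective hginj D v hv)
    (fun a => match a with
      | .inl D => by
          by_cases h : D = Finset.univ
          · right
            subst h
            exact Fintype.card_coe Finset.univ
          · exact Or.inl (hc2 D h)
      | .inr D => by
          by_cases h : D = Finset.univ
          · right
            subst h
            exact (Fintype.card_coe Finset.univ).trans hcard
          · exact Or.inl (hc2' D h))
    isCompact_isBlk_unitary ⟨(1 : Matrix T T ℂ), by
      refine ⟨?_, ?_⟩
      · change (1 : Matrix T T ℂ)ᴴ * 1 = 1
        simp
      · intro i j h
        change (1 : Matrix T T ℂ) i j ≠ 0 at h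
        by_contra hij
        exact h (Matrix.one_apply_ne (fun h' => hij (by rw [h'])))⟩
    (fun k hk => hk.1)
    (fun k hk lam => by
      obtain ⟨C, hC⟩ := weightedLog_slope hS hfg hgf hsum hsub hc1 hc2 hc3 hc1' hc2' hc3' hk.2 hk.1 lam
      exact ⟨C, fun t ht => (hC t ht).trans_eq (weightedLog_minorFrame g c c' _ _).symm⟩) hδ
  set k := Matrix.of k0 with hk
  set M := Matrix.diagonal (fun t => ((Real.exp (lam0 t / 2) : ℝ) : ℂ)) * k with hM
  have hkk : k * kᴴ = 1 := mul_eq_one_comm.1 hk0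
  have hM1 : kᴴ * Matrix.diagonal (fun t => ((Real.exp (-(lam0 t / 2)) : ℝ) : ℂ)) * M = 1 := by
    rw [hM, Matrix.mul_assoc, ← Matrix.mul_assoc (Matrix.diagonal _), Matrix.diagonal_mul_diagonal]
    have : (fun i => ((Real.exp (-(lam0 i / 2)) : ℝ) : ℂ) * ((Real.exp (lam0 i / 2) : ℝ) : ℂ)) =
        fun _ => 1 := by
      ext i
      rw [← Complex.ofReal_mul, ← Real.exp_add]; simp
    rw [this, Matrix.diagonal_one, Matrix.one_mul, hk0]
  have hMM : Mᴴ * M = kᴴ * Matrix.diagonal (fun t => ((Real.exp (lam0 t) : ℝ) : ℂ)) * k := by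
    rw [hM, Matrix.conjTranspose_mul, Matrix.diagonal_conjTranspose, Matrix.mul_assoc,
      ← Matrix.mul_assoc (Matrix.diagonal _), Matrix.diagonal_mul_diagonal, ← Matrix.mul_assoc]
    congr 3
    ext i
    rw [Pi.star_apply, Complex.star_def, Complex.conj_ofReal, ← Complex.ofReal_mul, ← Real.exp_add,
      add_halves]
  have hMb : ∀ i j, M i j ≠ 0 → blk i = blk j := fun i j h => by
    rw [hM, Matrix.diagonal_mul] at h
    exact hk0b i j (right_ne_zero_of_mul h)
  obtain ⟨p, r, hp, hrp, hpr, -, hMp⟩ := exists_cholesky_gram hM1 fun i j hij => by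
    rw [Matrix.mul_apply] at hij
    obtain ⟨l, -, hl⟩ := Finset.exists_ne_zero_of_sum_ne_zero hij
    rw [Matrix.conjTranspose_apply] at hl
    exact (hMb l i (fun h => hl (by simp [h]))).symm.trans (hMb l j (fun h => hl (by simp [h])))
  obtain ⟨q, r', hq, hrq, hqr, hr1, hgq⟩ := exists_cholesky_gram (M := p * g) (N := f * r)
    (by rw [Matrix.mul_assoc, ← Matrix.mul_assoc r, hrp, Matrix.one_mul, hfg]) fun i j _ => hS i j
  set V := p * g * r' with hV
  have hV1 : Vᴴ * V = 1 := by
    rw [← hr1, hV, Matrix.conjTranspose_mul]; simp only [Matrix.mul_assoc]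
  have hVq : V * q = p * g := by rw [hV, Matrix.mul_assoc, hrq, Matrix.mul_one]
  have hV2 : V * Vᴴ = 1 := by
    have h1 : V * (q * f * r) = 1 := by
      calc V * (q * f * r) = V * q * f * r := by simp only [Matrix.mul_assoc]
        _ = p * (g * f) * r := by rw [hVq]; simp only [Matrix.mul_assoc]
        _ = 1 := by rw [hgf, Matrix.mul_one, hpr]
    calc V * Vᴴ = V * Vᴴ * (V * (q * f * r)) := by rw [h1, Matrix.mul_one]
      _ = V * (Vᴴ * V) * (q * f * r) := by simp only [Matrix.mul_assoc]
      _ = 1 := by rw [hV1, Matrix.mul_one, h1]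
  refine ⟨V, hV1, hV2, fun v hv => ?_⟩
  set n := ∑ i, ‖v i‖ ^ 2 with hn
  set u := Vᴴ *ᵥ v with hu
  set P : ℝ → Matrix T T ℂ := fun s =>
    pᴴ * (1 + (s : ℂ) • Matrix.vecMulVec v (star v)) * p with hP
  have hPq : ∀ s, gᴴ * P s * g = qᴴ * (1 + (s : ℂ) • Matrix.vecMulVec u (star u)) * q := by
    intro s
    have h1 : Matrix.vecMulVec u (star u) = Vᴴ * Matrix.vecMulVec v (star v) * V := by
      rw [hu, Matrix.mul_vecMulVec, Matrix.vecMulVec_mul, Matrix.star_mulVec,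
        Matrix.conjTranspose_conjTranspose]
    calc gᴴ * P s * g = (p * g)ᴴ * (1 + (s : ℂ) • Matrix.vecMulVec v (star v)) * (p * g) := by
          rw [hP, Matrix.conjTranspose_mul]; simp only [Matrix.mul_assoc]
      _ = qᴴ * (Vᴴ * (1 + (s : ℂ) • Matrix.vecMulVec v (star v)) * V) * q := by
          rw [← hVq, Matrix.conjTranspose_mul]; simp only [Matrix.mul_assoc]
      _ = _ := by
          rw [Matrix.mul_add, Matrix.add_mul, Matrix.mul_one, hV1, Matrix.mul_smul, Matrix.smul_mul,
            h1]
  obtain ⟨τ, β, hτ, hβ, hβ', htr⟩ := trace_perturb p v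
  have hdet : ∃ e : ℝ, 0 < e ∧ ∀ s : ℝ, (P s).det.re = e * (1 + s * n) := by
    have hp0 : p.det ≠ 0 := fun h => by
      have := congrArg Matrix.det hrp
      rw [Matrix.det_mul, h, mul_zero, Matrix.det_one] at this
      exact zero_ne_one this
    refine ⟨‖p.det‖ ^ 2, by positivity, fun s => ?_⟩
    rw [hP]
    simp only [Matrix.det_mul, Matrix.det_conjTranspose]
    rw [det_one_add_smul_vecMulVec, mul_right_comm, Complex.star_def, Complex.conj_mul',
      ← Complex.ofReal_pow, ← Complex.ofReal_mul, Complex.ofReal_re]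
  obtain ⟨e, he, hdet⟩ := hdet
  set nn : Finset T ⊕ Finset S → ℝ :=
    Sum.elim (fun D => ∑ i ∈ D, ‖v i‖ ^ 2) (fun D => ∑ j ∈ D, ‖u j‖ ^ 2) with hnn
  have hminor : ∀ a, ∃ K : ℝ, 0 < K ∧ ∀ (s : ℝ) (k : Matrix T T ℂ) (lam : T → ℝ),
      P s = kᴴ * Matrix.diagonal (fun t => ((Real.exp (lam t) : ℝ) : ℂ)) * k →
      Sum.elim c c' a * Real.log (expSum (k * minorFrame g a) lam) =
        Sum.elim c c' a * Real.log (K * (1 + s * nn a)) := by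
    rintro (D | D)
    · by_cases h0 : c D = 0
      · exact ⟨1, one_pos, fun s k lam _ => by simp [h0]⟩
      · obtain ⟨K, hK, hKs⟩ := exists_det_lower_minor hp hrp (hc1 D h0)
        refine ⟨(Fintype.card D).factorial * K, by positivity, fun s k lam h => ?_⟩
        congr 2
        apply Complex.ofReal_injective
        change ((expSum (k * (1 : Matrix T T ℂ).submatrix id (Subtype.val : D → T)) lam : ℝ) : ℂ) = _
        have hnD : nn (Sum.inl D) = ∑ i ∈ D, ‖v i‖ ^ 2 := rfl
        rw [expSum_mul_eq _ h, mul_assoc, Complex.ofReal_mul, hnD, ← hKs v s, Complex.ofReal_natCast]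
        congr 2
        ext i j
        simp [Matrix.mul_apply, Matrix.one_apply, hP]
    · by_cases h0 : c' D = 0
      · exact ⟨1, one_pos, fun s k lam _ => by simp [h0]⟩
      · obtain ⟨K, hK, hKs⟩ := exists_det_lower_minor hq hrq (hc1' D h0)
        refine ⟨(Fintype.card D).factorial * K, by positivity, fun s k lam h => ?_⟩
        congr 2
        apply Complex.ofReal_injective
        change ((expSum (k * g.submatrix id (Subtype.val : D → S)) lam : ℝ) : ℂ) = _
        have hnD : nn (Sum.inr D) = ∑ j ∈ D, ‖u j‖ ^ 2 := rfl
        rw [expSum_mul_eq _ h, mul_assoc, Complex.ofReal_mul, hnD, ← hKs u s, Complex.ofReal_natCast,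
          ← hPq]
        rfl
  choose K hK hKs using hminor
  have hval : ∀ (s : ℝ) (k : Matrix T T ℂ) (lam : T → ℝ), kᴴ * k = 1 →
      P s = kᴴ * Matrix.diagonal (fun t => ((Real.exp (lam t) : ℝ) : ℂ)) * k →
      weightedLog (minorFrame g) (Sum.elim c c') k lam + δ * coerc lam =
        ∑ a, Sum.elim c c' a * Real.log (K a * (1 + s * nn a)) +
          δ * Real.log (τ + s * β + (e * (1 + s * n))⁻¹) := by
    intro s k lam hk1 h
    rw [coerc_eq hk1 h, hdet, htr, weightedLog]
    congr 1
    exact Finset.sum_congr rfl fun a _ => hKs a s k lam h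
  have hmain := abs_sum_le_of_min (c := Sum.elim c c') (nn := nn) hK hδ.le he hτ hβ hβ'
    (by positivity : 0 ≤ n) fun s hs => by
      obtain ⟨t, ht, ht'⟩ := exists_add_sq_eq hs
      obtain ⟨N, hN⟩ := exists_inv_perturb v ht'
      obtain ⟨k', lam', hk'b, hk'1, hk'⟩ := exists_gram_eq_exp blk
        (M := (1 + (t : ℂ) • Matrix.vecMulVec v (star v)) * p) (N := r * N)
        (by rw [Matrix.mul_assoc, ← Matrix.mul_assoc N, hN, Matrix.one_mul, hrp]) fun i j hij => by
          rw [Matrix.mul_apply] at hij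
          obtain ⟨l, -, hl⟩ := Finset.exists_ne_zero_of_sum_ne_zero hij
          rw [← BlockOrder.blk_eq_of_le (hp l j (right_ne_zero_of_mul hl))]
          by_contra hb
          apply left_ne_zero_of_mul hl
          have hil : i ≠ l := fun h => hb (by rw [h])
          rw [Matrix.add_apply, Matrix.one_apply_ne hil, Matrix.smul_apply, Matrix.vecMulVec_apply,
            zero_add, smul_eq_mul, Pi.star_apply]
          by_cases h1 : v i = 0
          · simp [h1]
          · have h2 : v l = 0 := by
              by_contra h2
              exact hb (hv i l h1 h2)
            simp [h2]
      rw [gram_perturb, ht] at hk'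
      have hP0 : P 0 = kᴴ * Matrix.diagonal (fun t => ((Real.exp (lam0 t) : ℝ) : ℂ)) * k := by
        rw [← hMM, hMp, hP]; simp
      rw [← hval 0 k lam0 hk0 hP0, ← hval s k' lam' hk'1 hk']
      exact hmin k' ⟨hk'1, hk'b⟩ lam'
  rw [Fintype.sum_sum_type] at hmain
  simp only [hnn, Sum.elim_inl, Sum.elim_inr] at hmain
  rw [sum_layers_mul hc3, sum_layers_mul hc3'] at hmain
  simpa only [neg_mul, Finset.sum_neg_distrib, ← sub_eq_add_neg] using hmain

end Approx

section Limit

variable {S T : Type} [Fintype S] [Fintype T] [DecidableEq S] [DecidableEq T]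

theorem sum_mul_norm_sq (x : T → ℝ) (v : T → ℂ) :
    ((∑ i, x i * ‖v i‖ ^ 2 : ℝ) : ℂ) =
      star v ⬝ᵥ (Matrix.diagonal (fun i => (x i : ℂ)) *ᵥ v) := by
  rw [dotProduct, Complex.ofReal_sum]
  refine Finset.sum_congr rfl fun i _ => ?_
  rw [Matrix.mulVec_diagonal, Pi.star_apply, Complex.star_def, mul_left_comm, Complex.conj_mul']
  simp

theorem sum_mul_norm_sq_mulVec (x : S → ℝ) (U : Matrix S T ℂ) (v : T → ℂ) :
    ((∑ j, x j * ‖(U *ᵥ v) j‖ ^ 2 : ℝ) : ℂ) =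
      star v ⬝ᵥ ((Uᴴ * Matrix.diagonal (fun i => (x i : ℂ)) * U) *ᵥ v) := by
  rw [sum_mul_norm_sq, Matrix.star_mulVec, ← Matrix.mulVec_mulVec, ← Matrix.mulVec_mulVec,
    Matrix.dotProduct_mulVec (star v), Matrix.dotProduct_mulVec]

theorem star_dotProduct_mulVec_single_add (H : Matrix T T ℂ) (i i' : T) (c : ℂ) :
    star (Pi.single i 1 + c • Pi.single i' 1 : T → ℂ) ⬝ᵥ
        (H *ᵥ (Pi.single i 1 + c • Pi.single i' 1)) =
      H i i + c * H i i' + star c * H i' i + star c * c * H i' i' := by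
  simp only [star_add, star_smul, Pi.star_single, star_one, Matrix.mulVec_add, Matrix.mulVec_smul,
    Matrix.mulVec_single_one, add_dotProduct, dotProduct_add, smul_dotProduct, dotProduct_smul,
    single_one_dotProduct, Matrix.col_apply, smul_eq_mul]
  ring

/-- A matrix whose quadratic form vanishes on block vectors has vanishing block entries. -/
theorem entry_eq_zero_of_quadratic [BlockOrder T] {H : Matrix T T ℂ}
    (h : ∀ v : T → ℂ, (∀ i j, v i ≠ 0 → v j ≠ 0 → blk i = blk j) → star v ⬝ᵥ (H *ᵥ v) = 0)
    {i i' : T} (hb : blk i = blk i') : H i i' = 0 := by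
  have key : ∀ {i i'}, blk i = blk i' → ∀ c : ℂ,
      H i i + c * H i i' + star c * H i' i + star c * c * H i' i' = 0 := by
    intro i i' hb c
    rw [← star_dotProduct_mulVec_single_add]
    refine h _ fun a b ha hb' => ?_
    have hs : ∀ a, (Pi.single i 1 + c • Pi.single i' 1 : T → ℂ) a ≠ 0 → blk a = blk i := by
      intro a ha
      by_cases h1 : a = i
      · rw [h1]
      · by_cases h2 : a = i'
        · rw [h2, hb]
        · exact absurd (by simp [h1, h2]) ha
    rw [hs a ha, hs b hb']
  have hd : ∀ i, H i i = 0 := fun i => by simpa using key (i := i) rfl 0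
  have h1 := key hb 1
  have h2 := key hb Complex.I
  simp only [hd, mul_zero, add_zero, zero_add, star_one, one_mul, Complex.star_def,
    Complex.conj_I] at h1 h2
  have h3 : Complex.I * (H i i' - H i' i) = 0 := by linear_combination h2
  have h4 := (mul_eq_zero.1 h3).resolve_left Complex.I_ne_zero
  linear_combination (h1 + h4) / 2

variable [BlockOrder S] [BlockOrder T]

theorem lru_univ_of_hasSub (hS : ∀ s s' : S, blk s = blk s') {f : Matrix S T ℂ}
    {g : Matrix T S ℂ} (hfg : f * g = 1) (hgf : g * f = 1) {w : T → ℝ} {x : S → ℝ}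
    (hw : Antitone w) (hx : Monotone x) (hsum : ∑ i, w i = ∑ j, x j)
    (hsub : ∀ I' J', I'.card = J'.card → HasSub f Finset.univ Finset.univ I' J' →
      ∑ i ∈ I', w i ≤ ∑ j ∈ J', x j) : LRU Finset.univ Finset.univ w x := by
  choose V hV1 hV2 hV using fun n : ℕ =>
    exists_approx hS hfg hgf hw hx hsum hsub (δ := 1 / ((n : ℝ) + 1)) (by positivity)
  have hKc : IsCompact (Set.univ.pi fun _ => Set.univ.pi fun _ => Metric.closedBall (0:ℂ) 1 :
      Set (S → T → ℂ)) :=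
    isCompact_univ_pi fun _ => isCompact_univ_pi fun _ => isCompact_closedBall _ _
  obtain ⟨u, -, φ, hφ, hu⟩ := hKc.tendsto_subseq (x := fun n => (fun i j => (V n)ᴴ i j : S → T → ℂ))
    (fun n i _ j _ => by
      have : V n * (V n)ᴴ = 1 := hV2 n
      have h1 : (V n)ᴴᴴ * (V n)ᴴ = pr Finset.univ := by
        rw [Matrix.conjTranspose_conjTranspose, pr_univ]; exact this
      simpa using norm_entry_le_one h1 i j)
  set U : Matrix S T ℂ := Matrix.of u with hU
  have hu' : Filter.Tendsto (fun n => (V (φ n))ᴴ) Filter.atTop (nhds U) := hu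
  have h1 : Uᴴ * U = 1 := by
    have hc : Continuous fun M : Matrix S T ℂ => Mᴴ * M := by fun_prop
    refine tendsto_nhds_unique ((hc.tendsto U).comp hu') ?_
    refine tendsto_const_nhds.congr fun n => ?_
    simp [hV2]
  have h2 : U * Uᴴ = 1 := by
    have hc : Continuous fun M : Matrix S T ℂ => M * Mᴴ := by fun_prop
    refine tendsto_nhds_unique ((hc.tendsto U).comp hu') ?_
    refine tendsto_const_nhds.congr fun n => ?_
    simp [hV1]
  have h3 : ∀ v : T → ℂ, (∀ i j, v i ≠ 0 → v j ≠ 0 → blk i = blk j) →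
      ∑ i, w i * ‖v i‖ ^ 2 = ∑ j, x j * ‖(U *ᵥ v) j‖ ^ 2 := by
    intro v hv
    have hc : Continuous fun M : Matrix S T ℂ =>
        |∑ i, w i * ‖v i‖ ^ 2 - ∑ j, x j * ‖(M *ᵥ v) j‖ ^ 2| := by fun_prop
    have hl : Filter.Tendsto (fun n : ℕ => 1 / ((φ n : ℝ) + 1) * ∑ i, ‖v i‖ ^ 2) Filter.atTop
        (nhds (0 * ∑ i, ‖v i‖ ^ 2)) :=
      (tendsto_one_div_add_atTop_nhds_zero_nat.comp hφ.tendsto_atTop).mul_const _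
    have := le_of_tendsto_of_tendsto' ((hc.tendsto U).comp hu') hl fun n => hV (φ n) v hv
    rw [zero_mul] at this
    exact sub_eq_zero.1 (abs_nonpos_iff.1 this)
  refine ⟨U, fun _ _ _ => ⟨Finset.mem_univ _, Finset.mem_univ _⟩, by rw [h1, pr_univ],
    by rw [h2, pr_univ], fun i _ i' _ hb => ?_⟩
  have h4 := entry_eq_zero_of_quadratic (H := Uᴴ * Matrix.diagonal (fun s => (x s : ℂ)) * U -
    Matrix.diagonal (fun i => (w i : ℂ))) (fun v hv => by
      rw [Matrix.sub_mulVec, dotProduct_sub, ← sum_mul_norm_sq_mulVec, ← sum_mul_norm_sq, h3 v hv,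
        sub_self]) hb
  rw [Matrix.sub_apply, sub_eq_zero, Matrix.diagonal_apply] at h4
  convert h4

end Limit

section Subset

instance {T : Type} [BlockOrder T] (I : Finset T) : BlockOrder I where
  toPartialOrder := inferInstance
  blk i := blk (i : T)
  blk_eq_iff a b := BlockOrder.blk_eq_iff (a : T) b

/-- The isometry including the coordinates in `I` into all coordinates. -/
def incl {T : Type} [DecidableEq T] (I : Finset T) : Matrix T I ℂ :=
  (1 : Matrix T T ℂ).submatrix id Subtype.val

variable {S T : Type} [DecidableEq S] [DecidableEq T]

theorem conjTranspose_incl (I : Finset T) :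
    (incl I)ᴴ = (1 : Matrix T T ℂ).submatrix Subtype.val id := by
  rw [incl, Matrix.conjTranspose_submatrix, Matrix.conjTranspose_one]

theorem incl_apply (I : Finset T) (t : T) (i : I) : incl I t i = if t = i then 1 else 0 :=
  Matrix.one_apply

theorem conjTranspose_incl_apply (I : Finset T) (t : T) (i : I) :
    (incl I)ᴴ i t = if (i : T) = t then 1 else 0 := by
  rw [conjTranspose_incl]; exact Matrix.one_apply

theorem incl_mul_mul_apply (I : Finset T) (J : Finset S) (B : Matrix J I ℂ) (j : J) (i : I) :
    (incl J * B * (incl I)ᴴ) j i = B j i := by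
  rw [Matrix.mul_apply, Finset.sum_eq_single i]
  · rw [Matrix.mul_apply, Finset.sum_eq_single j]
    · rw [incl_apply, conjTranspose_incl_apply, if_pos rfl, if_pos rfl, one_mul, mul_one]
    · intro b _ hb
      rw [incl_apply, if_neg (fun h => hb (Subtype.ext h.symm)), zero_mul]
    · simp
  · intro b _ hb
    rw [conjTranspose_incl_apply, if_neg (fun h => hb (Subtype.ext h)), mul_zero]
  · simp

theorem exists_of_incl_mul_mul_ne_zero {I : Finset T} {J : Finset S} {B : Matrix J I ℂ} {s : S}
    {t : T} (h : (incl J * B * (incl I)ᴴ) s t ≠ 0) :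
    ∃ (j : J) (i : I), s = j ∧ t = i ∧ B j i ≠ 0 := by
  rw [Matrix.mul_apply] at h
  obtain ⟨i, -, hi⟩ := Finset.exists_ne_zero_of_sum_ne_zero h
  have h1 := left_ne_zero_of_mul hi
  rw [Matrix.mul_apply] at h1
  obtain ⟨j, -, hj⟩ := Finset.exists_ne_zero_of_sum_ne_zero h1
  refine ⟨j, i, ?_, ?_, right_ne_zero_of_mul hj⟩
  · by_contra hne
    exact hj (by rw [incl_apply, if_neg hne, zero_mul])
  · by_contra hne
    exact hi (by rw [conjTranspose_incl_apply, if_neg (Ne.symm hne), mul_zero])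

theorem incl_conjTranspose_mul [Fintype T] (I : Finset T) : (incl I)ᴴ * incl I = 1 := by
  ext a b
  rw [Matrix.mul_apply, Finset.sum_eq_single (b : T)]
  · rw [conjTranspose_incl_apply, incl_apply, if_pos rfl, mul_one, Matrix.one_apply]
    simp only [Subtype.ext_iff]
  · intro t _ ht
    rw [incl_apply, if_neg ht, mul_zero]
  · simp

theorem incl_mul_conjTranspose (I : Finset T) : incl I * (incl I)ᴴ = pr I := by
  ext a b
  rw [pr_apply]
  rw [Matrix.mul_apply]
  by_cases ha : a ∈ I
  · rw [Finset.sum_eq_single ⟨a, ha⟩]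
    · rw [incl_apply, conjTranspose_incl_apply, if_pos rfl, one_mul]
      simp [ha]
    · intro i _ hi
      rw [incl_apply, if_neg (fun h => hi (Subtype.ext h.symm)), zero_mul]
    · simp
  · rw [if_neg (fun h => ha h.2)]
    refine Finset.sum_eq_zero fun i _ => ?_
    rw [incl_apply, if_neg (fun h : a = i => ha (h ▸ i.2)), zero_mul]

theorem incl_diagonal [Fintype T] (I : Finset T) (x : T → ℂ) :
    (incl I)ᴴ * Matrix.diagonal x * incl I = Matrix.diagonal fun i : I => x i := by
  ext a b
  rw [Matrix.mul_apply, Finset.sum_eq_single (b : T)]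
  · rw [Matrix.mul_diagonal, conjTranspose_incl_apply, incl_apply, Matrix.diagonal_apply, if_pos rfl,
      mul_one]
    by_cases h : a = b
    · simp [h]
    · rw [if_neg (fun h' => h (Subtype.ext h')), if_neg h, zero_mul]
  · intro t _ ht
    rw [incl_apply, if_neg ht, mul_zero]
  · simp

theorem supp_incl_mul_mul {I : Finset T} {J : Finset S} {B : Matrix J I ℂ} {I₁ : Finset I}
    {J₁ : Finset J} (h : Supp B J₁ I₁) :
    Supp (incl J * B * (incl I)ᴴ) (J₁.map ⟨_, Subtype.val_injective⟩)
      (I₁.map ⟨_, Subtype.val_injective⟩) := by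
  intro s t hst
  obtain ⟨j, i, rfl, rfl, hB⟩ := exists_of_incl_mul_mul_ne_zero hst
  exact ⟨Finset.mem_map_of_mem _ (h j i hB).1, Finset.mem_map_of_mem _ (h j i hB).2⟩

theorem isEch_incl [PartialOrder T] {I : Finset T} {I₁ : Finset I} {C : Matrix I I ℂ}
    (h : IsEch C Finset.univ I₁) :
    IsEch (incl I * C * (incl I)ᴴ) I (I₁.map ⟨_, Subtype.val_injective⟩) where
  supp s t hst := by
    obtain ⟨j, i, rfl, rfl, hB⟩ := exists_of_incl_mul_mul_ne_zero hst
    exact ⟨j.2, Finset.mem_map_of_mem _ (h.supp j i hB).2⟩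
  up s t hst := by
    obtain ⟨j, i, rfl, rfl, hB⟩ := exists_of_incl_mul_mul_ne_zero hst
    exact h.up j i hB
  diag a ha := by
    obtain ⟨i, hi, rfl⟩ := Finset.mem_map.1 ha
    exact (incl_mul_mul_apply I I C i i).trans_ne (h.diag i hi)

variable [Fintype S] [Fintype T]

theorem HasSub.of_subtype [PartialOrder S] [PartialOrder T] {I : Finset T} {J : Finset S}
    {f : Matrix S T ℂ} {I₁ : Finset I} {J₁ : Finset J}
    (h : HasSub ((incl J)ᴴ * f * incl I) Finset.univ Finset.univ I₁ J₁) :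
    HasSub (mask J I f) I J (I₁.map ⟨_, Subtype.val_injective⟩)
      (J₁.map ⟨_, Subtype.val_injective⟩) := by
  obtain ⟨C, C', B, hC, hC', hB, h⟩ := h
  refine ⟨_, _, _, isEch_incl hC, isEch_incl hC',
    supp_incl_mul_mul hB, ?_⟩
  rw [mask, ← incl_mul_conjTranspose, ← incl_mul_conjTranspose]
  calc _ = incl J * ((incl J)ᴴ * f * incl I * ((incl I)ᴴ * incl I) * C) * (incl I)ᴴ := by
        simp only [Matrix.mul_assoc]
    _ = incl J * (C' * ((incl J)ᴴ * incl J) * B) * (incl I)ᴴ := by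
        rw [incl_conjTranspose_mul, incl_conjTranspose_mul, Matrix.mul_one, Matrix.mul_one, h]
    _ = _ := by simp only [Matrix.mul_assoc]

theorem LRU.of_subtype [BlockOrder S] [BlockOrder T] {I : Finset T} {J : Finset S} {w : T → ℝ}
    {x : S → ℝ} (h : LRU (Finset.univ : Finset I) (Finset.univ : Finset J) (fun i => w i)
      (fun j => x j)) : LRU I J w x := by
  obtain ⟨U, -, h1, h2, h3⟩ := h
  rw [pr_univ] at h1 h2
  have hU : (incl J * U * (incl I)ᴴ)ᴴ = incl I * Uᴴ * (incl J)ᴴ := by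
    simp only [Matrix.conjTranspose_mul, Matrix.conjTranspose_conjTranspose, Matrix.mul_assoc]
  refine ⟨incl J * U * (incl I)ᴴ, ?_, ?_, ?_, ?_⟩
  · intro s t hst
    obtain ⟨j, i, rfl, rfl, -⟩ := exists_of_incl_mul_mul_ne_zero hst
    exact ⟨j.2, i.2⟩
  · calc _ = incl I * (Uᴴ * ((incl J)ᴴ * incl J) * U) * (incl I)ᴴ := by
          rw [hU]; simp only [Matrix.mul_assoc]
      _ = _ := by
          rw [incl_conjTranspose_mul, Matrix.mul_one, h1, Matrix.mul_one, incl_mul_conjTranspose]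
  · calc _ = incl J * (U * ((incl I)ᴴ * incl I) * Uᴴ) * (incl J)ᴴ := by
          rw [hU]; simp only [Matrix.mul_assoc]
      _ = _ := by
          rw [incl_conjTranspose_mul, Matrix.mul_one, h2, Matrix.mul_one, incl_mul_conjTranspose]
  · intro i hi i' hi' hb
    have : (incl J * U * (incl I)ᴴ)ᴴ * Matrix.diagonal (fun s => (x s : ℂ)) *
        (incl J * U * (incl I)ᴴ) =
        incl I * (Uᴴ * Matrix.diagonal (fun s : J => (x s : ℂ)) * U) * (incl I)ᴴ := by
      rw [← incl_diagonal J (fun s => (x s : ℂ)), hU]; simp only [Matrix.mul_assoc]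
    have h4 := (congrFun (congrFun this i) i').trans
      (incl_mul_mul_apply I I _ ⟨i, hi⟩ ⟨i', hi'⟩)
    have h5 := h3 ⟨i, hi⟩ (Finset.mem_univ _) ⟨i', hi'⟩ (Finset.mem_univ _) hb
    simp only [Subtype.mk.injEq] at h5
    convert h4.trans (Eq.trans ?_ h5)
    congr!

/-- If all subrepresentations of an invertible filtered map satisfy the slope inequality then
the moment map equation can be solved. -/
theorem lru_of_hasSub [BlockOrder S] [BlockOrder T] (hS : ∀ s s' : S, blk s = blk s')
    {I : Finset T} {J : Finset S} {f : Matrix S T ℂ} {F : Matrix T S ℂ}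
    (hfF : mask J I f * F = pr J) (hFf : F * mask J I f = pr I) {w : T → ℝ} {x : S → ℝ}
    (hw : Antitone w) (hx : Monotone x) (hsum : ∑ i ∈ I, w i = ∑ j ∈ J, x j)
    (hsub : ∀ I' J', I'.card = J'.card → HasSub (mask J I f) I J I' J' →
      ∑ i ∈ I', w i ≤ ∑ j ∈ J', x j) : LRU I J w x := by
  apply LRU.of_subtype
  refine lru_univ_of_hasSub (S := J) (T := I) (fun s s' => hS s s') (f := (incl J)ᴴ * f * incl I)
    (g := (incl I)ᴴ * F * incl J) ?_ ?_ (fun a b hab => hw hab) (fun a b hab => hx hab) ?_ ?_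
  · calc _ = (incl J)ᴴ * incl J * ((incl J)ᴴ * f * (incl I * (incl I)ᴴ) * F * incl J) := by
          rw [incl_conjTranspose_mul, Matrix.one_mul]; simp only [Matrix.mul_assoc]
      _ = (incl J)ᴴ * (incl J * (incl J)ᴴ * f * (incl I * (incl I)ᴴ) * F) * incl J := by
          simp only [Matrix.mul_assoc]
      _ = (incl J)ᴴ * incl J * ((incl J)ᴴ * incl J) := by
          rw [incl_mul_conjTranspose, incl_mul_conjTranspose]
          change (incl J)ᴴ * (mask J I f * F) * incl J = _
          rw [hfF, ← incl_mul_conjTranspose]; simp only [Matrix.mul_assoc]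
      _ = 1 := by rw [incl_conjTranspose_mul, Matrix.one_mul]
  · calc _ = (incl I)ᴴ * F * (incl J * (incl J)ᴴ) * f * incl I * ((incl I)ᴴ * incl I) := by
          rw [incl_conjTranspose_mul, Matrix.mul_one]; simp only [Matrix.mul_assoc]
      _ = (incl I)ᴴ * (F * (incl J * (incl J)ᴴ * f * (incl I * (incl I)ᴴ))) * incl I := by
          simp only [Matrix.mul_assoc]
      _ = (incl I)ᴴ * incl I * ((incl I)ᴴ * incl I) := by
          rw [incl_mul_conjTranspose, incl_mul_conjTranspose]
          change (incl I)ᴴ * (F * mask J I f) * incl I = _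
          rw [hFf, ← incl_mul_conjTranspose]; simp only [Matrix.mul_assoc]
      _ = 1 := by rw [incl_conjTranspose_mul, Matrix.one_mul]
  · rw [Finset.sum_coe_sort, Finset.sum_coe_sort J, hsum]
  · intro I₁ J₁ hc h
    simpa using hsub _ _ (by simpa using hc) h.of_subtype

end Subset

section Necessity

variable {S T : Type}

open scoped Classical in
/-- The weight on `T` attached to the complementary index set `K`. -/
noncomputable def subWeight [PartialOrder T] (K : Finset T) (i : T) : ℝ :=
  -((K.filter (· ≤ i)).card : ℝ)

open scoped Classical in
/-- The weight on `S` attached to the complementary index set `L`. -/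
noncomputable def quotWeight [PartialOrder S] (L : Finset S) (j : S) : ℝ :=
  ((L.filter (· ≤ j)).card : ℝ) - L.card

theorem antitone_subWeight [PartialOrder T] (K : Finset T) : Antitone (subWeight K) := by
  classical
  intro a b hab
  refine neg_le_neg (Nat.cast_le.2 (Finset.card_le_card fun k hk => ?_))
  rw [Finset.mem_filter] at hk ⊢
  exact ⟨hk.1, hk.2.trans hab⟩

theorem monotone_quotWeight [PartialOrder S] (L : Finset S) : Monotone (quotWeight L) := by
  classical
  intro a b hab
  refine sub_le_sub_right (Nat.cast_le.2 (Finset.card_le_card fun k hk => ?_)) _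
  rw [Finset.mem_filter] at hk ⊢
  exact ⟨hk.1, hk.2.trans hab⟩

theorem card_filPos [PartialOrder T] [DecidableLE T] (K I : Finset T) :
    (filPos K I).card = ∑ i ∈ I, (K.filter (· ≤ i)).card := by
  classical
  rw [filPos, Finset.card_filter, Finset.sum_product_right]
  refine Finset.sum_congr rfl fun i _ => ?_
  rw [Finset.card_filter]
  congr!

theorem pairing_eq_sum [PartialOrder S] [PartialOrder T] {I : Finset T} {J : Finset S}
    (h : I.card = J.card) (K : Finset T) (L : Finset S) :
    (pairing I J K L : ℝ) = ∑ j ∈ J, quotWeight L j - ∑ i ∈ I, subWeight K i := by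
  classical
  simp only [pairing, card_filPos, subWeight, quotWeight, Finset.sum_sub_distrib,
    Finset.sum_neg_distrib, Finset.sum_const, nsmul_eq_mul, h]
  push_cast
  ring

variable [Fintype S] [Fintype T] [BlockOrder S] [BlockOrder T]

theorem LRU.card_eq {I : Finset T} {J : Finset S} {w : T → ℝ} {x : S → ℝ} (h : LRU I J w x) :
    I.card = J.card := by
  obtain ⟨U, -, h1, h2, -⟩ := h
  have h3 := Matrix.trace_mul_comm Uᴴ U
  rw [h1, h2, trace_pr, trace_pr] at h3
  exact_mod_cast h3

/-- The weights of a subrepresentation type for which the moment map equation is solvable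
satisfy the slope inequalities for generic subrepresentations. -/
theorem LRU.gen_subNonneg {I : Finset T} {J : Finset S} {K : Finset T} {L : Finset S}
    (h : LRU I J (subWeight K) (quotWeight L)) :
    Gen (subNonneg I J K L : Set (Matrix S T ℂ)) := by
  classical
  have : Gen {f : Matrix S T ℂ | ∀ p : Finset T × Finset S, f ∈ {f : Matrix S T ℂ |
      p.1.card = p.2.card → HasSub (mask J I f) I J p.1 p.2 → 0 ≤ pairing p.1 p.2 K L}} := by
    refine Gen.iInter fun p => ?_
    rcases dom_or_gen_not (I := I) (J := J) (I' := p.1) (J' := p.2) with hd | hn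
    · refine gen_univ.mono fun f _ hc _ => ?_
      have h1 := h.sum_le_sum hd.1 hc (antitone_subWeight K) (monotone_quotWeight L)
      have h2 := pairing_eq_sum hc K L
      exact_mod_cast (h2 ▸ sub_nonneg.2 h1 : (0 : ℝ) ≤ pairing p.1 p.2 K L)
    · exact hn.mono fun f hf _ h => absurd h hf
  refine this.mono fun f hf I' J' hc => ?_
  exact hf (I', J') hc

theorem LRU.sum_le_sum_of_lru [DecidableEq S] [DecidableEq T] {I I' : Finset T}
    {J J' : Finset S} {w : T → ℝ} {x : S → ℝ} (h : LRU I J w x) (hw : Antitone w)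
    (hx : Monotone x) (hI : I' ⊆ I) (hJ : J' ⊆ J)
    (h' : LRU I' J' (subWeight (I \ I')) (quotWeight (J \ J'))) :
    ∑ i ∈ I', w i ≤ ∑ j ∈ J', x j := by
  have hKL : (I \ I').card = (J \ J').card := by
    rw [Finset.card_sdiff_of_subset hI, Finset.card_sdiff_of_subset hJ, h.card_eq, h'.card_eq]
  obtain ⟨f, g, hfg⟩ := exists_dMap_surjective hKL I'.card I' J' rfl h'.card_eq.symm h'.gen_subNonneg
  exact h.sum_le_sum (dom_of_dMap hI hJ hfg) h'.card_eq hw hx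

end Necessity

section Image

variable {T : Type} [Fintype T] [DecidableEq T] [PartialOrder T]
variable {I I₀ K I₂ : Finset T} {φ C₀ C₂ : Matrix T T ℂ}

theorem card_inter_le_of_kernel (hφ : IsUp φ) (hC₀ : IsEch C₀ I I₀)
    (hker : ∀ v ∈ coord I, φ *ᵥ v = 0 → v ∈ LinearMap.range C₀.mulVecLin)
    (hC₂ : IsEch C₂ K I₂) (hr : LinearMap.range C₂.mulVecLin = LinearMap.range φ.mulVecLin)
    {D : Finset T} (hD : IsLowerSet (D : Set T)) :
    (I ∩ D).card ≤ (I₀ ∩ D).card + (I₂ ∩ D).card := by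
  have h := (φ.mulVecLin.domRestrict (coord (I ∩ D))).finrank_range_add_finrank_ker
  rw [finrank_coord] at h
  rw [← h, ← hC₀.finrank_inf_coord hD, ← hC₂.finrank_inf_coord hD, add_comm]
  refine add_le_add ?_ ?_
  · rw [← Submodule.finrank_map_subtype_eq]
    apply Submodule.finrank_mono
    rintro _ ⟨v, hv, rfl⟩
    have h1 : v.1 ∈ coord I ⊓ coord D := by rw [coord_inf]; exact v.2
    exact ⟨hker _ h1.1 hv, h1.2⟩
  · apply Submodule.finrank_mono
    rintro _ ⟨v, rfl⟩
    have hv : v.1 ∈ coord I ⊓ coord D := by rw [coord_inf]; exact v.2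
    exact ⟨hr ▸ ⟨v.1, rfl⟩, hφ.mulVec_mem hD hv.2⟩

theorem card_eq_of_kernel (hφ : Supp φ K I) (hφu : IsUp φ) (hC₀ : IsEch C₀ I I₀) (h0 : φ * C₀ = 0)
    (hker : ∀ v ∈ coord I, φ *ᵥ v = 0 → v ∈ LinearMap.range C₀.mulVecLin)
    (hC₂ : IsEch C₂ K I₂) (hr : LinearMap.range C₂.mulVecLin = LinearMap.range φ.mulVecLin) :
    I.card = I₀.card + I₂.card := by
  refine le_antisymm ?_ ?_
  · have := card_inter_le_of_kernel hφu hC₀ hker hC₂ hr (D := Finset.univ) (by simp [isLowerSet_univ])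
    simpa using this
  · have h := (φ.mulVecLin.domRestrict (coord I)).finrank_range_add_finrank_ker
    rw [finrank_coord] at h
    rw [← h, ← hC₀.finrank_range, ← hC₂.finrank_range, add_comm]
    refine add_le_add ?_ ?_
    · apply Submodule.finrank_mono
      rw [hr]
      rintro _ ⟨v, rfl⟩
      refine ⟨⟨pr I *ᵥ v, pr_mulVec_mem _ _⟩, ?_⟩
      simp only [LinearMap.domRestrict_apply, Matrix.mulVecLin_apply, Matrix.mulVec_mulVec]
      rw [hφ.mul_pr subset_rfl]
    · rw [← Submodule.finrank_map_subtype_eq (coord I) (LinearMap.ker _)]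
      apply Submodule.finrank_mono
      rintro _ ⟨v, rfl⟩
      refine ⟨⟨C₀ *ᵥ v, hC₀.supp.mulVec_mem _⟩, ?_, rfl⟩
      simp only [LinearMap.domRestrict_apply, Matrix.mulVecLin_apply, LinearMap.mem_ker,
        Matrix.mulVec_mulVec, SetLike.mem_coe]
      rw [h0, Matrix.zero_mulVec]

/-- Subadditivity of antitone weights along the kernel and the image of a filtered matrix. -/
theorem sum_le_of_kernel {w : T → ℝ} (hw : Antitone w) (hφ : Supp φ K I) (hφu : IsUp φ)
    (hC₀ : IsEch C₀ I I₀) (h0 : φ * C₀ = 0)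
    (hker : ∀ v ∈ coord I, φ *ᵥ v = 0 → v ∈ LinearMap.range C₀.mulVecLin)
    (hC₂ : IsEch C₂ K I₂) (hr : LinearMap.range C₂.mulVecLin = LinearMap.range φ.mulVecLin) :
    ∑ i ∈ I, w i ≤ ∑ i ∈ I₀, w i + ∑ i ∈ I₂, w i := by
  obtain ⟨c, hc1, hc2, hc3⟩ := exists_layers hw
  simp only [sum_eq_sum_layers hc3]
  rw [← Finset.sum_add_distrib]
  refine Finset.sum_le_sum fun D _ => ?_
  by_cases hD : D = Finset.univ
  · subst hD
    simp [card_eq_of_kernel hφ hφu hC₀ h0 hker hC₂ hr, mul_add]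
  · by_cases hcD : c D = 0
    · simp [hcD]
    · rw [← mul_add]
      refine mul_le_mul_of_nonneg_left ?_ (hc2 D hD)
      exact_mod_cast card_inter_le_of_kernel hφu hC₀ hker hC₂ hr (hc1 D hcD)

end Image

theorem IsEch.pr_add {T : Type} [Fintype T] [DecidableEq T] [PartialOrder T]
    {I I₁ I₂ : Finset T} {C : Matrix T T ℂ} (hC : IsEch C (I \ I₁) I₂) (hI : I₁ ⊆ I) :
    IsEch (pr I₁ + C) I (I₁ ∪ I₂) := by
  have hd : ∀ a ∈ I₂, a ∉ I₁ := fun a ha => (Finset.mem_sdiff.1 (hC.subset ha)).2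
  refine ⟨((supp_pr I₁).mono hI Finset.subset_union_left).add
    (hC.supp.mono Finset.sdiff_subset Finset.subset_union_right), (isUp_pr _).add hC.up, ?_⟩
  intro a ha
  rw [Matrix.add_apply]
  rcases Finset.mem_union.1 ha with h | h
  · have : C a a = 0 := by
      by_contra h0
      exact (Finset.mem_sdiff.1 (hC.supp a a h0).1).2 h
    simp [this, pr_apply, h]
  · have := hC.diag a h
    simpa [pr_apply, hd a h] using this

section Maximal

variable {S T : Type} [Fintype S] [Fintype T] [DecidableEq S] [DecidableEq T] [BlockOrder S]
  [BlockOrder T]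

/-- A filtered homomorphism from a maximally destabilizing coordinate subrepresentation to the
quotient vanishes. -/
theorem eq_zero_of_maximal {I : Finset T} {J : Finset S} {h : Matrix S T ℂ}
    {w : T → ℝ} {x : S → ℝ} (hw : Antitone w) (hx : Monotone x)
    {I₁ : Finset T} {J₁ : Finset S} (hI : I₁ ⊆ I) (hJ : J₁ ⊆ J)
    {B : Matrix S T ℂ} {F₁ : Matrix T S ℂ} (hB : Supp B J₁ I₁) (hhB : h * pr I₁ = B)
    (hF : Supp F₁ I₁ J₁) (hBF : B * F₁ = pr J₁) (hFB : F₁ * B = pr I₁)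
    {g : Matrix S T ℂ} {G : Matrix T S ℂ}
    (hsupp : Supp h J I)
    (hg : g = pr (J \ J₁) * h * pr (I \ I₁)) (hGg : G * g = pr (I \ I₁))
    (hmax : ∀ I' J', I'.card = J'.card → HasSub h I J I' J' →
      ∑ i ∈ I', w i - ∑ j ∈ J', x j ≤ ∑ i ∈ I₁, w i - ∑ j ∈ J₁, x j ∧
      (∑ i ∈ I', w i - ∑ j ∈ J', x j = ∑ i ∈ I₁, w i - ∑ j ∈ J₁, x j → I'.card ≤ I₁.card))
    (hcard : I₁.card = J₁.card)
    {φ : Matrix T T ℂ} {ψ : Matrix S S ℂ} (hφ : Supp φ (I \ I₁) I₁) (hφu : IsUp φ)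
    (hψ : Supp ψ (J \ J₁) J₁) (hψu : IsUp ψ) (hk : g * φ = ψ * B) : φ = 0 ∧ ψ = 0 := by
  suffices h0 : φ = 0 by
    refine ⟨h0, ?_⟩
    rw [← hψ.mul_pr subset_rfl, ← hBF, ← Matrix.mul_assoc, ← hk, h0, Matrix.mul_zero,
      Matrix.zero_mul]
  obtain ⟨I₀, J₀, C₀, C₀', B₀, hC₀, hC₀', hB₀, hBC₀, hc₀, hφ0, hψ0, hker⟩ :=
    exists_kernel_sub hB hF hBF hFB hGg hφ hφu hψ hψu hk
  have hker' : ∀ v ∈ coord J₁, ψ *ᵥ v = 0 → v ∈ LinearMap.range C₀'.mulVecLin := by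
    intro v hv hv0
    have h1 : φ *ᵥ (F₁ *ᵥ v) = 0 := by
      have : φ = G * (ψ * B) := by
        rw [← hk, ← Matrix.mul_assoc, hGg, hφ.pr_mul subset_rfl]
      rw [this, Matrix.mulVec_mulVec, Matrix.mul_assoc, Matrix.mul_assoc, hBF, hψ.mul_pr subset_rfl,
        ← Matrix.mulVec_mulVec, hv0, Matrix.mulVec_zero]
    obtain ⟨u, hu⟩ := hker _ (hF.mulVec_mem v) h1
    rw [Matrix.mulVecLin_apply] at hu
    refine ⟨B₀ *ᵥ u, ?_⟩
    rw [Matrix.mulVecLin_apply, Matrix.mulVec_mulVec, ← hBC₀, ← Matrix.mulVec_mulVec, hu,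
      Matrix.mulVec_mulVec, hBF, pr_mulVec hv]
  obtain ⟨I₂, C₂, hC₂, hr⟩ := hφu.graded_range.exists_echelon
    (I := I \ I₁) (by rintro _ ⟨v, rfl⟩; exact hφ.mulVec_mem v)
  obtain ⟨J₂, C₂', hC₂', hr'⟩ := hψu.graded_range.exists_echelon
    (I := J \ J₁) (by rintro _ ⟨v, rfl⟩; exact hψ.mulVec_mem v)
  have e1 := card_eq_of_kernel hφ hφu hC₀ hφ0 hker hC₂ hr
  have e2 := card_eq_of_kernel hψ hψu hC₀' hψ0 hker' hC₂' hr'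
  have hgs : Supp g (J \ J₁) (I \ I₁) := by rw [hg]; exact supp_mask _ _ _
  obtain ⟨B₂, hB₂, hgC₂⟩ := hC₂'.exists_factor (M := g * C₂) (hgs.mul hC₂.supp) (fun v => by
    have : C₂ *ᵥ v ∈ LinearMap.range φ.mulVecLin := hr ▸ ⟨v, rfl⟩
    obtain ⟨u, hu⟩ := this
    rw [Matrix.mulVecLin_apply] at hu
    rw [hr', ← Matrix.mulVec_mulVec, ← hu, Matrix.mulVec_mulVec, hk, ← Matrix.mulVec_mulVec]
    exact ⟨_, rfl⟩)
  have i1 := sum_le_of_kernel hw hφ hφu hC₀ hφ0 hker hC₂ hr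
  have i2 := sum_le_of_kernel (w := fun j => -x j) (fun a b hab => neg_le_neg (hx hab)) hψ hψu hC₀'
    hψ0 hker' hC₂' hr'
  simp only [Finset.sum_neg_distrib] at i2
  have m0 := (hmax I₀ J₀ hc₀ ⟨C₀, C₀', B₀, ⟨hC₀.supp.mono hI subset_rfl, hC₀.up, hC₀.diag⟩,
    ⟨hC₀'.supp.mono hJ subset_rfl, hC₀'.up, hC₀'.diag⟩, hB₀, by
      rw [← hBC₀, ← hhB, Matrix.mul_assoc, hC₀.supp.pr_mul subset_rfl]⟩).1
  have d1 : Disjoint I₁ I₂ := Finset.disjoint_left.2 fun a ha ha2 =>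
    (Finset.mem_sdiff.1 (hC₂.subset ha2)).2 ha
  have d2 : Disjoint J₁ J₂ := Finset.disjoint_left.2 fun a ha ha2 =>
    (Finset.mem_sdiff.1 (hC₂'.subset ha2)).2 ha
  have hsub : HasSub h I J (I₁ ∪ I₂) (J₁ ∪ J₂) := by
    refine ⟨pr I₁ + C₂, pr J₁ + C₂', B + pr J₁ * h * C₂ + B₂, ?_, ?_, ?_, ?_⟩
    · exact hC₂.pr_add hI
    · exact hC₂'.pr_add hJ
    · exact ((hB.mono Finset.subset_union_left Finset.subset_union_left).add
        (((supp_pr J₁).mul (hsupp.mul (hC₂.supp.mono Finset.sdiff_subset subset_rfl)) |>.mono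
          Finset.subset_union_left Finset.subset_union_right) |> fun h => by
            rwa [← Matrix.mul_assoc] at h)).add
        (hB₂.mono Finset.subset_union_right Finset.subset_union_right)
    · have z1 : pr J₁ * B₂ = 0 := supp_mul_eq_zero (supp_pr J₁) hB₂ d2
      have z2 : C₂' * B = 0 := supp_mul_eq_zero hC₂'.supp hB d2.symm
      have z3 : C₂' * pr J₁ = 0 := supp_mul_eq_zero hC₂'.supp (supp_pr J₁) d2.symm
      have z4 : C₂' * (pr J₁ * h * C₂) = 0 := by
        rw [← Matrix.mul_assoc, ← Matrix.mul_assoc, z3, Matrix.zero_mul, Matrix.zero_mul]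
      have z5 : C₂' * B₂ = pr (J \ J₁) * (h * C₂) := by
        rw [← hgC₂, hg, Matrix.mul_assoc, Matrix.mul_assoc, hC₂.supp.pr_mul subset_rfl]
      have z6 : pr J₁ * B = B := hB.pr_mul subset_rfl
      have z7 : pr J₁ * (pr J₁ * h * C₂) = pr J₁ * (h * C₂) := by
        rw [← Matrix.mul_assoc, ← Matrix.mul_assoc, pr_mul_self, Matrix.mul_assoc]
      have z8 : h * C₂ = pr J₁ * (h * C₂) + pr (J \ J₁) * (h * C₂) := by
        rw [← Matrix.add_mul, pr_add_pr_sdiff hJ, ← Matrix.mul_assoc, hsupp.pr_mul subset_rfl]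
      rw [Matrix.mul_add, hhB, Matrix.add_mul, Matrix.mul_add, Matrix.mul_add, Matrix.mul_add,
        Matrix.mul_add, z1, z2, z4, z5, z6, z7]
      nth_rewrite 1 [z8]
      abel
  have m2 := hmax _ _ (by
    rw [Finset.card_union_of_disjoint d1, Finset.card_union_of_disjoint d2]; omega) hsub
  rw [Finset.sum_union d1, Finset.sum_union d2, Finset.card_union_of_disjoint d1] at m2
  have hI2 : I₂ = ∅ := by
    have := m2.2 (by linarith [m2.1])
    exact Finset.card_eq_zero.1 (by omega)
  have hC0 : C₂ = 0 := by
    ext i j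
    by_contra hij
    have := (hC₂.supp i j hij).2
    rw [hI2] at this
    exact absurd this (Finset.notMem_empty _)
  refine Matrix.ext_of_mulVec_single fun i => ?_
  have : φ *ᵥ Pi.single i 1 ∈ LinearMap.range C₂.mulVecLin := hr ▸ ⟨_, rfl⟩
  obtain ⟨u, hu⟩ := this
  rw [← hu, hC0, Matrix.mulVecLin_apply, Matrix.zero_mulVec, Matrix.zero_mulVec]

end Maximal

section Sufficiency

variable {S T : Type} [Fintype S] [Fintype T]

theorem mul_eq_pr_of_card_eq {I : Finset T} {J : Finset S} {A : Matrix S T ℂ} {F : Matrix T S ℂ}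
    (hA : Supp A J I) (hF : Supp F I J) (h : F * A = pr I) (hc : I.card = J.card) :
    A * F = pr J := by
  classical
  have h1 : LinearMap.range A.mulVecLin = coord J := by
    refine Submodule.eq_of_le_of_finrank_le ?_ ?_
    · rintro _ ⟨v, rfl⟩; exact hA.mulVec_mem v
    · rw [finrank_coord, ← hc, ← finrank_coord I]
      refine le_trans (Submodule.finrank_mono (t := (LinearMap.range A.mulVecLin).map F.mulVecLin)
        fun v hv => ?_) (Submodule.finrank_map_le _ _)
      exact ⟨A *ᵥ v, ⟨v, rfl⟩, by
        rw [Matrix.mulVecLin_apply, Matrix.mulVec_mulVec, h, pr_mulVec hv]⟩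
  refine Matrix.ext_of_mulVec_single fun i => ?_
  obtain ⟨u, hu⟩ : pr J *ᵥ Pi.single i 1 ∈ LinearMap.range A.mulVecLin :=
    h1 ▸ pr_mulVec_mem _ _
  rw [← hu, ← hF.mul_pr subset_rfl, ← Matrix.mul_assoc, ← Matrix.mulVec_mulVec, ← hu,
    Matrix.mulVecLin_apply, Matrix.mulVec_mulVec, Matrix.mul_assoc, h, hA.mul_pr subset_rfl]

variable [BlockOrder S] [BlockOrder T]

/-- After a filtered change of basis a subrepresentation becomes a coordinate one. -/
theorem HasSub.exists_coordinate {I I₁ : Finset T} {J J₁ : Finset S} {f : Matrix S T ℂ}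
    {F : Matrix T S ℂ} (hf : Supp f J I) (hF : Supp F I J) (hfF : f * F = pr J)
    (hFf : F * f = pr I) (hs : HasSub f I J I₁ J₁) :
    ∃ (h B : Matrix S T ℂ) (F' : Matrix T S ℂ), Supp h J I ∧ Supp F' I J ∧ h * F' = pr J ∧
      F' * h = pr I ∧ Supp B J₁ I₁ ∧ h * pr I₁ = B ∧
      ∀ I' J', HasSub h I J I' J' → HasSub f I J I' J' := by
  obtain ⟨C, C', B, hC, hC', hB, hfC⟩ := hs
  obtain ⟨E, D, hE, hD, hED, hDE, hE1, hD1⟩ := hC.exists_completion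
  obtain ⟨E', D', hE', hD', hED', hDE', hE1', hD1'⟩ := hC'.exists_completion
  refine ⟨D' * f * E, B, D * F * E', (hD'.supp.mul hf).mul hE.supp, (hD.supp.mul hF).mul hE'.supp,
    ?_, ?_, hB, ?_, ?_⟩
  · calc D' * f * E * (D * F * E') = D' * (f * (E * D) * F) * E' := by
          simp only [Matrix.mul_assoc]
      _ = pr J := by rw [hED, hf.mul_pr subset_rfl, hfF, hD'.supp.mul_pr subset_rfl, hDE']
  · calc D * F * E' * (D' * f * E) = D * (F * (E' * D') * f) * E := by
          simp only [Matrix.mul_assoc]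
      _ = pr I := by rw [hED', hF.mul_pr subset_rfl, hFf, hD.supp.mul_pr subset_rfl, hDE]
  · rw [Matrix.mul_assoc, hE1, Matrix.mul_assoc, hfC, ← Matrix.mul_assoc, hD1',
      hB.pr_mul subset_rfl]
  · rintro I' J' ⟨C₁, C₁', B₁, hC₁, hC₁', hB₁, h1⟩
    refine ⟨E * C₁, E' * C₁', B₁, hE.mul hC₁, hE'.mul hC₁', hB₁, ?_⟩
    calc f * (E * C₁) = E' * (D' * f * E * C₁) := by
          rw [← hf.pr_mul subset_rfl, ← hED']; simp only [Matrix.mul_assoc]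
          rw [← Matrix.mul_assoc D' E', hDE', ← Matrix.mul_assoc (pr J) D',
            hD'.supp.pr_mul subset_rfl]
      _ = E' * C₁' * B₁ := by rw [h1, Matrix.mul_assoc]

variable [DecidableEq S] [DecidableEq T]

/-- A generic injective linear system yields a solution of the moment map equation. -/
theorem lru_of_dMap_injective (hS : ∀ s s' : S, blk s = blk s') {I₁ K : Finset T}
    {J₁ L : Finset S} {B g : Matrix S T ℂ} {F₁ : Matrix T S ℂ} (hB : Supp B J₁ I₁)
    (hBF : B * F₁ = pr J₁) (hFB : F₁ * B = pr I₁)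
    (hg : Supp g L K) (hc : I₁.card = J₁.card) (hp : 0 ≤ pairing I₁ J₁ K L)
    (hinj : ∀ φ ψ, Supp φ K I₁ → IsUp φ → Supp ψ L J₁ → IsUp ψ → g * φ = ψ * B → φ = 0 ∧ ψ = 0) :
    LRU I₁ J₁ (subWeight K) (quotWeight L) := by
  have hi : Function.Injective (dMap I₁ J₁ K L B g) := by
    rw [← LinearMap.ker_eq_bot, LinearMap.ker_eq_bot']
    rintro ⟨⟨φ, hφ⟩, ⟨ψ, hψ⟩⟩ h0
    rw [dMap_apply, mask_eq hg, mask_eq hB, sub_eq_zero] at h0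
    rw [mem_entr_filPos] at hφ hψ
    obtain ⟨h1, h2⟩ := hinj φ ψ hφ.1 hφ.2 hψ.1 hψ.2 h0
    subst h1 h2
    rfl
  have hdim : finrank ℂ (entr (filPos K I₁) × entr (filPos L J₁)) =
      (filPos K I₁).card + (filPos L J₁).card := by
    rw [Module.finrank_prod, finrank_entr, finrank_entr]
  have hrk := LinearMap.finrank_range_of_inj hi
  have hle := Submodule.finrank_mono (dMap_range_le I₁ J₁ K L B g)
  rw [hrk, hdim, finrank_entr, Finset.card_product] at hle
  have hp0 : pairing I₁ J₁ K L = 0 := by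
    refine le_antisymm ?_ hp
    rw [pairing]
    have : ((filPos K I₁).card + (filPos L J₁).card : ℤ) ≤ L.card * I₁.card := by exact_mod_cast hle
    linarith
  have hsurj : LinearMap.range (dMap I₁ J₁ K L B g) = entr (L ×ˢ I₁) := by
    apply dMap_range_eq
    rw [hrk, hdim]
    rw [pairing] at hp
    have : (L.card * I₁.card : ℤ) ≤ (filPos K I₁).card + (filPos L J₁).card := by linarith
    exact_mod_cast this
  have hB' := mask_eq hB
  refine lru_of_hasSub hS (f := B) (F := F₁) (by rw [hB', hBF]) (by rw [hB', hFB])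
    (antitone_subWeight K) (monotone_quotWeight L) ?_ fun I₀ J₀ hc₀ hs => ?_
  · have := pairing_eq_sum hc K L
    rw [hp0, Int.cast_zero] at this
    linarith
  · have h0 := pairing_eq_sum hc₀ K L
    suffices 0 ≤ pairing I₀ J₀ K L by
      have : (0 : ℝ) ≤ pairing I₀ J₀ K L := by exact_mod_cast this
      linarith
    rw [hB'] at hs
    obtain ⟨C, C', B₀, hC, hC', hB₀, hBC⟩ := hs
    obtain ⟨E, D, hE, hD, hED, hDE, hE1, hD1⟩ := hC.exists_completion
    have : entr (L ×ˢ I₀) ≤ LinearMap.range (dMap I₀ J₀ K L B₀ g) := by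
      intro M hM
      rw [mem_entr_prod] at hM
      have h1 : M * D ∈ entr (L ×ˢ I₁) := mem_entr_prod.2
        ((hM.mono subset_rfl hC.subset).mul hD.supp)
      rw [← hsurj] at h1
      obtain ⟨⟨⟨φ, hφ⟩, ⟨ψ, hψ⟩⟩, h2⟩ := h1
      rw [dMap_apply, mask_eq hg, mask_eq hB] at h2
      rw [mem_entr_filPos] at hφ hψ
      refine ⟨⟨⟨φ * C, mem_entr_filPos.2 ⟨hφ.1.mul hC.supp, hφ.2.mul hC.up⟩⟩,
        ⟨ψ * C', mem_entr_filPos.2 ⟨hψ.1.mul hC'.supp, hψ.2.mul hC'.up⟩⟩⟩, ?_⟩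
      rw [dMap_apply, mask_eq hg, mask_eq hB₀]
      calc g * (φ * C) - ψ * C' * B₀ = (g * φ - ψ * B) * C := by
            rw [Matrix.sub_mul, Matrix.mul_assoc, Matrix.mul_assoc, Matrix.mul_assoc, hBC]
        _ = M := by
            rw [show g * φ - ψ * B = M * D from h2, Matrix.mul_assoc, hD1, hM.mul_pr subset_rfl]
    have := (Submodule.finrank_mono this).trans (LinearMap.finrank_range_le _)
    rw [finrank_entr, Finset.card_product, Module.finrank_prod, finrank_entr, finrank_entr] at this
    rw [pairing]
    have : (L.card * I₀.card : ℤ) ≤ (filPos K I₀).card + (filPos L J₀).card := by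
      exact_mod_cast this
    linarith

/-- The recursive inequalities are sufficient for solvability of the moment map equation. -/
theorem lru_of_recursive (hS : ∀ s s' : S, blk s = blk s') {I : Finset T} {J : Finset S}
    {w : T → ℝ} {x : S → ℝ} (hw : Antitone w) (hx : Monotone x) (hc : I.card = J.card)
    (hsum : ∑ i ∈ I, w i = ∑ j ∈ J, x j)
    (hrec : ∀ I' J', I' ⊆ I → J' ⊆ J → I'.card = J'.card →
      LRU I' J' (subWeight (I \ I')) (quotWeight (J \ J')) →
      ∑ i ∈ I', w i ≤ ∑ j ∈ J', x j) : LRU I J w x := by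
  have hgen : Gen {f : Matrix S T ℂ | ∀ p : Finset T × Finset S,
      f ∈ {f | HasSub (mask J I f) I J p.1 p.2 → Dom I J p.1 p.2}} := by
    refine Gen.iInter fun p => ?_
    rcases dom_or_gen_not (I := I) (J := J) (I' := p.1) (J' := p.2) with h | h
    · exact gen_univ.mono fun f _ _ => h.1
    · exact h.mono fun f hf hf' => absurd hf' hf
  obtain ⟨f, ⟨F, hF, hfF, hFf⟩, hdom⟩ := ((gen_invertible hc).inter hgen).nonempty
  refine lru_of_hasSub hS hfF hFf hw hx hsum ?_
  by_contra hcon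
  push Not at hcon
  obtain ⟨I', J', hc', hs', hlt⟩ := hcon
  classical
  let P := Finset.univ.filter fun p : Finset T × Finset S =>
    p.1.card = p.2.card ∧ HasSub (mask J I f) I J p.1 p.2
  let θ : Finset T × Finset S → ℝ ×ₗ ℕ := fun p =>
    toLex (∑ i ∈ p.1, w i - ∑ j ∈ p.2, x j, p.1.card)
  obtain ⟨⟨I₁, J₁⟩, hp1, hp2⟩ := Finset.exists_max_image P θ ⟨(I', J'), by simp [P, hc', hs']⟩
  have hp3 : I₁.card = J₁.card ∧ HasSub (mask J I f) I J I₁ J₁ := by simpa [P] using hp1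
  have hmax : ∀ I' J', I'.card = J'.card → HasSub (mask J I f) I J I' J' →
      ∑ i ∈ I', w i - ∑ j ∈ J', x j ≤ ∑ i ∈ I₁, w i - ∑ j ∈ J₁, x j ∧
      (∑ i ∈ I', w i - ∑ j ∈ J', x j = ∑ i ∈ I₁, w i - ∑ j ∈ J₁, x j → I'.card ≤ I₁.card) := by
    intro I' J' h1 h2
    have := hp2 (I', J') (by simp [P, h1, h2])
    rw [Prod.Lex.le_iff] at this
    rcases this with h | h
    · exact ⟨le_of_lt h, fun h' => absurd h' (ne_of_lt h)⟩
    · exact ⟨le_of_eq h.1, fun _ => h.2⟩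
  have hpos : 0 < ∑ i ∈ I₁, w i - ∑ j ∈ J₁, x j := by
    have := (hmax I' J' hc' hs').1
    linarith
  have hI : I₁ ⊆ I := by obtain ⟨C, _, _, hC, -⟩ := hp3.2; exact hC.subset
  have hJ : J₁ ⊆ J := by obtain ⟨_, C, _, _, hC, -⟩ := hp3.2; exact hC.subset
  obtain ⟨h, B, F', hh, hF', hhF, hFh, hB, hhB, hsub⟩ :=
    hp3.2.exists_coordinate (supp_mask' J I f) hF hfF hFf
  have hFB : pr I₁ * F' * pr J₁ * B = pr I₁ := by
    rw [Matrix.mul_assoc, hB.pr_mul subset_rfl, ← hhB, Matrix.mul_assoc, ← Matrix.mul_assoc F',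
      hFh, (supp_pr I₁).pr_mul hI, pr_mul_self]
  have hF₁ : Supp (pr I₁ * F' * pr J₁) I₁ J₁ := supp_mask _ _ _
  have hBF := mul_eq_pr_of_card_eq hB hF₁ hFB hp3.1
  have hF'1 : F' * pr J₁ = pr I₁ * F' * pr J₁ := by
    have e : F' * B = pr I₁ := by
      rw [← hhB, ← Matrix.mul_assoc, hFh, (supp_pr I₁).pr_mul hI]
    nth_rewrite 1 [← hBF]
    rw [← Matrix.mul_assoc F' B, e, hF₁.pr_mul subset_rfl]
  have hdj : Disjoint (I \ I₁) I₁ := Finset.sdiff_disjoint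
  have hGg : pr (I \ I₁) * F' * pr (J \ J₁) * (pr (J \ J₁) * h * pr (I \ I₁)) = pr (I \ I₁) := by
    have e1 : F' * pr (J \ J₁) = F' - pr I₁ * F' * pr J₁ := by
      rw [← hF'1, eq_sub_iff_add_eq, ← Matrix.mul_add, add_comm, pr_add_pr_sdiff hJ,
        hF'.mul_pr subset_rfl]
    calc _ = pr (I \ I₁) * (F' * (pr (J \ J₁) * pr (J \ J₁))) * h * pr (I \ I₁) := by
          simp only [Matrix.mul_assoc]
      _ = pr (I \ I₁) * F' * h * pr (I \ I₁) -
          pr (I \ I₁) * pr I₁ * (F' * pr J₁ * h * pr (I \ I₁)) := by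
          rw [pr_mul_self, e1]
          simp only [Matrix.mul_sub, Matrix.sub_mul, Matrix.mul_assoc]
      _ = pr (I \ I₁) := by
          rw [supp_mul_eq_zero (supp_pr _) (supp_pr _) hdj, Matrix.zero_mul, sub_zero,
            Matrix.mul_assoc _ F', hFh, (supp_pr (I \ I₁)).mul_pr Finset.sdiff_subset, pr_mul_self]
  have key : LRU I₁ J₁ (subWeight (I \ I₁)) (quotWeight (J \ J₁)) := by
    refine lru_of_dMap_injective hS hB hBF hFB (g := pr (J \ J₁) * h * pr (I \ I₁))
      (supp_mask _ _ _) hp3.1 (hdom (I₁, J₁) hp3.2).pairing_nonneg fun φ ψ h1 h2 h3 h4 h5 => ?_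
    exact eq_zero_of_maximal hw hx hI hJ hB hhB hF₁ hBF hFB hh rfl hGg
      (fun I' J' hc h6 => hmax I' J' hc (hsub I' J' h6)) hp3.1 h1 h2 h3 h4 h5
  have := hrec I₁ J₁ hI hJ hp3.1 key
  linarith

end Sufficiency

section EigVec

variable {k : ℕ}

theorem antitone_eigVec (X : Matrix (Fin k) (Fin k) ℂ) (hX : X.IsHermitian) :
    Antitone (eigVec X hX) := fun _ _ hab =>
  Tuple.monotone_sort hX.eigenvalues (Fin.rev_le_rev.2 hab)

theorem eigVec_eq {X W : Matrix (Fin k) (Fin k) ℂ} (hX : X.IsHermitian) {v : Fin k → ℝ}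
    (hv : Antitone v) (hW : W * Wᴴ = 1)
    (h : X = W * Matrix.diagonal (fun i => (v i : ℂ)) * Wᴴ) : eigVec X hX = v := by
  have hr : X.charpoly.roots = Multiset.map (RCLike.ofReal ∘ v) Finset.univ.val := by
    have hW' : Wᴴ * W = 1 := mul_eq_one_comm.1 hW
    rw [h, Matrix.charpoly_mul_comm, ← Matrix.mul_assoc, hW', Matrix.one_mul,
      Matrix.charpoly_diagonal, Polynomial.roots_prod]
    · simp
    · simp [Finset.prod_ne_zero_iff, Polynomial.X_sub_C_ne_zero]
  rw [hX.roots_charpoly_eq_eigenvalues, ← Multiset.map_map, ← Multiset.map_map] at hr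
  have hr' := Multiset.map_injective RCLike.ofReal_injective hr
  rw [Fin.univ_val_map, Fin.univ_val_map, Multiset.coe_eq_coe] at hr'
  apply List.ofFn_injective
  refine List.Perm.eq_of_sortedGE (antitone_eigVec X hX).sortedGE_ofFn hv.sortedGE_ofFn
    (List.Perm.trans ?_ hr')
  exact Equiv.Perm.ofFn_comp_perm (Fin.revPerm.trans (Tuple.sort hX.eigenvalues)) hX.eigenvalues

theorem exists_eq_eigVec (X : Matrix (Fin k) (Fin k) ℂ) (hX : X.IsHermitian) :
    ∃ W : Matrix (Fin k) (Fin k) ℂ, W * Wᴴ = 1 ∧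
      X = W * Matrix.diagonal (fun i => (eigVec X hX i : ℂ)) * Wᴴ := by
  obtain ⟨U, ev, hU, h⟩ := hX.exists_unitary_diagonal
  let σ : Equiv.Perm (Fin k) := Fin.revPerm.trans (Tuple.sort ev)
  have hσ : Antitone (ev ∘ σ) := fun a b hab =>
    Tuple.monotone_sort ev (Fin.rev_le_rev.2 hab)
  have h1 : U.submatrix id σ * (U.submatrix id σ)ᴴ = 1 := by
    rw [Matrix.conjTranspose_submatrix, Matrix.submatrix_mul_equiv, hU, Matrix.submatrix_id_id]
  have h2 : X = U.submatrix id σ * Matrix.diagonal (fun i => ((ev ∘ σ) i : ℂ)) *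
      (U.submatrix id σ)ᴴ := by
    have : Matrix.diagonal (fun i => ((ev ∘ σ) i : ℂ)) =
        (Matrix.diagonal (fun i => (ev i : ℂ))).submatrix σ σ := by
      rw [Matrix.submatrix_diagonal_equiv]; rfl
    rw [this, Matrix.conjTranspose_submatrix, Matrix.submatrix_mul_equiv,
      Matrix.submatrix_mul_equiv, ← h, Matrix.submatrix_id_id]
  exact ⟨_, h1, by rw [eigVec_eq hX hσ h1 h2]; exact h2⟩

end EigVec

section LRV

variable {b c : ℕ}

/-- A unitary matrix conjugating `diag(v)` to a matrix with diagonal blocks `diag(y)` and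
`diag(z)`. -/
def LRV (b c : ℕ) (v : Fin (b + c) → ℝ) (u : Fin b ⊕ Fin c → ℝ) : Prop :=
  ∃ V : Matrix (Fin (b + c)) (Fin b ⊕ Fin c) ℂ, Vᴴ * V = 1 ∧ V * Vᴴ = 1 ∧
    ∀ r r', r.isLeft = r'.isLeft →
      (Vᴴ * Matrix.diagonal (fun i => (v i : ℂ)) * V) r r' = if r = r' then (u r : ℂ) else 0

theorem LRV.neg {v : Fin (b + c) → ℝ} {u : Fin b ⊕ Fin c → ℝ} (h : LRV b c v u) :
    LRV b c (-v) (-u) := by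
  obtain ⟨V, h1, h2, h3⟩ := h
  refine ⟨V, h1, h2, fun r r' hr => ?_⟩
  have : Matrix.diagonal (fun i => (((-v) i : ℝ) : ℂ)) = -Matrix.diagonal (fun i => (v i : ℂ)) := by
    ext i j; by_cases hij : i = j <;> simp [Matrix.diagonal, hij]
  rw [this, Matrix.mul_neg, Matrix.neg_mul, Matrix.neg_apply, h3 r r' hr]
  split_ifs <;> simp

theorem mem_LRcone_iff {v : Fin (b + c) → ℝ} {y : Fin b → ℝ} {z : Fin c → ℝ} (hv : Antitone v)
    (hy : Antitone y) (hz : Antitone z) :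
    (v, y, z) ∈ LRcone b c ↔ LRV b c v (Sum.elim y z) := by
  constructor
  · rintro ⟨M, hM, h1, h2, h3⟩
    obtain ⟨W, hW, hMW⟩ := exists_eq_eigVec M hM
    obtain ⟨P, hP, hMP⟩ := exists_eq_eigVec _ (hM.submatrix (Fin.castAdd c))
    obtain ⟨Q, hQ, hMQ⟩ := exists_eq_eigVec _ (hM.submatrix (Fin.natAdd b))
    dsimp only at h1 h2 h3
    rw [← h1] at hMW
    rw [← h2] at hMP
    rw [← h3] at hMQ
    have hP' : Pᴴ * P = 1 := mul_eq_one_comm.1 hP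
    have hQ' : Qᴴ * Q = 1 := mul_eq_one_comm.1 hQ
    have hW' : Wᴴ * W = 1 := mul_eq_one_comm.1 hW
    let N : Matrix (Fin b ⊕ Fin c) (Fin b ⊕ Fin c) ℂ := Matrix.fromBlocks P 0 0 Q
    have hN : Nᴴ * N = 1 := by
      simp [N, Matrix.fromBlocks_conjTranspose, Matrix.fromBlocks_multiply, hP', hQ']
    have hN' : N * Nᴴ = 1 := mul_eq_one_comm.1 hN
    let e := finSumFinEquiv (m := b) (n := c)
    let A := W.submatrix e id
    have hA : A * Aᴴ = 1 := by
      rw [Matrix.conjTranspose_submatrix]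
      rw [show W.submatrix e id * Wᴴ.submatrix id e = (W * Wᴴ).submatrix e e from
        (Matrix.submatrix_mul_equiv W Wᴴ e (Equiv.refl _) e), hW, Matrix.submatrix_one_equiv]
    have hA' : Aᴴ * A = 1 := by
      rw [Matrix.conjTranspose_submatrix, Matrix.submatrix_mul_equiv, hW', Matrix.submatrix_id_id]
    have hMA : A * Matrix.diagonal (fun i => (v i : ℂ)) * Aᴴ = M.submatrix e e := by
      rw [hMW]
      rfl
    have hMb : M.submatrix e e = Matrix.fromBlocks
        (M.submatrix (Fin.castAdd c) (Fin.castAdd c)) (M.submatrix (Fin.castAdd c) (Fin.natAdd b))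
        (M.submatrix (Fin.natAdd b) (Fin.castAdd c))
        (M.submatrix (Fin.natAdd b) (Fin.natAdd b)) := by
      ext (i | i) (j | j) <;> simp [e]
    have key : (Aᴴ * N)ᴴ * Matrix.diagonal (fun i => (v i : ℂ)) * (Aᴴ * N) =
        Nᴴ * (M.submatrix e e) * N := by
      rw [← hMA, Matrix.conjTranspose_mul, Matrix.conjTranspose_conjTranspose]
      simp only [Matrix.mul_assoc]
    refine ⟨Aᴴ * N, ?_, ?_, ?_⟩
    · rw [Matrix.conjTranspose_mul, Matrix.conjTranspose_conjTranspose, Matrix.mul_assoc,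
        ← Matrix.mul_assoc A, hA, Matrix.one_mul, hN]
    · rw [Matrix.conjTranspose_mul, Matrix.conjTranspose_conjTranspose, Matrix.mul_assoc,
        ← Matrix.mul_assoc N, hN', Matrix.one_mul, hA']
    · rw [key, hMb]
      have d1 : Pᴴ * (M.submatrix (Fin.castAdd c) (Fin.castAdd c)) * P =
          Matrix.diagonal (fun i => (y i : ℂ)) := by
        rw [hMP]
        calc _ = (Pᴴ * P) * Matrix.diagonal (fun i => (y i : ℂ)) * (Pᴴ * P) := by
              simp only [Matrix.mul_assoc]
          _ = _ := by rw [hP', Matrix.one_mul, Matrix.mul_one]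
      have d2 : Qᴴ * (M.submatrix (Fin.natAdd b) (Fin.natAdd b)) * Q =
          Matrix.diagonal (fun i => (z i : ℂ)) := by
        rw [hMQ]
        calc _ = (Qᴴ * Q) * Matrix.diagonal (fun i => (z i : ℂ)) * (Qᴴ * Q) := by
              simp only [Matrix.mul_assoc]
          _ = _ := by rw [hQ', Matrix.one_mul, Matrix.mul_one]
      simp only [N, Matrix.fromBlocks_conjTranspose, Matrix.fromBlocks_multiply,
        Matrix.conjTranspose_zero, Matrix.zero_mul, Matrix.mul_zero, add_zero, zero_add, d1, d2]
      rintro (i | i) (j | j) hij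
      · simp [Matrix.diagonal_apply]
      · simp at hij
      · simp at hij
      · simp [Matrix.diagonal_apply]
  · rintro ⟨V, h1, h2, h3⟩
    let e := finSumFinEquiv (m := b) (n := c)
    let A := V.submatrix id e.symm
    let D := Matrix.diagonal (fun i => (v i : ℂ))
    have hA : Aᴴ * A = 1 := by
      rw [Matrix.conjTranspose_submatrix]
      rw [show Vᴴ.submatrix e.symm id * V.submatrix id e.symm = (Vᴴ * V).submatrix e.symm e.symm from
        (Matrix.submatrix_mul_equiv Vᴴ V e.symm (Equiv.refl _) e.symm), h1,
        Matrix.submatrix_one_equiv]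
    have hD : D.IsHermitian := by
      ext i j; by_cases hij : i = j <;> simp [D, Matrix.diagonal, hij, Ne.symm]
    have hM : (Aᴴ * D * A).IsHermitian := Matrix.isHermitian_conjTranspose_mul_mul A hD
    have hMe : Aᴴ * D * A = (Vᴴ * D * V).submatrix e.symm e.symm := rfl
    refine ⟨Aᴴ * D * A, hM, ?_, ?_, ?_⟩
    · refine (eigVec_eq hM hv (W := Aᴴ) ?_ ?_).symm
      · rw [Matrix.conjTranspose_conjTranspose, hA]
      · rw [Matrix.conjTranspose_conjTranspose]
    · refine (eigVec_eq _ hy (W := 1) (by simp) ?_).symm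
      ext i j
      rw [hMe]
      simp only [Matrix.submatrix_apply, e, finSumFinEquiv_symm_apply_castAdd]
      refine (h3 (Sum.inl i) (Sum.inl j) rfl).trans ?_
      simp [Matrix.one_apply]
    · refine (eigVec_eq _ hz (W := 1) (by simp) ?_).symm
      ext i j
      rw [hMe]
      simp only [Matrix.submatrix_apply, e, finSumFinEquiv_symm_apply_natAdd]
      refine (h3 (Sum.inr i) (Sum.inr j) rfl).trans ?_
      simp [Matrix.one_apply]

end LRV

section Instances

instance instBlockOrderSum {m n : ℕ} : BlockOrder (Fin m ⊕ Fin n) where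
  toPartialOrder := inferInstance
  blk := Sum.isLeft
  blk_eq_iff := by
    rintro (a | a) (b | b)
    · simpa using le_total a b
    · simp
    · simp
    · simpa using le_total a b

instance instBlockOrderDual {N : ℕ} : BlockOrder (Fin N)ᵒᵈ where
  toPartialOrder := inferInstance
  blk := fun _ => true
  blk_eq_iff := fun a b => by simpa using le_total a b

theorem blk_sum {m n : ℕ} (r : Fin m ⊕ Fin n) : blk r = r.isLeft := rfl

end Instances

section Reindex

variable {S T P R : Type} [Fintype S] [Fintype T] [Fintype P] [Fintype R]

/-- The matrix of the map of coordinate vectors induced by an injection. -/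
noncomputable def sel (α : P → S) : Matrix S P ℂ := by
  classical exact fun s p => if α p = s then 1 else 0

theorem sel_apply [DecidableEq S] (α : P → S) (s : S) (p : P) :
    sel α s p = if α p = s then 1 else 0 := by
  unfold sel; congr

theorem sel_conjTranspose_mul [DecidableEq P] {α : P → S} (hα : Function.Injective α) :
    (sel α)ᴴ * sel α = 1 := by
  classical
  ext p q
  simp [Matrix.mul_apply, sel_apply, Matrix.one_apply, hα.eq_iff, eq_comm]

theorem sel_mul_conjTranspose {α : P → S} (hα : Function.Injective α) {J : Finset S}
    (hJ : ∀ s, s ∈ J ↔ ∃ p, α p = s) : sel α * (sel α)ᴴ = pr J := by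
  classical
  ext s t
  simp only [Matrix.mul_apply, sel_apply, Matrix.conjTranspose_apply, pr_apply]
  by_cases hs : s ∈ J
  · obtain ⟨p, rfl⟩ := (hJ s).1 hs
    rw [Finset.sum_eq_single p]
    · by_cases h : α p = t
      · simp [h, h ▸ hs]
      · simp [h]
    · intro q _ hq
      simp [hα.ne hq]
    · simp
  · rw [Finset.sum_eq_zero, if_neg (fun h => hs h.2)]
    intro p _
    rw [if_neg (fun h => hs ((hJ s).2 ⟨p, h⟩)), zero_mul]

theorem supp_sel {α : P → S} {J : Finset S} (hJ : ∀ s, s ∈ J ↔ ∃ p, α p = s) :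
    Supp (sel α) J Finset.univ := by
  classical
  intro s p h
  rw [sel_apply] at h
  refine ⟨(hJ s).2 ⟨p, ?_⟩, Finset.mem_univ _⟩
  by_contra h'
  simp [h'] at h

theorem diagonal_mul_sel [DecidableEq S] [DecidableEq P] (α : P → S) (x : S → ℂ) :
    Matrix.diagonal x * sel α = sel α * Matrix.diagonal (x ∘ α) := by
  ext s p
  rw [Matrix.diagonal_mul, Matrix.mul_diagonal, sel_apply]
  by_cases h : α p = s
  · simp [h]
  · simp [h]

theorem sel_conjTranspose_mul_mul (β : R → T) (M : Matrix T T ℂ) (r r' : R) :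
    ((sel β)ᴴ * M * sel β) r r' = M (β r) (β r') := by
  classical
  simp [Matrix.mul_apply, sel_apply]

theorem sel_mul_mul_conjTranspose {β : R → T} (hβ : Function.Injective β) (M : Matrix R R ℂ)
    (r r' : R) : (sel β * M * (sel β)ᴴ) (β r) (β r') = M r r' := by
  classical
  simp [Matrix.mul_apply, sel_apply, hβ.eq_iff]

variable [BlockOrder S] [BlockOrder T]

theorem lru_iff_exists [DecidableEq P] [DecidableEq R] {α : P → S} {β : R → T}
    (hα : Function.Injective α) (hβ : Function.Injective β) {J : Finset S} {I : Finset T}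
    (hJ : ∀ s, s ∈ J ↔ ∃ p, α p = s) (hI : ∀ t, t ∈ I ↔ ∃ r, β r = t) {w : T → ℝ} {x : S → ℝ} :
    LRU I J w x ↔ ∃ V : Matrix P R ℂ, Vᴴ * V = 1 ∧ V * Vᴴ = 1 ∧
      ∀ r r', blk (β r) = blk (β r') →
        (Vᴴ * Matrix.diagonal (fun p => (x (α p) : ℂ)) * V) r r' =
          if r = r' then (w (β r) : ℂ) else 0 := by
  classical
  have a1 := sel_conjTranspose_mul hα
  have a2 := sel_mul_conjTranspose hα hJ
  have b1 := sel_conjTranspose_mul hβ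
  have b2 := sel_mul_conjTranspose hβ hI
  have hd := diagonal_mul_sel α (fun s => (x s : ℂ))
  constructor
  · rintro ⟨U, hU, h1, h2, h3⟩
    refine ⟨(sel α)ᴴ * U * sel β, ?_, ?_, ?_⟩
    · calc _ = (sel β)ᴴ * (Uᴴ * (sel α * (sel α)ᴴ) * U) * sel β := by
            simp only [Matrix.conjTranspose_mul, Matrix.conjTranspose_conjTranspose,
              Matrix.mul_assoc]
        _ = (sel β)ᴴ * sel β * ((sel β)ᴴ * sel β) := by
            rw [a2, hU.conjTranspose.mul_pr subset_rfl, h1, ← b2]; simp only [Matrix.mul_assoc]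
        _ = 1 := by rw [b1, Matrix.one_mul]
    · calc _ = (sel α)ᴴ * (U * (sel β * (sel β)ᴴ) * Uᴴ) * sel α := by
            simp only [Matrix.conjTranspose_mul, Matrix.conjTranspose_conjTranspose,
              Matrix.mul_assoc]
        _ = (sel α)ᴴ * sel α * ((sel α)ᴴ * sel α) := by
            rw [b2, hU.mul_pr subset_rfl, h2, ← a2]; simp only [Matrix.mul_assoc]
        _ = 1 := by rw [a1, Matrix.one_mul]
    · intro r r' hr
      have : ((sel α)ᴴ * U * sel β)ᴴ * Matrix.diagonal (fun p => (x (α p) : ℂ)) *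
          ((sel α)ᴴ * U * sel β) =
          (sel β)ᴴ * (Uᴴ * Matrix.diagonal (fun s => (x s : ℂ)) * U) * sel β := by
        calc _ = (sel β)ᴴ * (Uᴴ * (sel α * Matrix.diagonal (fun p => (x (α p) : ℂ))) *
              ((sel α)ᴴ * U)) * sel β := by
              simp only [Matrix.conjTranspose_mul, Matrix.conjTranspose_conjTranspose,
                Matrix.mul_assoc]
          _ = (sel β)ᴴ * (Uᴴ * (Matrix.diagonal (fun s => (x s : ℂ)) * sel α) *
              ((sel α)ᴴ * U)) * sel β := by rw [hd]; rfl
          _ = (sel β)ᴴ * (Uᴴ * Matrix.diagonal (fun s => (x s : ℂ)) *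
              (sel α * (sel α)ᴴ * U)) * sel β := by simp only [Matrix.mul_assoc]
          _ = _ := by rw [a2, hU.pr_mul subset_rfl]
      rw [this, sel_conjTranspose_mul_mul, h3 _ ((hI _).2 ⟨r, rfl⟩) _ ((hI _).2 ⟨r', rfl⟩) hr]
      simp [hβ.eq_iff]
  · rintro ⟨V, h1, h2, h3⟩
    refine ⟨sel α * V * (sel β)ᴴ, ?_, ?_, ?_, ?_⟩
    · exact ((supp_sel hJ).mul (I' := Finset.univ) (K := Finset.univ) (B := V)
        fun _ _ _ => ⟨Finset.mem_univ _, Finset.mem_univ _⟩).mul (supp_sel hI).conjTranspose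
    · calc _ = sel β * (Vᴴ * ((sel α)ᴴ * sel α) * V) * (sel β)ᴴ := by
            simp only [Matrix.conjTranspose_mul, Matrix.conjTranspose_conjTranspose,
              Matrix.mul_assoc]
        _ = _ := by rw [a1, Matrix.mul_one, h1, Matrix.mul_one, b2]
    · calc _ = sel α * (V * ((sel β)ᴴ * sel β) * Vᴴ) * (sel α)ᴴ := by
            simp only [Matrix.conjTranspose_mul, Matrix.conjTranspose_conjTranspose,
              Matrix.mul_assoc]
        _ = _ := by rw [b1, Matrix.mul_one, h2, Matrix.mul_one, a2]
    · intro i hi i' hi' hb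
      obtain ⟨r, rfl⟩ := (hI _).1 hi
      obtain ⟨r', rfl⟩ := (hI _).1 hi'
      have : (sel α * V * (sel β)ᴴ)ᴴ * Matrix.diagonal (fun s => (x s : ℂ)) *
          (sel α * V * (sel β)ᴴ) =
          sel β * (Vᴴ * Matrix.diagonal (fun p => (x (α p) : ℂ)) * V) * (sel β)ᴴ := by
        calc _ = sel β * (Vᴴ * ((sel α)ᴴ * (Matrix.diagonal (fun s => (x s : ℂ)) * sel α)) * V) *
              (sel β)ᴴ := by
              simp only [Matrix.conjTranspose_mul, Matrix.conjTranspose_conjTranspose,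
                Matrix.mul_assoc]
          _ = _ := by
              rw [hd, ← Matrix.mul_assoc (sel α)ᴴ, a1, Matrix.one_mul]; rfl
      rw [this, sel_mul_mul_conjTranspose hβ, h3 _ _ hb]
      simp [hβ.eq_iff]

end Reindex

section Translation

theorem lru_iff_lrv {N m n b c : ℕ} {α : Fin (b + c) → (Fin N)ᵒᵈ} {β₁ : Fin b → Fin m}
    {β₂ : Fin c → Fin n} (hα : Function.Injective α) (hβ₁ : Function.Injective β₁)
    (hβ₂ : Function.Injective β₂) {J : Finset (Fin N)ᵒᵈ} {I : Finset (Fin m ⊕ Fin n)}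
    (hJ : ∀ s, s ∈ J ↔ ∃ p, α p = s) (hI : ∀ t, t ∈ I ↔ ∃ r, Sum.map β₁ β₂ r = t)
    {w : Fin m ⊕ Fin n → ℝ} {x : (Fin N)ᵒᵈ → ℝ} :
    LRU I J w x ↔ LRV b c (x ∘ α) (w ∘ Sum.map β₁ β₂) := by
  rw [lru_iff_exists hα (hβ₁.sumMap hβ₂) hJ hI, LRV]
  simp only [blk_sum, Sum.isLeft_map, Function.comp_apply]

end Translation

section Weights

theorem quotWeight_eq_neg {S : Type} [PartialOrder S] [DecidableLE S] (L : Finset S) (j : S) :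
    quotWeight L j = -((L.filter (¬ · ≤ j)).card : ℝ) := by
  have h := Finset.card_filter_add_card_filter_not (s := L) (· ≤ j)
  have h' : quotWeight L j = ((L.filter (· ≤ j)).card : ℝ) - L.card := by
    unfold quotWeight; congr
  rw [h', ← h]
  push_cast
  ring

theorem subWeight_eq_neg {T : Type} [PartialOrder T] [DecidableLE T] (K : Finset T) (i : T) :
    subWeight K i = -((K.filter (· ≤ i)).card : ℝ) := by
  unfold subWeight; congr

variable {N r : ℕ}

theorem card_filter_lt_orderEmbOfFin (A : Finset (Fin N)) (h : A.card = r) (k : Fin r) :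
    (A.filter (· < A.orderEmbOfFin h k)).card = k := by
  have : A.filter (· < A.orderEmbOfFin h k) = (Finset.Iio k).map (A.orderEmbOfFin h).toEmbedding := by
    ext a
    simp only [Finset.mem_filter, Finset.mem_map, Finset.mem_Iio]
    constructor
    · rintro ⟨ha, hlt⟩
      obtain ⟨l, rfl⟩ : a ∈ Set.range (A.orderEmbOfFin h) := by
        rw [Finset.range_orderEmbOfFin]; exact ha
      exact ⟨l, (A.orderEmbOfFin h).lt_iff_lt.1 hlt, rfl⟩
    · rintro ⟨l, hl, rfl⟩
      exact ⟨A.orderEmbOfFin_mem h l, (A.orderEmbOfFin h).lt_iff_lt.2 hl⟩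
  rw [this, Finset.card_map, Fin.card_Iio]

theorem muVec_eq_card (A : Finset (Fin N)) (h : A.card = r) (k : Fin r) :
    muVec A h k = ((Aᶜ.filter (· < A.orderEmbOfFin h k.rev)).card : ℝ) := by
  have h1 := card_filter_lt_orderEmbOfFin A h k.rev
  have h2 : (A.filter (· < A.orderEmbOfFin h k.rev)).card +
      (Aᶜ.filter (· < A.orderEmbOfFin h k.rev)).card = (A.orderEmbOfFin h k.rev : ℕ) := by
    rw [← Finset.card_union_of_disjoint, ← Finset.filter_union, Finset.union_compl,
      ← Fin.card_Iio (A.orderEmbOfFin h k.rev)]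
    · congr 1; ext; simp
    · exact Finset.disjoint_filter_filter disjoint_compl_right
  rw [muVec, Finset.coe_orderIsoOfFin_apply, ← h2, h1]
  push_cast
  ring

theorem antitone_muVec (A : Finset (Fin N)) (h : A.card = r) : Antitone (muVec A h) := by
  intro k l hkl
  rw [muVec_eq_card, muVec_eq_card]
  refine Nat.cast_le.2 (Finset.card_le_card fun a ha => ?_)
  rw [Finset.mem_filter] at ha ⊢
  exact ⟨ha.1, ha.2.trans_le ((A.orderEmbOfFin h).monotone (Fin.rev_le_rev.2 hkl))⟩

theorem quotWeight_toDual (A : Finset (Fin N)) (a : Fin N) :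
    quotWeight (Finset.univ \ A.map OrderDual.toDual.toEmbedding) (OrderDual.toDual a) =
      -((Aᶜ.filter (· < a)).card : ℝ) := by
  rw [quotWeight_eq_neg, ← Finset.card_map OrderDual.toDual.toEmbedding (s := Aᶜ.filter _)]
  congr 3
  ext l
  simp only [Finset.mem_filter, Finset.mem_sdiff, Finset.mem_univ, true_and, Finset.mem_map_equiv,
    OrderDual.toDual_symm_eq, Finset.mem_compl]
  exact and_congr_right fun _ => not_le (a := a) (b := OrderDual.ofDual l)

variable {m n : ℕ}

theorem subWeight_inl (B : Finset (Fin m)) (C : Finset (Fin n)) {b : Fin m} (hb : b ∈ B) :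
    subWeight (Finset.univ \ B.disjSum C) (Sum.inl b) = -((Bᶜ.filter (· < b)).card : ℝ) := by
  classical
  rw [subWeight_eq_neg, ← Finset.card_map Function.Embedding.inl (s := Bᶜ.filter _)]
  congr 3
  ext l
  rcases l with l | l
  · simp only [Finset.mem_filter, Finset.mem_sdiff, Finset.mem_univ, Finset.inl_mem_disjSum,
      Sum.inl_le_inl_iff, Finset.mem_map, Finset.mem_compl, Function.Embedding.inl_apply,
      Sum.inl.injEq, exists_eq_right, true_and]
    refine and_congr_right fun hl => ⟨fun h => lt_of_le_of_ne h ?_, le_of_lt⟩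
    rintro rfl
    exact hl hb
  · simp

theorem subWeight_inr (B : Finset (Fin m)) (C : Finset (Fin n)) {c : Fin n} (hc : c ∈ C) :
    subWeight (Finset.univ \ B.disjSum C) (Sum.inr c) = -((Cᶜ.filter (· < c)).card : ℝ) := by
  classical
  rw [subWeight_eq_neg, ← Finset.card_map Function.Embedding.inr (s := Cᶜ.filter _)]
  congr 3
  ext l
  rcases l with l | l
  · simp
  · simp only [Finset.mem_filter, Finset.mem_sdiff, Finset.mem_univ, Finset.inr_mem_disjSum,
      Sum.inr_le_inr_iff, Finset.mem_map, Finset.mem_compl, Function.Embedding.inr_apply,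
      Sum.inr.injEq, exists_eq_right, true_and]
    refine and_congr_right fun hl => ⟨fun h => lt_of_le_of_ne h ?_, le_of_lt⟩
    rintro rfl
    exact hl hc

end Weights

section Translation

variable {m n : ℕ}

theorem mem_LRcone_iff_lru {x : Fin (m + n) → ℝ} {y : Fin m → ℝ} {z : Fin n → ℝ}
    (hx : Antitone x) (hy : Antitone y) (hz : Antitone z) :
    (x, y, z) ∈ LRcone m n ↔
      LRU Finset.univ Finset.univ (Sum.elim y z) (x ∘ OrderDual.ofDual) := by
  rw [mem_LRcone_iff hx hy hz, lru_iff_lrv (α := OrderDual.toDual) (β₁ := id) (β₂ := id)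
    OrderDual.toDual.injective Function.injective_id Function.injective_id
    (fun s => ⟨fun _ => ⟨OrderDual.ofDual s, rfl⟩, fun _ => Finset.mem_univ _⟩)
    (fun t => ⟨fun _ => ⟨t, by simp⟩, fun _ => Finset.mem_univ _⟩), Sum.map_id_id]
  rfl

theorem lru_weights_iff {N : ℕ} (A : Finset (Fin N)) (B : Finset (Fin m)) (C : Finset (Fin n))
    (hA : A.card = B.card + C.card) :
    LRU (B.disjSum C) (A.map OrderDual.toDual.toEmbedding)
        (subWeight (Finset.univ \ B.disjSum C))
        (quotWeight (Finset.univ \ A.map OrderDual.toDual.toEmbedding)) ↔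
      (muVec A hA, muVec B rfl, muVec C rfl) ∈ LRcone B.card C.card := by
  have key {N r : ℕ} (D : Finset (Fin N)) (h : D.card = r) (d : Fin N) :
      d ∈ D ↔ ∃ k : Fin r, D.orderEmbOfFin h k.rev = d := by
    rw [← Finset.mem_coe, ← Finset.range_orderEmbOfFin D h, Set.mem_range, Fin.rev_surjective.exists]
  have inj {N r : ℕ} (D : Finset (Fin N)) (h : D.card = r) :
      Function.Injective fun k : Fin r => D.orderEmbOfFin h k.rev :=
    (D.orderEmbOfFin h).injective.comp Fin.rev_injective
  rw [mem_LRcone_iff (antitone_muVec A hA) (antitone_muVec B rfl) (antitone_muVec C rfl),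
    lru_iff_lrv (α := fun k => OrderDual.toDual (A.orderEmbOfFin hA k.rev))
      (OrderDual.toDual.injective.comp (inj A hA)) (inj B rfl) (inj C rfl)]
  · have h1 : quotWeight (Finset.univ \ A.map OrderDual.toDual.toEmbedding) ∘
        (fun k => OrderDual.toDual (A.orderEmbOfFin hA k.rev)) = -muVec A hA := by
      ext k
      rw [Function.comp_apply, quotWeight_toDual, Pi.neg_apply, muVec_eq_card]
    have h2 : subWeight (Finset.univ \ B.disjSum C) ∘ Sum.map
        (fun k => B.orderEmbOfFin rfl k.rev) (fun k => C.orderEmbOfFin rfl k.rev) =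
        -Sum.elim (muVec B rfl) (muVec C rfl) := by
      ext (k | k)
      · rw [Function.comp_apply, Sum.map_inl, subWeight_inl B C (B.orderEmbOfFin_mem _ _),
          Pi.neg_apply, Sum.elim_inl, muVec_eq_card]
      · rw [Function.comp_apply, Sum.map_inr, subWeight_inr B C (C.orderEmbOfFin_mem _ _),
          Pi.neg_apply, Sum.elim_inr, muVec_eq_card]
    rw [h1, h2]
    exact ⟨fun h => by simpa using h.neg, fun h => h.neg⟩
  · intro s
    obtain ⟨a, rfl⟩ := OrderDual.toDual.surjective s
    simpa using key A hA a
  · rintro (t | t)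
    · simpa using key B rfl t
    · simpa using key C rfl t

theorem lru_of_eq {S T : Type} [Fintype S] [Fintype T] [BlockOrder S] [BlockOrder T]
    {I : Finset T} {J : Finset S} {w : T → ℝ} {x : S → ℝ} (σ : T → S)
    (hσ : Set.InjOn σ I) (hJ : ∀ s, s ∈ J ↔ ∃ i ∈ I, σ i = s) (h : ∀ i ∈ I, w i = x (σ i)) :
    LRU I J w x := by
  classical
  rw [lru_iff_exists (P := I) (R := I) (α := fun i => σ i) (β := Subtype.val)
    (fun i j hij => Subtype.ext (hσ i.2 j.2 hij)) Subtype.val_injective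
    (fun s => by rw [hJ]; simp) (fun t => by simp)]
  refine ⟨1, by simp, by simp, fun r r' _ => ?_⟩
  rw [Matrix.conjTranspose_one, Matrix.one_mul, Matrix.mul_one, Matrix.diagonal_apply, h r r.2]

theorem LRV.sum_eq {b c : ℕ} {v : Fin (b + c) → ℝ} {u : Fin b ⊕ Fin c → ℝ} (h : LRV b c v u) :
    ∑ i, v i = ∑ r, u r := by
  obtain ⟨V, -, h2, h3⟩ := h
  have h4 : (Vᴴ * Matrix.diagonal (fun i => (v i : ℂ)) * V).trace = ∑ r, (u r : ℂ) :=
    Finset.sum_congr rfl fun r _ => by rw [Matrix.diag_apply, h3 r r rfl, if_pos rfl]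
  rw [Matrix.trace_mul_comm, ← Matrix.mul_assoc, h2, Matrix.one_mul, Matrix.trace_diagonal] at h4
  exact_mod_cast h4

end Translation

section Inequalities

variable {m n : ℕ} {x : Fin (m + n) → ℝ} {y : Fin m → ℝ} {z : Fin n → ℝ}

theorem sum_eq_of_lru (h : LRU Finset.univ Finset.univ (Sum.elim y z) (x ∘ OrderDual.ofDual)) :
    ∑ i, x i = ∑ i, y i + ∑ i, z i := by
  have h' := (lru_iff_lrv (α := OrderDual.toDual) (β₁ := id) (β₂ := id)
    OrderDual.toDual.injective Function.injective_id Function.injective_id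
    (fun s => ⟨fun _ => ⟨OrderDual.ofDual s, rfl⟩, fun _ => Finset.mem_univ _⟩)
    (fun t => ⟨fun _ => ⟨t, by simp⟩, fun _ => Finset.mem_univ _⟩)).1 h
  simpa [Fintype.sum_sum_type] using h'.sum_eq

theorem antitone_sumElim (hy : Antitone y) (hz : Antitone z) : Antitone (Sum.elim y z) := by
  rintro (a | a) (b | b) hab
  · exact hy (Sum.inl_le_inl_iff.1 hab)
  · exact absurd hab Sum.not_inl_le_inr
  · exact absurd hab Sum.not_inr_le_inl
  · exact hz (Sum.inr_le_inr_iff.1 hab)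

theorem sum_le_of_lru (hx : Antitone x) (hy : Antitone y) (hz : Antitone z)
    (h : LRU Finset.univ Finset.univ (Sum.elim y z) (x ∘ OrderDual.ofDual))
    {A : Finset (Fin (m + n))} {B : Finset (Fin m)} {C : Finset (Fin n)}
    (h' : LRU (B.disjSum C) (A.map OrderDual.toDual.toEmbedding)
      (subWeight (Finset.univ \ B.disjSum C))
      (quotWeight (Finset.univ \ A.map OrderDual.toDual.toEmbedding))) :
    ∑ i ∈ B, y i + ∑ i ∈ C, z i ≤ ∑ i ∈ A, x i := by
  simpa [Finset.sum_disjSum] using h.sum_le_sum_of_lru (antitone_sumElim hy hz) hx.dual_left (Finset.subset_univ _)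
    (Finset.subset_univ _) h'

theorem sum_le_of_injOn (hx : Antitone x) (hy : Antitone y) (hz : Antitone z)
    (h : LRU Finset.univ Finset.univ (Sum.elim y z) (x ∘ OrderDual.ofDual))
    {A : Finset (Fin (m + n))} {B : Finset (Fin m)} {C : Finset (Fin n)}
    (σ : Fin m ⊕ Fin n → Fin (m + n)) (hσ : Set.InjOn σ (B.disjSum C))
    (hA : ∀ a, a ∈ A ↔ ∃ i ∈ B.disjSum C, σ i = a)
    (hB : ∀ b ∈ B, (Bᶜ.filter (· < b)).card = (Aᶜ.filter (· < σ (Sum.inl b))).card)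
    (hC : ∀ c ∈ C, (Cᶜ.filter (· < c)).card = (Aᶜ.filter (· < σ (Sum.inr c))).card) :
    ∑ i ∈ B, y i + ∑ i ∈ C, z i ≤ ∑ i ∈ A, x i := by
  refine sum_le_of_lru hx hy hz h (lru_of_eq (OrderDual.toDual ∘ σ)
    (OrderDual.toDual.injective.comp_injOn hσ) (fun s => ?_) ?_)
  · rw [Finset.mem_map_equiv]
    exact hA _
  · rintro (i | i) hi
    · rw [Finset.inl_mem_disjSum] at hi
      rw [subWeight_inl B C hi, Function.comp_apply, quotWeight_toDual, hB i hi]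
    · rw [Finset.inr_mem_disjSum] at hi
      rw [subWeight_inr B C hi, Function.comp_apply, quotWeight_toDual, hC i hi]

theorem card_filter_singleton_lt {N : ℕ} (a b : Fin N) :
    (({a} : Finset (Fin N)).filter (· < b)).card = if a < b then 1 else 0 := by
  split_ifs with h
  · rw [Finset.filter_true_of_mem (by simpa using h), Finset.card_singleton]
  · rw [Finset.filter_false_of_mem (by simpa using h), Finset.card_empty]

theorem card_filter_compl_singleton_lt {N : ℕ} (a : Fin N) :
    (({a}ᶜ : Finset (Fin N)).filter (· < a)).card = a := by
  rw [← Fin.card_Iio a]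
  congr 1
  ext b
  simpa using fun h : b < a => h.ne

theorem left_le_of_lru (hx : Antitone x) (hy : Antitone y) (hz : Antitone z)
    (h : LRU Finset.univ Finset.univ (Sum.elim y z) (x ∘ OrderDual.ofDual)) (k : Fin m) :
    y k ≤ x (Fin.castLE (Nat.le_add_right m n) k) := by
  have := sum_le_of_injOn hx hy hz h (A := {Fin.castLE (Nat.le_add_right m n) k}) (B := {k})
    (C := ∅) (fun _ => Fin.castLE (Nat.le_add_right m n) k) (by simp) (by simp [eq_comm])
    (fun b hb => by
      rw [Finset.mem_singleton.1 hb, card_filter_compl_singleton_lt,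
        card_filter_compl_singleton_lt, Fin.val_castLE]) (by simp)
  simpa using this

theorem right_le_of_lru (hx : Antitone x) (hy : Antitone y) (hz : Antitone z)
    (h : LRU Finset.univ Finset.univ (Sum.elim y z) (x ∘ OrderDual.ofDual)) (l : Fin n) :
    z l ≤ x (Fin.castLE (Nat.le_add_left n m) l) := by
  have := sum_le_of_injOn hx hy hz h (A := {Fin.castLE (Nat.le_add_left n m) l}) (B := ∅)
    (C := {l}) (fun _ => Fin.castLE (Nat.le_add_left n m) l) (by simp) (by simp [eq_comm])
    (by simp) (fun b hb => by
      rw [Finset.mem_singleton.1 hb, card_filter_compl_singleton_lt,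
        card_filter_compl_singleton_lt, Fin.val_castLE])
  simpa using this

theorem le_left_of_lru (hx : Antitone x) (hy : Antitone y) (hz : Antitone z)
    (h : LRU Finset.univ Finset.univ (Sum.elim y z) (x ∘ OrderDual.ofDual)) (k : Fin m) :
    x (Fin.cast (Nat.add_comm n m) (Fin.natAdd n k)) ≤ y k := by
  have hk := k.isLt
  set a : Fin (m + n) := Fin.cast (Nat.add_comm n m) (Fin.natAdd n k) with ha
  have := sum_le_of_injOn hx hy hz h (A := {a}ᶜ) (B := {k}ᶜ) (C := Finset.univ)
    (Sum.elim (fun j => ⟨if (j : ℕ) < k then j else n + j,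
        by have := j.isLt; split_ifs <;> omega⟩)
      (fun l => ⟨k + l, by have := l.isLt; omega⟩)) ?_ ?_ ?_ ?_
  · have h1 := Finset.sum_add_sum_compl {a} x
    have h2 := Finset.sum_add_sum_compl {k} y
    have h3 := sum_eq_of_lru h
    rw [Finset.sum_singleton] at h1 h2
    linarith
  · rintro (i | i) hi (j | j) hj hij
    all_goals
      simp [Fin.ext_iff] at hi hj hij ⊢
      try split_ifs at hij
      all_goals omega
  · intro s
    simp only [Finset.mem_compl, Finset.mem_singleton, Sum.exists, Finset.inl_mem_disjSum,
      Finset.inr_mem_disjSum, Finset.mem_univ, true_and, Sum.elim_inl, Sum.elim_inr, Fin.ext_iff,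
      ha, Fin.val_cast, Fin.val_natAdd]
    have hs := s.isLt
    constructor
    · intro hne
      rcases lt_or_ge (s : ℕ) k with h1 | h1
      · exact Or.inl ⟨⟨s, by omega⟩, by simpa using h1.ne, by simp [h1]⟩
      rcases lt_or_ge (s : ℕ) (n + k) with h2 | h2
      · exact Or.inr ⟨⟨s - k, by omega⟩, by simp; omega⟩
      · exact Or.inl ⟨⟨s - n, by omega⟩, by simp; omega, by
          rw [if_neg (by simp; omega)]; simp; omega⟩
    · rintro (⟨i, hi, h1⟩ | ⟨i, h1⟩)
      · split_ifs at h1 <;> omega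
      · have := i.isLt
        omega
  · intro b hb
    rw [compl_compl, compl_compl, card_filter_singleton_lt, card_filter_singleton_lt]
    simp only [Finset.mem_compl, Finset.mem_singleton, Fin.ext_iff] at hb
    simp only [Fin.lt_def, Sum.elim_inl, ha, Fin.val_cast, Fin.val_natAdd]
    split_ifs <;> omega
  · intro c _
    rw [compl_compl, card_filter_singleton_lt, if_neg]
    · simp
    · simp only [Fin.lt_def, Sum.elim_inr, ha, Fin.val_cast, Fin.val_natAdd]
      omega

theorem le_right_of_lru (hx : Antitone x) (hy : Antitone y) (hz : Antitone z)
    (h : LRU Finset.univ Finset.univ (Sum.elim y z) (x ∘ OrderDual.ofDual)) (k : Fin n) :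
    x (Fin.natAdd m k) ≤ z k := by
  have hk := k.isLt
  set a : Fin (m + n) := Fin.natAdd m k with ha
  have := sum_le_of_injOn hx hy hz h (A := {a}ᶜ) (B := Finset.univ) (C := {k}ᶜ)
    (Sum.elim (fun l => ⟨k + l, by have := l.isLt; omega⟩)
      (fun j => ⟨if (j : ℕ) < k then j else m + j,
        by have := j.isLt; split_ifs <;> omega⟩)) ?_ ?_ ?_ ?_
  · have h1 := Finset.sum_add_sum_compl {a} x
    have h2 := Finset.sum_add_sum_compl {k} z
    have h3 := sum_eq_of_lru h
    rw [Finset.sum_singleton] at h1 h2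
    linarith
  · rintro (i | i) hi (j | j) hj hij
    all_goals
      simp [Fin.ext_iff] at hi hj hij ⊢
      try split_ifs at hij
      all_goals omega
  · intro s
    simp only [Finset.mem_compl, Finset.mem_singleton, Sum.exists, Finset.inl_mem_disjSum,
      Finset.inr_mem_disjSum, Finset.mem_univ, true_and, Sum.elim_inl, Sum.elim_inr, Fin.ext_iff,
      ha, Fin.val_natAdd]
    have hs := s.isLt
    constructor
    · intro hne
      rcases lt_or_ge (s : ℕ) k with h1 | h1
      · exact Or.inr ⟨⟨s, by omega⟩, by simpa using h1.ne, by simp [h1]⟩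
      rcases lt_or_ge (s : ℕ) (m + k) with h2 | h2
      · exact Or.inl ⟨⟨s - k, by omega⟩, by simp; omega⟩
      · exact Or.inr ⟨⟨s - m, by omega⟩, by simp; omega, by
          rw [if_neg (by simp; omega)]; simp; omega⟩
    · rintro (⟨i, h1⟩ | ⟨i, hi, h1⟩)
      · have := i.isLt
        omega
      · split_ifs at h1 <;> omega
  · intro c _
    rw [compl_compl, card_filter_singleton_lt, if_neg]
    · simp
    · simp only [Fin.lt_def, Sum.elim_inl, ha, Fin.val_natAdd]
      omega
  · intro b hb
    rw [compl_compl, compl_compl, card_filter_singleton_lt, card_filter_singleton_lt]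
    simp only [Finset.mem_compl, Finset.mem_singleton, Fin.ext_iff] at hb
    simp only [Fin.lt_def, Sum.elim_inr, ha, Fin.val_natAdd]
    split_ifs <;> omega

end Inequalities

section Sufficiency

variable {m n : ℕ} {x : Fin (m + n) → ℝ} {y : Fin m → ℝ} {z : Fin n → ℝ}

/-- The case where the index set of the first block is everything. -/
theorem sum_le_of_left_univ (hx : Antitone x) (hsum : ∑ i, x i = ∑ i, y i + ∑ i, z i)
    (hz : ∀ l : Fin n, x (Fin.natAdd m l) ≤ z l) {A : Finset (Fin (m + n))} {C : Finset (Fin n)}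
    (h : LRU (Finset.univ.disjSum C) (A.map OrderDual.toDual.toEmbedding)
      (subWeight (Finset.univ \ (Finset.univ : Finset (Fin m)).disjSum C))
      (quotWeight (Finset.univ \ A.map OrderDual.toDual.toEmbedding))) :
    ∑ i, y i + ∑ i ∈ C, z i ≤ ∑ i ∈ A, x i := by
  have hs : LRU Finset.univ Finset.univ
      (Sum.elim (fun i : Fin m => x (Fin.castAdd n i)) fun l => x (Fin.natAdd m l))
      (x ∘ OrderDual.ofDual) :=
    lru_of_eq (fun t => OrderDual.toDual (finSumFinEquiv t))
      (OrderDual.toDual.injective.comp finSumFinEquiv.injective).injOn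
      (fun s => ⟨fun _ => ⟨finSumFinEquiv.symm (OrderDual.ofDual s), by simp⟩, by simp⟩)
      (by rintro (i | i) _ <;> simp)
  have h1 := sum_le_of_lru hx (fun _ _ hij => hx hij)
    (fun _ _ hij => hx (Nat.add_le_add_left hij m)) hs h
  have h2 := sum_eq_of_lru hs
  have h3 := Finset.sum_add_sum_compl C z
  have h4 := Finset.sum_add_sum_compl C fun l => x (Fin.natAdd m l)
  have h5 : ∑ l ∈ Cᶜ, x (Fin.natAdd m l) ≤ ∑ l ∈ Cᶜ, z l := Finset.sum_le_sum fun l _ => hz l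
  linarith

/-- The case where the index set of the second block is everything. -/
theorem sum_le_of_right_univ (hx : Antitone x) (hsum : ∑ i, x i = ∑ i, y i + ∑ i, z i)
    (hy : ∀ k : Fin m, x (Fin.cast (Nat.add_comm n m) (Fin.natAdd n k)) ≤ y k)
    {A : Finset (Fin (m + n))} {B : Finset (Fin m)}
    (h : LRU (B.disjSum Finset.univ) (A.map OrderDual.toDual.toEmbedding)
      (subWeight (Finset.univ \ B.disjSum (Finset.univ : Finset (Fin n))))
      (quotWeight (Finset.univ \ A.map OrderDual.toDual.toEmbedding))) :
    ∑ i ∈ B, y i + ∑ i, z i ≤ ∑ i ∈ A, x i := by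
  let e : Fin m ⊕ Fin n ≃ Fin (m + n) :=
    (Equiv.sumComm _ _).trans (finSumFinEquiv.trans (finCongr (Nat.add_comm n m)))
  have hs : LRU Finset.univ Finset.univ
      (Sum.elim (fun k : Fin m => x (Fin.cast (Nat.add_comm n m) (Fin.natAdd n k)))
        fun l : Fin n => x (Fin.castLE (Nat.le_add_left n m) l))
      (x ∘ OrderDual.ofDual) :=
    lru_of_eq (fun t => OrderDual.toDual (e t))
      (OrderDual.toDual.injective.comp e.injective).injOn
      (fun s => ⟨fun _ => ⟨e.symm (OrderDual.ofDual s), by simp⟩, by simp⟩)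
      (by rintro (i | i) _ <;> rfl)
  have h1 := sum_le_of_lru hx (fun _ _ hij => hx (Nat.add_le_add_left hij n))
    (fun _ _ hij => hx hij) hs h
  have h2 := sum_eq_of_lru hs
  have h3 := Finset.sum_add_sum_compl B y
  have h4 := Finset.sum_add_sum_compl B fun k => x (Fin.cast (Nat.add_comm n m) (Fin.natAdd n k))
  have h5 : ∑ k ∈ Bᶜ, x (Fin.cast (Nat.add_comm n m) (Fin.natAdd n k)) ≤ ∑ k ∈ Bᶜ, y k :=
    Finset.sum_le_sum fun k _ => hy k
  linarith

end Sufficiency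

theorem stmt_16 (m n : ℕ) (hm : 1 ≤ m) (hn : 1 ≤ n)
    (x : Fin (m + n) → ℝ) (hx : Antitone x)
    (y : Fin m → ℝ) (hy : Antitone y)
    (z : Fin n → ℝ) (hz : Antitone z) :
    (x, y, z) ∈ LRcone m n ↔
      ((∑ i, x i) = (∑ i, y i) + (∑ i, z i) ∧
       (∀ k : Fin m, x ⟨n + (k : ℕ), by have := k.isLt; omega⟩ ≤ y k ∧
          y k ≤ x (Fin.castLE (Nat.le_add_right m n) k)) ∧
       (∀ l : Fin n, x ⟨m + (l : ℕ), by have := l.isLt; omega⟩ ≤ z l ∧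
          z l ≤ x (Fin.castLE (Nat.le_add_left n m) l)) ∧
       ∀ (A : Finset (Fin (m + n))) (B : Finset (Fin m)) (C : Finset (Fin n)),
         B ≠ Finset.univ → C ≠ Finset.univ →
         ∀ hA : A.card = B.card + C.card,
           (muVec A hA, muVec B rfl, muVec C rfl) ∈ LRcone B.card C.card →
           (∑ i ∈ A, x i) ≥ (∑ i ∈ B, y i) + (∑ i ∈ C, z i)) := by
  constructor
  · intro h
    rw [mem_LRcone_iff_lru hx hy hz] at h
    exact ⟨sum_eq_of_lru h,
      fun k => ⟨le_left_of_lru hx hy hz h k, left_le_of_lru hx hy hz h k⟩,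
      fun l => ⟨le_right_of_lru hx hy hz h l, right_le_of_lru hx hy hz h l⟩,
      fun A B C _ _ hA hABC => sum_le_of_lru hx hy hz h ((lru_weights_iff A B C hA).2 hABC)⟩
  · rintro ⟨hsum, hxy, hxz, hhorn⟩
    rw [mem_LRcone_iff_lru hx hy hz]
    have hw : Antitone (Sum.elim y z) := antitone_sumElim hy hz
    refine lru_of_recursive (fun _ _ => rfl) hw hx.dual_left (by simp) ?_ ?_
    · rw [Fintype.sum_sum_type]
      exact hsum.symm
    · intro I' J' _ _ hc h'
      obtain ⟨B, C, rfl⟩ : ∃ B C, I' = B.disjSum C :=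
        ⟨I'.toLeft, I'.toRight, I'.toLeft_disjSum_toRight.symm⟩
      obtain ⟨A, rfl⟩ : ∃ A, J' = A.map OrderDual.toDual.toEmbedding :=
        ⟨J'.map OrderDual.ofDual.toEmbedding, by ext; simp⟩
      rw [Finset.card_disjSum, Finset.card_map] at hc
      suffices ∑ i ∈ B, y i + ∑ i ∈ C, z i ≤ ∑ i ∈ A, x i by
        simpa [Finset.sum_disjSum] using this
      by_cases hB : B = Finset.univ
      · subst hB
        exact sum_le_of_left_univ hx hsum (fun l => (hxz l).1) h'
      by_cases hC : C = Finset.univ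
      · subst hC
        exact sum_le_of_right_univ hx hsum (fun k => (hxy k).1) h'
      exact hhorn A B C hB hC hc.symm ((lru_weights_iff A B C hc.symm).1 h')
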